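/- arXiv:0712.2471 — 2 statements merged into one kernel-verified Lean document; each statement's English description precedes it below -/
import Mathlib

section
/- For 0 ≤ p ≤ 1/4, the quantum capacity of the depolarizing channel satisfies Q(N_p) ≤ co[f_1, f_2, f_3](p), where f_1(p) = 1 − H(p), f_2(p) = H((1−γ(p))/2) − H(γ(p)/2) with γ(p) = 4√(1−p)·(1 − √(1−p)), f_3(p) = 1 − 4p, and co[f_1,f_2,f_3] denotes the largest convex function on [0,1/4] that is pointwise less than or equal to each f_i. -/
open scoped Matrix Kronecker ComplexOrder

/-- A finite family of Kraus operators from input space `A` to output space `B`. -/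
structure KrausFamily (A B : Type) [Fintype A] [DecidableEq A] [Fintype B] [DecidableEq B] :
    Type 1 where
  ι : Type
  [fι : Fintype ι]
  [dι : DecidableEq ι]
  K : ι → Matrix B A ℂ

attribute [instance] KrausFamily.fι KrausFamily.dι

variable {A B : Type} [Fintype A] [DecidableEq A] [Fintype B] [DecidableEq B]

/-- The trace-preservation condition `Σ Kᵢ† Kᵢ = 1` making a Kraus family a quantum channel. -/
def KrausFamily.IsChannel (N : KrausFamily A B) : Prop :=
  ∑ i, (N.K i)ᴴ * N.K i = 1

/-- The action of a channel: `N(ρ) = Σ Kᵢ ρ Kᵢ†`. -/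
noncomputable def KrausFamily.apply (N : KrausFamily A B) (ρ : Matrix A A ℂ) : Matrix B B ℂ :=
  ∑ i, N.K i * ρ * (N.K i)ᴴ

/-- The complementary channel: `N̂(ρ)ᵢⱼ = Tr (Kᵢ ρ Kⱼ†)`. -/
noncomputable def KrausFamily.compl (N : KrausFamily A B) (ρ : Matrix A A ℂ) :
    Matrix N.ι N.ι ℂ :=
  Matrix.of fun i j => (N.K i * ρ * (N.K j)ᴴ).trace

/-- Von Neumann entropy, base 2: `S(ρ) = −Σ λⱼ log₂ λⱼ` over the eigenvalues of `ρ`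
(junk value `0` for non-Hermitian matrices). -/
noncomputable def vnEntropy {n : Type} [Fintype n] [DecidableEq n] (ρ : Matrix n n ℂ) : ℝ :=
  if h : ρ.IsHermitian then -∑ j, h.eigenvalues j * Real.logb 2 (h.eigenvalues j) else 0

/-- A density matrix: positive semidefinite with unit trace. -/
def IsDensity {n : Type} [Fintype n] (ρ : Matrix n n ℂ) : Prop :=
  ρ.PosSemidef ∧ ρ.trace = 1

/-- Coherent information of `N` at input `φ`: `I^c(N,φ) = S(N(φ)) − S(N̂(φ))`. -/
noncomputable def cohInfo (N : KrausFamily A B) (φ : Matrix A A ℂ) : ℝ :=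
  vnEntropy (N.apply φ) - vnEntropy (N.compl φ)

/-- One-shot quantum capacity: `Q^{(1)}(N) = sup_φ I^c(N,φ)` over density matrices `φ`. -/
noncomputable def Q1 (N : KrausFamily A B) : ℝ :=
  sSup {x | ∃ φ : Matrix A A ℂ, IsDensity φ ∧ x = cohInfo N φ}

/-- The `n`-th tensor power of a Kraus family, whose Kraus operators are all `n`-fold
Kronecker products of Kraus operators of `N`. -/
noncomputable def KrausFamily.pow (N : KrausFamily A B) (n : ℕ) :
    KrausFamily (Fin n → A) (Fin n → B) where
  ι := Fin n → N.ι
  K f := Matrix.of fun b a => ∏ i, N.K (f i) (b i) (a i)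

/-- Quantum capacity: `Q(N) = sup_{n ≥ 1} (1/n) Q^{(1)}(N^{⊗n})`. -/
noncomputable def Qcap (N : KrausFamily A B) : ℝ :=
  sSup {x | ∃ n : ℕ, 0 < n ∧ x = (1 / (n : ℝ)) * Q1 (N.pow n)}

/-- `N` is degradable if some channel `D` maps its output to its complementary output. -/
def KrausFamily.IsDegradable (N : KrausFamily A B) : Prop :=
  ∃ D : KrausFamily B N.ι, D.IsChannel ∧ ∀ ρ : Matrix A A ℂ, D.apply (N.apply ρ) = N.compl ρ

/-- `N` is antidegradable if some channel `D` maps its complementary output to its output. -/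
def KrausFamily.IsAntidegradable (N : KrausFamily A B) : Prop :=
  ∃ D : KrausFamily N.ι B, D.IsChannel ∧ ∀ ρ : Matrix A A ℂ, D.apply (N.compl ρ) = N.apply ρ

/-- Pauli `X`. -/
def PauliX : Matrix (Fin 2) (Fin 2) ℂ := !![0, 1; 1, 0]

/-- Pauli `Y`. -/
def PauliY : Matrix (Fin 2) (Fin 2) ℂ := !![0, -Complex.I; Complex.I, 0]

/-- Pauli `Z`. -/
def PauliZ : Matrix (Fin 2) (Fin 2) ℂ := !![1, 0; 0, -1]

/-- The depolarizing channel with error probability `p`: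
`N_p(ρ) = (1−p)ρ + (p/3)XρX + (p/3)YρY + (p/3)ZρZ`. -/
noncomputable def depol (p : ℝ) : KrausFamily (Fin 2) (Fin 2) where
  ι := Fin 4
  K := ![((Real.sqrt (1 - p) : ℝ) : ℂ) • 1,
        ((Real.sqrt (p / 3) : ℝ) : ℂ) • PauliX,
        ((Real.sqrt (p / 3) : ℝ) : ℂ) • PauliY,
        ((Real.sqrt (p / 3) : ℝ) : ℂ) • PauliZ]

/-- Binary entropy `H(x) = −x log₂ x − (1−x) log₂ (1−x)`. -/
noncomputable def binEnt (x : ℝ) : ℝ :=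
  -x * Real.logb 2 x - (1 - x) * Real.logb 2 (1 - x)

/-- The pointwise value at `x` of the largest function that is convex on `[0, 1/4]` and is
a pointwise lower bound on `[0, 1/4]` for every member of the family `F`. -/
noncomputable def convEnv (F : Set (ℝ → ℝ)) (x : ℝ) : ℝ :=
  sSup {y | ∃ g : ℝ → ℝ, ConvexOn ℝ (Set.Icc (0 : ℝ) (1 / 4)) g ∧
    (∀ z ∈ Set.Icc (0 : ℝ) (1 / 4), ∀ f ∈ F, g z ≤ f z) ∧ y = g x}

/-- `Δ(p)`: the minimum of `H(½(1+sin u sin v)) − H(½(1+cos u cos v))` over all real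
pairs `(u,v)` with `cos²(u/2) cos²(v/2) = 1 − p` and `|sin v| ≤ |cos u|`. -/
noncomputable def Δdep (p : ℝ) : ℝ :=
  sInf {y | ∃ u v : ℝ, Real.cos (u / 2) ^ 2 * Real.cos (v / 2) ^ 2 = 1 - p ∧
    |Real.sin v| ≤ |Real.cos u| ∧
    y = binEnt ((1 + Real.sin u * Real.sin v) / 2) -
        binEnt ((1 + Real.cos u * Real.cos v) / 2)}

set_option linter.unusedSectionVars false

/-- Comparison of logarithmic sums obtained by integrating a comparison of rational sums. -/
lemma sum_mul_log_sub_log_le {α β : Type*} [Fintype α] [Fintype β]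
    {a s r : α → ℝ} {a' s' r' : β → ℝ}
    (h : ∀ k, a k ≠ 0 → 0 < s k ∧ 0 < r k) (h' : ∀ k, a' k ≠ 0 → 0 < s' k ∧ 0 < r' k)
    (hsum : ∑ k, a k = ∑ k, a' k)
    (hle : ∀ t : ℝ, 0 < t →
      ∑ k, a k * (r k / (s k + t * r k)) ≤ ∑ k, a' k * (r' k / (s' k + t * r' k))) :
    ∑ k, a k * (Real.log (r k) - Real.log (s k)) ≤
      ∑ k, a' k * (Real.log (r' k) - Real.log (s' k)) := by
  have hderiv : ∀ (a s r : ℝ), (a ≠ 0 → 0 < s ∧ 0 < r) → ∀ t : ℝ, 0 ≤ t →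
      HasDerivAt (fun t => a * Real.log (s + t * r)) (a * (r / (s + t * r))) t := by
    intro a s r h t ht
    by_cases ha : a = 0
    · simpa [ha] using hasDerivAt_const t (0 : ℝ)
    · obtain ⟨hs, hr⟩ := h ha
      have hlin : HasDerivAt (fun t : ℝ => s + t * r) r t := by
        simpa using ((hasDerivAt_id t).mul_const r).const_add s
      exact (hlin.log (by positivity)).const_mul a
  have hlim : ∀ (a s r : ℝ), (a ≠ 0 → 0 < s ∧ 0 < r) →
      Filter.Tendsto (fun t : ℝ => a * Real.log (s + t * r) - a * Real.log t) Filter.atTop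
        (nhds (a * Real.log r)) := by
    intro a s r h
    by_cases ha : a = 0
    · simp [ha]
    · obtain ⟨hs, hr⟩ := h ha
      have h1 : Filter.Tendsto (fun t : ℝ => s / t + r) Filter.atTop (nhds r) := by
        simpa using (Filter.Tendsto.const_div_atTop Filter.tendsto_id s).add_const r
      have h2 := ((Real.continuousAt_log hr.ne').tendsto.comp h1).const_mul a
      refine h2.congr' ?_
      filter_upwards [Filter.eventually_gt_atTop 0] with t ht
      have : s / t + r = (s + t * r) / t := by field_simp
      simp only [Function.comp_apply]
      rw [this, Real.log_div (by positivity) ht.ne']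
      ring
  set F : ℝ → ℝ := fun t =>
    ∑ k, a' k * Real.log (s' k + t * r' k) - ∑ k, a k * Real.log (s k + t * r k) with hF
  have hFd : ∀ t, 0 ≤ t → HasDerivAt F (∑ k, a' k * (r' k / (s' k + t * r' k)) -
      ∑ k, a k * (r k / (s k + t * r k))) t := fun t ht =>
    (HasDerivAt.fun_sum fun k _ => hderiv _ _ _ (h' k) t ht).sub
      (HasDerivAt.fun_sum fun k _ => hderiv _ _ _ (h k) t ht)
  have hmono : MonotoneOn F (Set.Ici 0) := by
    refine monotoneOn_of_deriv_nonneg (convex_Ici 0)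
      (fun t ht => (hFd t ht).continuousAt.continuousWithinAt) ?_ ?_
    · intro t ht
      rw [interior_Ici] at ht
      exact (hFd t (le_of_lt ht)).differentiableAt.differentiableWithinAt
    · intro t ht
      rw [interior_Ici] at ht
      rw [(hFd t (le_of_lt ht)).deriv]
      exact sub_nonneg.mpr (hle t ht)
  have hFlim : Filter.Tendsto F Filter.atTop
      (nhds (∑ k, a' k * Real.log (r' k) - ∑ k, a k * Real.log (r k))) := by
    have h1 := (tendsto_finsetSum Finset.univ fun k _ => hlim _ _ _ (h' k)).sub
      (tendsto_finsetSum Finset.univ fun k _ => hlim _ _ _ (h k))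
    refine h1.congr fun t => ?_
    simp only [Finset.sum_sub_distrib, ← Finset.sum_mul, hsum, hF]
    ring
  have h0 : F 0 ≤ ∑ k, a' k * Real.log (r' k) - ∑ k, a k * Real.log (r k) := by
    refine ge_of_tendsto hFlim ?_
    filter_upwards [Filter.eventually_ge_atTop 0] with t ht
    exact hmono Set.self_mem_Ici ht ht
  simp only [hF, zero_mul, add_zero] at h0
  simp only [mul_sub, Finset.sum_sub_distrib]
  linarith

/-- `U` is unitary and `ρ = U diag(d) U†`. -/
structure IsSpec {n : Type} [Fintype n] [DecidableEq n] (ρ U : Matrix n n ℂ) (d : n → ℝ) :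
    Prop where
  star_mul : Uᴴ * U = 1
  eq : ρ = U * Matrix.diagonal (fun i => (d i : ℂ)) * Uᴴ

lemma Matrix.IsHermitian.exists_isSpec {n : Type} [Fintype n] [DecidableEq n]
    {ρ : Matrix n n ℂ} (h : ρ.IsHermitian) : ∃ U d, IsSpec ρ U d := by
  refine ⟨h.eigenvectorUnitary, h.eigenvalues, ?_, ?_⟩
  · exact Unitary.coe_star_mul_self h.eigenvectorUnitary
  · conv_lhs => rw [h.spectral_theorem, Unitary.conjStarAlgAut_apply]
    rfl

namespace IsSpec

variable {n m : Type} [Fintype n] [DecidableEq n] [Fintype m] [DecidableEq m]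
  {ρ U : Matrix n n ℂ} {d : n → ℝ}

lemma mul_star (h : IsSpec ρ U d) : U * Uᴴ = 1 := mul_eq_one_comm.mp h.star_mul

lemma isHermitian (h : IsSpec ρ U d) : ρ.IsHermitian := by
  rw [h.eq]
  refine Matrix.isHermitian_mul_mul_conjTranspose U ?_
  rw [Matrix.isHermitian_diagonal_iff]
  intro i
  exact Complex.conj_ofReal _

lemma conj_eq (h : IsSpec ρ U d) : Uᴴ * ρ * U = Matrix.diagonal (fun i => (d i : ℂ)) := by
  rw [h.eq]
  calc _ = (Uᴴ * U) * Matrix.diagonal (fun i => (d i : ℂ)) * (Uᴴ * U) := by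
        simp only [Matrix.mul_assoc]
    _ = _ := by rw [h.star_mul]; simp

lemma nonneg (h : IsSpec ρ U d) (hρ : ρ.PosSemidef) (i : n) : 0 ≤ d i := by
  have h1 : (Uᴴ * ρ * U).PosSemidef := hρ.conjTranspose_mul_mul_same U
  rw [h.conj_eq] at h1
  simpa using h1.diag_nonneg (i := i)

lemma trace_eq (h : IsSpec ρ U d) : ρ.trace = ∑ i, (d i : ℂ) := by
  rw [h.eq, Matrix.trace_mul_comm, ← Matrix.mul_assoc, h.star_mul, Matrix.one_mul,
    Matrix.trace_diagonal]

lemma charpoly_eq (h : IsSpec ρ U d) :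
    ρ.charpoly.roots = Finset.univ.val.map fun i => (d i : ℂ) := by
  rw [h.eq, Matrix.charpoly_mul_comm, ← Matrix.mul_assoc, h.star_mul, Matrix.one_mul,
    Matrix.charpoly_diagonal, Polynomial.roots_prod]
  · simp
  · simp [Finset.prod_ne_zero_iff, Polynomial.X_sub_C_ne_zero]

end IsSpec

lemma vnEntropy_eq_roots {n : Type} [Fintype n] [DecidableEq n] {ρ : Matrix n n ℂ}
    (h : ρ.IsHermitian) :
    vnEntropy ρ = -(ρ.charpoly.roots.map fun z => z.re * Real.logb 2 z.re).sum := by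
  rw [vnEntropy, dif_pos h, h.roots_charpoly_eq_eigenvalues, Multiset.map_map]
  rfl

lemma IsSpec.vnEntropy_eq {n : Type} [Fintype n] [DecidableEq n] {ρ U : Matrix n n ℂ} {d : n → ℝ}
    (h : IsSpec ρ U d) : vnEntropy ρ = -∑ i, d i * Real.logb 2 (d i) := by
  rw [vnEntropy_eq_roots h.isHermitian, h.charpoly_eq, Multiset.map_map]
  rfl

lemma vnEntropy_transpose {n : Type} [Fintype n] [DecidableEq n] {ρ : Matrix n n ℂ}
    (h : ρ.IsHermitian) : vnEntropy ρᵀ = vnEntropy ρ := by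
  rw [vnEntropy_eq_roots h, vnEntropy_eq_roots h.transpose, Matrix.charpoly_transpose]

lemma vnEntropy_mul_conjTranspose {n m : Type} [Fintype n] [DecidableEq n] [Fintype m]
    [DecidableEq m] (G : Matrix n m ℂ) : vnEntropy (G * Gᴴ) = vnEntropy (Gᴴ * G) := by
  rw [vnEntropy_eq_roots (Matrix.isHermitian_mul_conjTranspose_self G),
    vnEntropy_eq_roots (Matrix.isHermitian_conjTranspose_mul_self G)]
  have h := congrArg Polynomial.roots (Matrix.charpoly_mul_comm' G Gᴴ)
  rw [Polynomial.roots_mul (mul_ne_zero (by simp) (Matrix.charpoly_monic _).ne_zero),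
    Polynomial.roots_mul (mul_ne_zero (by simp) (Matrix.charpoly_monic _).ne_zero)] at h
  have h2 := congrArg (fun s => (Multiset.map (fun z : ℂ => z.re * Real.logb 2 z.re) s).sum) h
  simpa [Multiset.map_nsmul, Multiset.sum_nsmul] using h2

section relEnt

variable {H K : Type} [Fintype H] [DecidableEq H] [Fintype K] [DecidableEq K]

/-- The relative entropy `Tr ρ log ρ - Tr ρ log σ` (natural logarithm), where `r` lists the
eigenvalues of `ρ` and `σ = U diag(s) U†`. -/
noncomputable def relEnt (ρ : Matrix H H ℂ) (r : H → ℝ) (U : Matrix H H ℂ) (s : H → ℝ) : ℝ :=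
  ∑ j, r j * Real.log (r j) - ∑ i, ((Uᴴ * ρ * U) i i).re * Real.log (s i)

/-- A concave quadratic functional whose supremum over `X` is
`⟨ρ, (L_σ + t R_ρ)⁻¹ ρ⟩`. -/
noncomputable def quadFun (t : ℝ) (ρ σ X : Matrix H H ℂ) : ℝ :=
  2 * (Xᴴ * ρ).trace.re - (Xᴴ * σ * X).trace.re - t * (X * ρ * Xᴴ).trace.re

variable {ρ σ U V : Matrix H H ℂ} {r s : H → ℝ}

lemma IsSpec.conj_apply_self (hρ : IsSpec ρ V r) (U : Matrix H H ℂ) (i : H) :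
    ((Uᴴ * ρ * U) i i).re = ∑ j, Complex.normSq ((Uᴴ * V) i j) * r j := by
  have : Uᴴ * ρ * U = (Uᴴ * V) * Matrix.diagonal (fun i => (r i : ℂ)) * (Uᴴ * V)ᴴ := by
    rw [hρ.eq]
    simp only [Matrix.mul_assoc, Matrix.conjTranspose_mul, Matrix.conjTranspose_conjTranspose]
  rw [this, Matrix.mul_apply, Complex.re_sum]
  refine Finset.sum_congr rfl fun j _ => ?_
  rw [Matrix.mul_diagonal, Matrix.conjTranspose_apply, mul_right_comm]
  rw [Complex.star_def, Complex.mul_conj, ← Complex.ofReal_mul, Complex.ofReal_re]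

lemma IsSpec.sum_normSq (hρ : IsSpec ρ V r) (hσ : IsSpec σ U s) (j : H) :
    ∑ i, Complex.normSq ((Uᴴ * V) i j) = 1 := by
  have h : (Uᴴ * V)ᴴ * (Uᴴ * V) = 1 := by
    rw [Matrix.conjTranspose_mul, Matrix.conjTranspose_conjTranspose]
    calc _ = Vᴴ * (U * Uᴴ) * V := by simp only [Matrix.mul_assoc]
      _ = 1 := by rw [hσ.mul_star, Matrix.mul_one, hρ.star_mul]
  have h2 := congrFun (congrFun h j) j
  rw [Matrix.mul_apply, Matrix.one_apply_eq] at h2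
  simp only [Matrix.conjTranspose_apply, Complex.star_def, ← Complex.normSq_eq_conj_mul_self] at h2
  exact_mod_cast h2

lemma relEnt_eq_sum (hρ : IsSpec ρ V r) (hσ : IsSpec σ U s) :
    relEnt ρ r U s = ∑ k : H × H, (Complex.normSq ((Uᴴ * V) k.1 k.2) * r k.2) *
      (Real.log (r k.2) - Real.log (s k.1)) := by
  rw [relEnt, Fintype.sum_prod_type]
  simp only [mul_sub, Finset.sum_sub_distrib]
  congr 1
  · rw [Finset.sum_comm]
    refine Finset.sum_congr rfl fun j _ => ?_
    simp only [mul_assoc]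
    rw [← Finset.sum_mul, hρ.sum_normSq hσ, one_mul]
  · refine Finset.sum_congr rfl fun i _ => ?_
    rw [hρ.conj_apply_self, Finset.sum_mul]

lemma sum_weights_eq_trace (hρ : IsSpec ρ V r) (hσ : IsSpec σ U s) :
    ∑ k : H × H, Complex.normSq ((Uᴴ * V) k.1 k.2) * r k.2 = ρ.trace.re := by
  rw [Fintype.sum_prod_type, Finset.sum_comm, hρ.trace_eq, Complex.re_sum]
  refine Finset.sum_congr rfl fun j _ => ?_
  dsimp only
  rw [← Finset.sum_mul, hρ.sum_normSq hσ, one_mul, Complex.ofReal_re]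

lemma pos_of_weight_ne_zero (hρ : IsSpec ρ V r) (hσ : IsSpec σ U s) (hρ0 : ρ.PosSemidef)
    (hσ0 : σ.PosSemidef) {c : ℝ} (hc : (c • σ - ρ).PosSemidef) (k : H × H)
    (hk : Complex.normSq ((Uᴴ * V) k.1 k.2) * r k.2 ≠ 0) : 0 < s k.1 ∧ 0 < r k.2 := by
  obtain ⟨i, j⟩ := k
  have hr := hρ.nonneg hρ0
  have hs := hσ.nonneg hσ0
  refine ⟨lt_of_le_of_ne (hs i) fun h0 => hk ?_, lt_of_le_of_ne (hr j) fun h0 => hk ?_⟩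
  · have h1 := (hc.conjTranspose_mul_mul_same U).diag_nonneg (i := i)
    have h2 : Uᴴ * (c • σ - ρ) * U = c • (Uᴴ * σ * U) - Uᴴ * ρ * U := by
      simp [Matrix.mul_sub, Matrix.sub_mul]
    rw [h2, hσ.conj_eq] at h1
    have h3 := (Complex.nonneg_iff.mp h1).1
    simp only [Matrix.sub_apply, Matrix.smul_apply, Matrix.diagonal_apply_eq, ← h0,
      Complex.ofReal_zero, smul_zero, zero_sub, Complex.neg_re] at h3
    rw [hρ.conj_apply_self] at h3
    have h4 : ∀ j, 0 ≤ Complex.normSq ((Uᴴ * V) i j) * r j :=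
      fun j => mul_nonneg (Complex.normSq_nonneg _) (hr j)
    have h5 := Finset.single_le_sum (fun j _ => h4 j) (Finset.mem_univ j)
    have h6 := h4 j
    simp only at *
    linarith
  · simp only at h0 ⊢
    rw [← h0, mul_zero]

lemma quadFun_eq_sum (hρ : IsSpec ρ V r) (hσ : IsSpec σ U s) (t : ℝ) (x : Matrix H H ℂ) :
    quadFun t ρ σ (U * x * Vᴴ) = ∑ k : H × H,
      (2 * (star (x k.1 k.2) * (Uᴴ * V) k.1 k.2).re * r k.2 -
        Complex.normSq (x k.1 k.2) * (s k.1 + t * r k.2)) := by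
  have e1 : ((U * x * Vᴴ)ᴴ * ρ).trace =
      (xᴴ * ((Uᴴ * V) * Matrix.diagonal (fun i => (r i : ℂ)))).trace := by
    rw [hρ.eq]
    simp only [Matrix.conjTranspose_mul, Matrix.conjTranspose_conjTranspose, Matrix.mul_assoc]
    rw [Matrix.trace_mul_comm]
    simp only [Matrix.mul_assoc, hρ.star_mul, Matrix.mul_one]
  have e2 : ((U * x * Vᴴ)ᴴ * σ * (U * x * Vᴴ)).trace =
      (xᴴ * (Matrix.diagonal (fun i => (s i : ℂ)) * x)).trace := by
    rw [← hσ.conj_eq]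
    simp only [Matrix.conjTranspose_mul, Matrix.conjTranspose_conjTranspose, Matrix.mul_assoc]
    rw [Matrix.trace_mul_comm]
    simp only [Matrix.mul_assoc, hρ.star_mul, Matrix.mul_one]
  have e3 : ((U * x * Vᴴ) * ρ * (U * x * Vᴴ)ᴴ).trace =
      ((x * Matrix.diagonal (fun i => (r i : ℂ))) * xᴴ).trace := by
    rw [← hρ.conj_eq]
    simp only [Matrix.conjTranspose_mul, Matrix.conjTranspose_conjTranspose, Matrix.mul_assoc]
    rw [Matrix.trace_mul_comm]
    simp only [Matrix.mul_assoc, hσ.star_mul, Matrix.mul_one]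
  have f1 : (xᴴ * ((Uᴴ * V) * Matrix.diagonal (fun i => (r i : ℂ)))).trace.re =
      ∑ i, ∑ j, (star (x i j) * (Uᴴ * V) i j).re * r j := by
    simp only [Matrix.trace, Matrix.diag, Matrix.mul_apply (M := xᴴ), Matrix.mul_diagonal,
      Matrix.conjTranspose_apply, Complex.re_sum, ← mul_assoc, Complex.re_mul_ofReal]
    exact Finset.sum_comm
  have f2 : (xᴴ * (Matrix.diagonal (fun i => (s i : ℂ)) * x)).trace.re =
      ∑ i, ∑ j, Complex.normSq (x i j) * s i := by
    simp only [Matrix.trace, Matrix.diag, Matrix.mul_apply (M := xᴴ), Matrix.diagonal_mul,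
      Matrix.conjTranspose_apply, Complex.re_sum]
    rw [Finset.sum_comm]
    refine Finset.sum_congr rfl fun i _ => Finset.sum_congr rfl fun j _ => ?_
    rw [mul_left_comm, Complex.star_def, ← Complex.normSq_eq_conj_mul_self, mul_comm,
      ← Complex.ofReal_mul, Complex.ofReal_re]
  have f3 : ((x * Matrix.diagonal (fun i => (r i : ℂ))) * xᴴ).trace.re =
      ∑ i, ∑ j, Complex.normSq (x i j) * r j := by
    simp only [Matrix.trace, Matrix.diag, Matrix.mul_apply (N := xᴴ), Matrix.mul_diagonal,
      Matrix.conjTranspose_apply, Complex.re_sum]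
    refine Finset.sum_congr rfl fun i _ => Finset.sum_congr rfl fun j _ => ?_
    rw [mul_right_comm, Complex.star_def, Complex.mul_conj,
      ← Complex.ofReal_mul, Complex.ofReal_re]
  rw [quadFun, e1, e2, e3, f1, f2, f3, Fintype.sum_prod_type]
  simp only [Finset.mul_sum, ← Finset.sum_sub_distrib]
  refine Finset.sum_congr rfl fun i _ => Finset.sum_congr rfl fun j _ => ?_
  ring

lemma quadFun_le (hρ : IsSpec ρ V r) (hσ : IsSpec σ U s) (hρ0 : ρ.PosSemidef)
    (hσ0 : σ.PosSemidef) {t : ℝ} (ht : 0 < t) (X : Matrix H H ℂ) :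
    quadFun t ρ σ X ≤ ∑ k : H × H,
      (Complex.normSq ((Uᴴ * V) k.1 k.2) * r k.2) * (r k.2 / (s k.1 + t * r k.2)) := by
  have hX : X = U * (Uᴴ * X * V) * Vᴴ := by
    calc X = (U * Uᴴ) * X * (V * Vᴴ) := by rw [hσ.mul_star, hρ.mul_star]; simp
      _ = _ := by simp only [Matrix.mul_assoc]
  rw [hX, quadFun_eq_sum hρ hσ]
  refine Finset.sum_le_sum fun k _ => ?_
  obtain ⟨i, j⟩ := k
  have hr := hρ.nonneg hρ0 j
  have hs := hσ.nonneg hσ0 i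
  generalize (Uᴴ * X * V) i j = x
  generalize (Uᴴ * V) i j = m
  simp only [Complex.star_def, Complex.mul_re, Complex.conj_re, Complex.conj_im,
    Complex.normSq_apply]
  rcases hr.eq_or_lt with h0 | h0
  · rw [← h0]
    have : 0 ≤ (x.re * x.re + x.im * x.im) * s i :=
      mul_nonneg (add_nonneg (mul_self_nonneg _) (mul_self_nonneg _)) hs
    simpa using this
  · have hD : 0 < s i + t * r j := by positivity
    rw [← sub_nonneg]
    have : (m.re * m.re + m.im * m.im) * r j * (r j / (s i + t * r j)) -
        (2 * (x.re * m.re - -x.im * m.im) * r j -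
          (x.re * x.re + x.im * x.im) * (s i + t * r j)) =
        ((m.re * r j - x.re * (s i + t * r j)) ^ 2 +
          (m.im * r j - x.im * (s i + t * r j)) ^ 2) / (s i + t * r j) := by
      field_simp
      ring
    rw [this]
    positivity

lemma exists_quadFun_eq (hρ : IsSpec ρ V r) (hσ : IsSpec σ U s) (hρ0 : ρ.PosSemidef)
    (hσ0 : σ.PosSemidef) {t : ℝ} (ht : 0 < t) :
    ∃ X, quadFun t ρ σ X = ∑ k : H × H,
      (Complex.normSq ((Uᴴ * V) k.1 k.2) * r k.2) * (r k.2 / (s k.1 + t * r k.2)) := by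
  refine ⟨U * (Matrix.of fun i j => (Uᴴ * V) i j * ((r j / (s i + t * r j) : ℝ) : ℂ)) * Vᴴ, ?_⟩
  rw [quadFun_eq_sum hρ hσ]
  refine Finset.sum_congr rfl fun k _ => ?_
  obtain ⟨i, j⟩ := k
  have hr := hρ.nonneg hρ0 j
  have hs := hσ.nonneg hσ0 i
  simp only [Matrix.of_apply]
  generalize (Uᴴ * V) i j = m
  simp only [Complex.star_def, Complex.mul_re, Complex.conj_re, Complex.conj_im,
    Complex.normSq_apply, Complex.mul_im, Complex.ofReal_re, Complex.ofReal_im]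
  rcases hr.eq_or_lt with h0 | h0
  · rw [← h0]; simp
  · have hD : 0 < s i + t * r j := by positivity
    field_simp
    ring

namespace KrausFamily

lemma trace_mul_apply (L : KrausFamily H K) (Y : Matrix K K ℂ) (ρ : Matrix H H ℂ) :
    (Y * L.apply ρ).trace = ((∑ k, (L.K k)ᴴ * Y * L.K k) * ρ).trace := by
  simp only [apply, Matrix.mul_sum, Matrix.sum_mul, Matrix.trace_sum]
  refine Finset.sum_congr rfl fun k _ => ?_
  simp only [← Matrix.mul_assoc]
  rw [Matrix.trace_mul_comm]
  simp only [Matrix.mul_assoc]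

lemma posSemidef_apply (L : KrausFamily H K) (hρ : ρ.PosSemidef) : (L.apply ρ).PosSemidef :=
  Matrix.posSemidef_sum _ fun _ _ => hρ.mul_mul_conjTranspose_same _

lemma trace_apply {L : KrausFamily H K} (hL : L.IsChannel) (ρ : Matrix H H ℂ) :
    (L.apply ρ).trace = ρ.trace := by
  have h := L.trace_mul_apply 1 ρ
  simp only [Matrix.one_mul, Matrix.mul_one] at h
  rw [h, show ∑ k, (L.K k)ᴴ * L.K k = 1 from hL, Matrix.one_mul]

/-- Kadison's inequality `Tr Φ*(Y)† ρ Φ*(Y) ≤ Tr Y† Φ(ρ) Y`. -/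
lemma kadison {L : KrausFamily H K} (hL : L.IsChannel) (hρ : ρ.PosSemidef) (Y : Matrix K K ℂ) :
    ((∑ k, (L.K k)ᴴ * Y * L.K k)ᴴ * ρ * (∑ k, (L.K k)ᴴ * Y * L.K k)).trace.re ≤
      (Yᴴ * L.apply ρ * Y).trace.re := by
  set X := ∑ k, (L.K k)ᴴ * Y * L.K k with hX
  have key : (∑ k, (Yᴴ * L.K k - L.K k * Xᴴ) * ρ * (Yᴴ * L.K k - L.K k * Xᴴ)ᴴ).trace =
      (Yᴴ * L.apply ρ * Y).trace - (Xᴴ * ρ * X).trace := by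
    have h1 : ∀ k, ((Yᴴ * L.K k - L.K k * Xᴴ) * ρ * (Yᴴ * L.K k - L.K k * Xᴴ)ᴴ).trace =
        (Yᴴ * (L.K k * ρ * (L.K k)ᴴ) * Y).trace - (((L.K k)ᴴ * Y * L.K k) * (Xᴴ * ρ)).trace
        - (((L.K k)ᴴ * Yᴴ * L.K k) * (ρ * X)).trace
        + (((L.K k)ᴴ * L.K k) * (Xᴴ * ρ * X)).trace := by
      intro k
      simp only [Matrix.conjTranspose_sub, Matrix.conjTranspose_mul,
        Matrix.conjTranspose_conjTranspose, Matrix.sub_mul, Matrix.mul_sub, Matrix.trace_sub]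
      have a1 : (L.K k * Xᴴ * ρ * ((L.K k)ᴴ * Y)).trace =
          (((L.K k)ᴴ * Y * L.K k) * (Xᴴ * ρ)).trace := by
        rw [Matrix.trace_mul_comm]; simp only [Matrix.mul_assoc]
      have a2 : (Yᴴ * L.K k * ρ * (X * (L.K k)ᴴ)).trace =
          (((L.K k)ᴴ * Yᴴ * L.K k) * (ρ * X)).trace := by
        rw [← Matrix.mul_assoc, Matrix.trace_mul_comm]; simp only [Matrix.mul_assoc]
      have a3 : (L.K k * Xᴴ * ρ * (X * (L.K k)ᴴ)).trace =
          (((L.K k)ᴴ * L.K k) * (Xᴴ * ρ * X)).trace := by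
        rw [← Matrix.mul_assoc, Matrix.trace_mul_comm]; simp only [Matrix.mul_assoc]
      rw [a1, a2, a3]
      simp only [Matrix.mul_assoc]
      ring
    rw [Matrix.trace_sum, Finset.sum_congr rfl fun k _ => h1 k]
    simp only [Finset.sum_add_distrib, Finset.sum_sub_distrib, ← Matrix.trace_sum,
      ← Matrix.sum_mul, ← Matrix.mul_sum]
    have hXs : ∑ k, (L.K k)ᴴ * Yᴴ * L.K k = Xᴴ := by
      simp [hX, Matrix.conjTranspose_sum, Matrix.conjTranspose_mul, Matrix.mul_assoc]
    rw [hXs, ← hX, show ∑ k, (L.K k)ᴴ * L.K k = 1 from hL, Matrix.one_mul,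
      Matrix.trace_mul_comm X]
    simp only [← Matrix.mul_assoc, apply]
    ring
  have hpos : (∑ k, (Yᴴ * L.K k - L.K k * Xᴴ) * ρ * (Yᴴ * L.K k - L.K k * Xᴴ)ᴴ).PosSemidef :=
    Matrix.posSemidef_sum _ fun _ _ => hρ.mul_mul_conjTranspose_same _
  have := (Complex.nonneg_iff.mp hpos.trace_nonneg).1
  rw [key, Complex.sub_re] at this
  linarith

end KrausFamily

/-- Joint convexity together with monotonicity under channels of the relative entropy. -/
theorem relEnt_mono {S : Type} [Fintype S] {w : S → ℝ} (hw : ∀ a, 0 ≤ w a)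
    {L : S → KrausFamily H K} (hL : ∀ a, (L a).IsChannel)
    {ρ σ U V : S → Matrix H H ℂ} {r s : S → H → ℝ}
    (hρ : ∀ a, IsSpec (ρ a) (V a) (r a)) (hσ : ∀ a, IsSpec (σ a) (U a) (s a))
    (hρ0 : ∀ a, (ρ a).PosSemidef) (hσ0 : ∀ a, (σ a).PosSemidef)
    {c : ℝ} (hc : ∀ a, (c • σ a - ρ a).PosSemidef)
    {ρ' σ' U' V' : Matrix K K ℂ} {r' s' : K → ℝ}
    (hρ' : IsSpec ρ' V' r') (hσ' : IsSpec σ' U' s')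
    (eρ : ρ' = ∑ a, (w a : ℂ) • (L a).apply (ρ a)) (eσ : σ' = ∑ a, (w a : ℂ) • (L a).apply (σ a)) :
    relEnt ρ' r' U' s' ≤ ∑ a, w a * relEnt (ρ a) (r a) (U a) (s a) := by
  have hwc : ∀ a, (0 : ℂ) ≤ w a := fun a => by exact_mod_cast hw a
  have hρ'0 : ρ'.PosSemidef := by
    rw [eρ]
    exact Matrix.posSemidef_sum _ fun a _ => ((L a).posSemidef_apply (hρ0 a)).smul (hwc a)
  have hσ'0 : σ'.PosSemidef := by
    rw [eσ]
    exact Matrix.posSemidef_sum _ fun a _ => ((L a).posSemidef_apply (hσ0 a)).smul (hwc a)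
  have hc' : (c • σ' - ρ').PosSemidef := by
    have : c • σ' - ρ' = ∑ a, (w a : ℂ) • (L a).apply (c • σ a - ρ a) := by
      rw [eσ, eρ, Finset.smul_sum, ← Finset.sum_sub_distrib]
      refine Finset.sum_congr rfl fun a _ => ?_
      rw [smul_comm, ← smul_sub]
      congr 1
      simp [KrausFamily.apply, Matrix.mul_sub, Matrix.sub_mul, Finset.smul_sum]
    rw [this]
    exact Matrix.posSemidef_sum _ fun a _ => ((L a).posSemidef_apply (hc a)).smul (hwc a)
  have hRHS : ∑ a, w a * relEnt (ρ a) (r a) (U a) (s a) = ∑ k : S × (H × H),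
      (w k.1 * (Complex.normSq (((U k.1)ᴴ * V k.1) k.2.1 k.2.2) * r k.1 k.2.2)) *
        (Real.log (r k.1 k.2.2) - Real.log (s k.1 k.2.1)) := by
    rw [Fintype.sum_prod_type]
    refine Finset.sum_congr rfl fun a _ => ?_
    rw [relEnt_eq_sum (hρ a) (hσ a), Finset.mul_sum]
    simp only [mul_assoc]
  rw [hRHS, relEnt_eq_sum hρ' hσ']
  refine sum_mul_log_sub_log_le (fun k hk => pos_of_weight_ne_zero hρ' hσ' hρ'0 hσ'0 hc' k hk)
    (fun k hk => pos_of_weight_ne_zero (hρ k.1) (hσ k.1) (hρ0 k.1) (hσ0 k.1) (hc k.1) k.2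
      (right_ne_zero_of_mul hk)) ?_ ?_
  · rw [sum_weights_eq_trace hρ' hσ', Fintype.sum_prod_type, eρ, Matrix.trace_sum, Complex.re_sum]
    refine Finset.sum_congr rfl fun a _ => ?_
    rw [Matrix.trace_smul, KrausFamily.trace_apply (hL a), smul_eq_mul, Complex.re_ofReal_mul,
      ← sum_weights_eq_trace (hρ a) (hσ a), Finset.mul_sum]
  · intro t ht
    obtain ⟨Y, hY⟩ := exists_quadFun_eq hρ' hσ' hρ'0 hσ'0 ht
    rw [← hY, Fintype.sum_prod_type]
    have hterm : quadFun t ρ' σ' Y =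
        ∑ a, w a * quadFun t ((L a).apply (ρ a)) ((L a).apply (σ a)) Y := by
      simp only [quadFun, eρ, eσ, Matrix.sum_mul, Matrix.trace_sum,
        Complex.re_sum, Matrix.mul_smul, Matrix.smul_mul, Matrix.trace_smul, smul_eq_mul,
        Complex.re_ofReal_mul, Finset.mul_sum, ← Finset.sum_sub_distrib]
      refine Finset.sum_congr rfl fun a _ => ?_
      ring
    rw [hterm]
    refine Finset.sum_le_sum fun a _ => ?_
    simp only [mul_assoc (w a), ← Finset.mul_sum]
    refine mul_le_mul_of_nonneg_left ?_ (hw a)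
    set X := ∑ k, ((L a).K k)ᴴ * Y * (L a).K k with hX
    refine le_trans ?_ (quadFun_le (hρ a) (hσ a) (hρ0 a) (hσ0 a) ht X)
    have h1 := KrausFamily.kadison (hL a) (hσ0 a) Y
    have h2 := KrausFamily.kadison (hL a) (hρ0 a) Yᴴ
    have hXs : ∑ k, ((L a).K k)ᴴ * Yᴴ * (L a).K k = Xᴴ := by
      simp [hX, Matrix.conjTranspose_sum, Matrix.conjTranspose_mul, Matrix.mul_assoc]
    rw [hXs] at h2
    rw [← hX] at h1
    simp only [Matrix.conjTranspose_conjTranspose] at h2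
    have h3 := (L a).trace_mul_apply Yᴴ (ρ a)
    rw [hXs] at h3
    rw [quadFun, quadFun, h3]
    have := mul_le_mul_of_nonneg_left h2 ht.le
    linarith

end relEnt

section CoherentInformation

variable {C R : Type} [Fintype C] [DecidableEq C] [Fintype R] [DecidableEq R]

lemma Matrix.posSemidef_card_smul_sum_sub {m n : Type} [Fintype m] [Fintype n]
    (W : R → Matrix m n ℂ) :
    ((Fintype.card R : ℝ) • ∑ q, W q * (W q)ᴴ - (∑ q, W q) * (∑ q, W q)ᴴ).PosSemidef := by
  have key : (Fintype.card R : ℝ) • ∑ q, W q * (W q)ᴴ - (∑ q, W q) * (∑ q, W q)ᴴ =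
      (1 / 2 : ℝ) • ∑ q, ∑ q', (W q - W q') * (W q - W q')ᴴ := by
    have h1 : ∑ q, ∑ q', (W q - W q') * (W q - W q')ᴴ =
        (2 : ℝ) • ((Fintype.card R : ℝ) • ∑ q, W q * (W q)ᴴ - (∑ q, W q) * (∑ q, W q)ᴴ) := by
      simp only [Matrix.conjTranspose_sub, Matrix.sub_mul, Matrix.mul_sub,
        Finset.sum_sub_distrib, Finset.sum_const, Finset.card_univ, ← Matrix.mul_sum,
        ← Matrix.sum_mul, ← Matrix.conjTranspose_sum, ← Finset.smul_sum, two_smul,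
        Nat.cast_smul_eq_nsmul]
      abel
    rw [h1, smul_smul]
    norm_num
  rw [key]
  exact (Matrix.posSemidef_sum _ fun q _ => Matrix.posSemidef_sum _ fun q' _ =>
    Matrix.posSemidef_self_mul_conjTranspose _).smul (by norm_num)

lemma Matrix.PosSemidef.exists_eq_mul_conjTranspose {φ : Matrix A A ℂ} (hφ : φ.PosSemidef) :
    ∃ ψ : Matrix A A ℂ, φ = ψ * ψᴴ := by
  obtain ⟨U, d, hU⟩ := hφ.isHermitian.exists_isSpec
  refine ⟨U * Matrix.diagonal fun i => ((Real.sqrt (d i) : ℝ) : ℂ), ?_⟩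
  have hd : (Matrix.diagonal fun i => ((Real.sqrt (d i) : ℝ) : ℂ)) *
      (Matrix.diagonal fun i => ((Real.sqrt (d i) : ℝ) : ℂ))ᴴ =
        Matrix.diagonal fun i => (d i : ℂ) := by
    rw [Matrix.diagonal_conjTranspose, Matrix.diagonal_mul_diagonal]
    congr 1
    ext i
    simp only [Pi.star_apply, Complex.star_def, Complex.conj_ofReal]
    rw [← Complex.ofReal_mul, Real.mul_self_sqrt (hU.nonneg hφ i)]
  calc φ = U * Matrix.diagonal (fun i => (d i : ℂ)) * Uᴴ := hU.eq
    _ = _ := by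
      rw [← hd]
      simp only [Matrix.conjTranspose_mul, Matrix.mul_assoc]

lemma IsSpec.kronecker_one {σ U : Matrix B B ℂ} {s : B → ℝ} (h : IsSpec σ U s) :
    IsSpec (σ ⊗ₖ (1 : Matrix R R ℂ)) (U ⊗ₖ (1 : Matrix R R ℂ)) (fun x => s x.1) := by
  constructor
  · rw [Matrix.conjTranspose_kronecker, ← Matrix.mul_kronecker_mul, h.star_mul]
    simp
  · have : Matrix.diagonal (fun x : B × R => ((s x.1 : ℝ) : ℂ)) =
        Matrix.diagonal (fun i => (s i : ℂ)) ⊗ₖ (1 : Matrix R R ℂ) := by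
      rw [← Matrix.diagonal_one, Matrix.diagonal_kronecker_diagonal]
      simp
    rw [this, Matrix.conjTranspose_kronecker, ← Matrix.mul_kronecker_mul,
      ← Matrix.mul_kronecker_mul, ← h.eq]
    simp

namespace KrausFamily

/-- The Kraus operators applied to `ψ`, vectorised and stacked as columns. -/
def stack (N : KrausFamily A B) (ψ : Matrix A R ℂ) : Matrix (B × R) N.ι ℂ :=
  Matrix.of fun x i => (N.K i * ψ) x.1 x.2

lemma stack_mul_conjTranspose_apply (N : KrausFamily A B) (ψ : Matrix A R ℂ) (x y : B × R) :
    (N.stack ψ * (N.stack ψ)ᴴ) x y =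
      N.apply (Matrix.vecMulVec (ψ.col x.2) (star (ψ.col y.2))) x.1 y.1 := by
  simp only [apply, Matrix.mul_apply (M := N.stack ψ), Matrix.sum_apply]
  refine Finset.sum_congr rfl fun i _ => ?_
  rw [Matrix.mul_vecMulVec, Matrix.vecMulVec_mul, Matrix.vecMulVec_apply,
    ← Matrix.star_mulVec]
  rfl

lemma sum_stack (N : KrausFamily A B) (ψ : Matrix A R ℂ) (b b' : B) :
    ∑ q, (N.stack ψ * (N.stack ψ)ᴴ) (b, q) (b', q) = N.apply (ψ * ψᴴ) b b' := by
  simp only [apply, Matrix.mul_apply (M := N.stack ψ), Matrix.sum_apply]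
  rw [Finset.sum_comm]
  refine Finset.sum_congr rfl fun i _ => ?_
  have : N.K i * (ψ * ψᴴ) * (N.K i)ᴴ = (N.K i * ψ) * (N.K i * ψ)ᴴ := by
    simp only [Matrix.conjTranspose_mul, Matrix.mul_assoc]
  rw [this, Matrix.mul_apply]
  rfl

lemma compl_eq_stack (N : KrausFamily A B) (ψ : Matrix A R ℂ) :
    N.compl (ψ * ψᴴ) = ((N.stack ψ)ᴴ * N.stack ψ)ᵀ := by
  ext i j
  have : N.K i * (ψ * ψᴴ) * (N.K j)ᴴ = (N.K i * ψ) * (N.K j * ψ)ᴴ := by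
    simp only [Matrix.conjTranspose_mul, Matrix.mul_assoc]
  rw [compl, Matrix.of_apply, this, Matrix.transpose_apply, Matrix.mul_apply,
    Fintype.sum_prod_type]
  simp only [Matrix.trace, Matrix.diag, Matrix.mul_apply (M := N.K i * ψ)]
  refine Finset.sum_congr rfl fun b _ => Finset.sum_congr rfl fun q _ => ?_
  rw [mul_comm]
  rfl

lemma vnEntropy_compl (N : KrausFamily A B) (ψ : Matrix A R ℂ) :
    vnEntropy (N.compl (ψ * ψᴴ)) = vnEntropy (N.stack ψ * (N.stack ψ)ᴴ) := by
  rw [compl_eq_stack, vnEntropy_transpose (Matrix.isHermitian_conjTranspose_mul_self _),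
    vnEntropy_mul_conjTranspose]

lemma posSemidef_card_smul_sub_stack (N : KrausFamily A B) (ψ : Matrix A R ℂ) :
    ((Fintype.card R : ℝ) • (N.apply (ψ * ψᴴ) ⊗ₖ (1 : Matrix R R ℂ)) -
      N.stack ψ * (N.stack ψ)ᴴ).PosSemidef := by
  set Z : R → R → Matrix (B × R) N.ι ℂ := fun q q' =>
    Matrix.of fun x i => if x.2 = q' then N.stack ψ (x.1, q) i else 0 with hZ
  have e1 : N.stack ψ = ∑ q, Z q q := by
    ext x i
    simp [hZ, Matrix.sum_apply]
  have e2 : N.apply (ψ * ψᴴ) ⊗ₖ (1 : Matrix R R ℂ) = ∑ q, ∑ q', Z q q' * (Z q q')ᴴ := by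
    ext x y
    obtain ⟨b, a⟩ := x
    obtain ⟨b', a'⟩ := y
    rw [Matrix.kronecker_apply, ← N.sum_stack ψ, Finset.sum_mul, Matrix.sum_apply]
    refine Finset.sum_congr rfl fun q _ => ?_
    rw [Matrix.sum_apply]
    by_cases h : a = a'
    · subst h
      simp [hZ, Matrix.mul_apply]
    · have h2 : ∀ q', (if a = q' then (1 : ℂ) else 0) * (if a' = q' then 1 else 0) = 0 := by
        intro q'
        by_cases h3 : a = q'
        · subst h3; simp [Ne.symm h]
        · simp [h3]
      simp only [Matrix.one_apply_ne h, mul_zero]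
      symm
      refine Finset.sum_eq_zero fun q' _ => ?_
      rw [Matrix.mul_apply]
      refine Finset.sum_eq_zero fun i _ => ?_
      simp only [hZ, Matrix.of_apply, Matrix.conjTranspose_apply]
      by_cases h3 : a = q'
      · subst h3; simp [Ne.symm h]
      · simp [h3]
  have e3 : ∑ q, ∑ q', Z q q' * (Z q q')ᴴ = ∑ q, Z q q * (Z q q)ᴴ +
      ∑ q, ∑ q' ∈ Finset.univ.erase q, Z q q' * (Z q q')ᴴ := by
    rw [← Finset.sum_add_distrib]
    refine Finset.sum_congr rfl fun q _ => ?_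
    rw [Finset.add_sum_erase _ (fun q' => Z q q' * (Z q q')ᴴ) (Finset.mem_univ q)]
  rw [e2, e3, smul_add, add_sub_right_comm, e1]
  refine (Matrix.posSemidef_card_smul_sum_sub fun q => Z q q).add ?_
  exact (Matrix.posSemidef_sum _ fun q _ => Matrix.posSemidef_sum _ fun q' _ =>
    Matrix.posSemidef_self_mul_conjTranspose _).smul (Nat.cast_nonneg _)

/-- The coherent information as a relative entropy. -/
lemma relEnt_stack (N : KrausFamily A B) (ψ : Matrix A R ℂ) {U : Matrix B B ℂ} {s : B → ℝ}
    (hσ : IsSpec (N.apply (ψ * ψᴴ)) U s) {V : Matrix (B × R) (B × R) ℂ} {r : B × R → ℝ}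
    (hρ : IsSpec (N.stack ψ * (N.stack ψ)ᴴ) V r) :
    relEnt (N.stack ψ * (N.stack ψ)ᴴ) r (U ⊗ₖ (1 : Matrix R R ℂ)) (fun x => s x.1) =
      Real.log 2 * cohInfo N (ψ * ψᴴ) := by
  have hl : Real.log 2 ≠ 0 := (Real.log_pos one_lt_two).ne'
  have h1 : ∀ i, ∑ q, ((U ⊗ₖ (1 : Matrix R R ℂ))ᴴ * (N.stack ψ * (N.stack ψ)ᴴ) *
      (U ⊗ₖ (1 : Matrix R R ℂ))) (i, q) (i, q) = s i := by
    intro i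
    have h2 : (Uᴴ * N.apply (ψ * ψᴴ) * U) i i = s i := by
      rw [hσ.conj_eq, Matrix.diagonal_apply_eq]
    rw [← h2]
    simp only [Matrix.mul_apply (N := U), Matrix.mul_apply (M := Uᴴ), ← N.sum_stack ψ]
    generalize N.stack ψ * (N.stack ψ)ᴴ = T
    simp only [Matrix.mul_apply, Matrix.conjTranspose_kronecker, Matrix.kronecker_apply,
      Fintype.sum_prod_type, Matrix.conjTranspose_one, Matrix.one_apply, mul_ite, ite_mul,
      mul_one, mul_zero, zero_mul, Finset.sum_ite_eq, Finset.sum_ite_eq', Finset.mem_univ,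
      if_true]
    simp only [Finset.mul_sum, Finset.sum_mul]
    rw [Finset.sum_comm]
    refine Finset.sum_congr rfl fun b _ => ?_
    rw [Finset.sum_comm]
  rw [relEnt, cohInfo, N.vnEntropy_compl ψ, hσ.vnEntropy_eq, hρ.vnEntropy_eq]
  have h3 : ∑ x : B × R, (((U ⊗ₖ (1 : Matrix R R ℂ))ᴴ * (N.stack ψ * (N.stack ψ)ᴴ) *
      (U ⊗ₖ (1 : Matrix R R ℂ))) x x).re * Real.log (s x.1) = ∑ i, s i * Real.log (s i) := by
    rw [Fintype.sum_prod_type]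
    refine Finset.sum_congr rfl fun i _ => ?_
    dsimp only
    rw [← Finset.sum_mul, ← Complex.re_sum, h1, Complex.ofReal_re]
  rw [h3]
  simp only [Real.logb, ← mul_div_assoc, ← Finset.sum_div]
  field_simp
  ring

/-- The Kraus family acting trivially on a reference system. -/
def amp (L : KrausFamily B C) (R : Type) [Fintype R] [DecidableEq R] :
    KrausFamily (B × R) (C × R) where
  ι := L.ι
  K k := L.K k ⊗ₖ (1 : Matrix R R ℂ)

lemma IsChannel.amp {L : KrausFamily B C} (hL : L.IsChannel) : (L.amp R).IsChannel := by
  have : ∑ k, (L.K k ⊗ₖ (1 : Matrix R R ℂ))ᴴ * (L.K k ⊗ₖ (1 : Matrix R R ℂ)) = 1 := by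
    simp only [Matrix.conjTranspose_kronecker, ← Matrix.mul_kronecker_mul,
      Matrix.conjTranspose_one, Matrix.mul_one]
    have h2 : (∑ k, (L.K k)ᴴ * L.K k) ⊗ₖ (1 : Matrix R R ℂ) = 1 := by
      rw [show ∑ k, (L.K k)ᴴ * L.K k = 1 from hL]
      simp
    rw [← h2]
    ext x y
    simp [Matrix.sum_apply, Finset.sum_mul]
  exact this

lemma amp_apply_apply (L : KrausFamily B C) (X : Matrix (B × R) (B × R) ℂ) (x y : C × R) :
    (L.amp R).apply X x y =
      L.apply (Matrix.of fun b b' => X (b, x.2) (b', y.2)) x.1 y.1 := by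
  have : (L.amp R).apply X =
    ∑ k, (L.K k ⊗ₖ (1 : Matrix R R ℂ)) * X * (L.K k ⊗ₖ (1 : Matrix R R ℂ))ᴴ := rfl
  rw [this, apply]
  simp only [Matrix.sum_apply]
  refine Finset.sum_congr rfl fun k _ => ?_
  simp [Matrix.mul_apply, Fintype.sum_prod_type, Matrix.conjTranspose_kronecker, Matrix.one_apply]

lemma apply_sum_smul (L : KrausFamily A B) {S : Type} [Fintype S] (w : S → ℂ)
    (ρ : S → Matrix A A ℂ) : L.apply (∑ a, w a • ρ a) = ∑ a, w a • L.apply (ρ a) := by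
  simp only [apply, Matrix.mul_sum, Matrix.sum_mul, Finset.smul_sum, Matrix.mul_smul,
    Matrix.smul_mul]
  exact Finset.sum_comm

/-- Data processing: undoing unitaries and post-processing cannot increase the coherent
information. -/
theorem cohInfo_le_of_postprocess {N : KrausFamily A B} {M : KrausFamily A C}
    {S : Type} [Fintype S] {w : S → ℝ} (hw : ∀ a, 0 ≤ w a) {W : S → Matrix A A ℂ}
    {D : S → KrausFamily C B} (hD : ∀ a, (D a).IsChannel)
    (h : ∀ ρ, N.apply ρ = ∑ a, (w a : ℂ) • (D a).apply (M.apply (W a * ρ * (W a)ᴴ)))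
    {φ : Matrix A A ℂ} (hφ : φ.PosSemidef) :
    cohInfo N φ ≤ ∑ a, w a * cohInfo M (W a * φ * (W a)ᴴ) := by
  obtain ⟨ψ, rfl⟩ := hφ.exists_eq_mul_conjTranspose
  have hWψ : ∀ a, W a * (ψ * ψᴴ) * (W a)ᴴ = (W a * ψ) * (W a * ψ)ᴴ := fun a => by
    simp only [Matrix.conjTranspose_mul, Matrix.mul_assoc]
  have hpsd : ∀ a, (M.apply ((W a * ψ) * (W a * ψ)ᴴ)).PosSemidef := fun a =>
    M.posSemidef_apply (Matrix.posSemidef_self_mul_conjTranspose _)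
  choose U s hσ using fun a => (hpsd a).isHermitian.exists_isSpec
  choose V r hρ using fun a =>
    (Matrix.isHermitian_mul_conjTranspose_self (M.stack (W a * ψ))).exists_isSpec
  obtain ⟨U', s', hσ'⟩ := (N.posSemidef_apply hφ).isHermitian.exists_isSpec
  obtain ⟨V', r', hρ'⟩ :=
    (Matrix.isHermitian_mul_conjTranspose_self (N.stack ψ)).exists_isSpec
  have key := relEnt_mono hw (L := fun a => (D a).amp A) (fun a => (hD a).amp) hρ
    (fun a => (hσ a).kronecker_one (R := A))
    (fun a => Matrix.posSemidef_self_mul_conjTranspose _)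
    (fun a => (hpsd a).kronecker Matrix.PosSemidef.one)
    (fun a => M.posSemidef_card_smul_sub_stack (W a * ψ))
    hρ' (hσ'.kronecker_one (R := A)) ?_ ?_
  · rw [N.relEnt_stack ψ hσ' hρ'] at key
    simp only [fun a => M.relEnt_stack (W a * ψ) (hσ a) (hρ a), mul_left_comm (w _),
      ← Finset.mul_sum, ← hWψ] at key
    exact le_of_mul_le_mul_left key (Real.log_pos one_lt_two)
  · ext x y
    rw [stack_mul_conjTranspose_apply, h, Matrix.sum_apply, Matrix.sum_apply]
    refine Finset.sum_congr rfl fun a _ => ?_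
    rw [Matrix.smul_apply, Matrix.smul_apply, amp_apply_apply]
    congr 3
    ext b b'
    rw [Matrix.of_apply, stack_mul_conjTranspose_apply, Matrix.mul_vecMulVec,
      Matrix.vecMulVec_mul, ← Matrix.star_mulVec]
    rfl
  · ext x y
    rw [h, Matrix.kronecker_apply, Matrix.sum_apply, Matrix.sum_apply, Finset.sum_mul]
    refine Finset.sum_congr rfl fun a _ => ?_
    rw [Matrix.smul_apply, Matrix.smul_apply, amp_apply_apply, smul_mul_assoc, hWψ]
    congr 1
    by_cases hxy : x.2 = y.2
    · rw [hxy, Matrix.one_apply_eq, mul_one]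
      congr 2
      ext b b'
      simp
    · rw [Matrix.one_apply_ne hxy, mul_zero]
      have : (Matrix.of fun b b' => (M.apply (W a * ψ * (W a * ψ)ᴴ) ⊗ₖ (1 : Matrix A A ℂ))
          (b, x.2) (b', y.2)) = 0 := by
        ext b b'
        simp [Matrix.one_apply_ne hxy]
      rw [this]
      simp [apply]

/-- Concavity of `σ ↦ S(σ) - S(D(σ))`. -/
theorem vnEntropy_sub_concave {D : KrausFamily B C} (hD : D.IsChannel) {S : Type} [Fintype S]
    {w : S → ℝ} (hw : ∀ a, 0 < w a) {σ : S → Matrix B B ℂ} (hσ0 : ∀ a, (σ a).PosSemidef) :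
    ∑ a, w a * (vnEntropy (σ a) - vnEntropy (D.apply (σ a))) ≤
      vnEntropy (∑ a, (w a : ℂ) • σ a) - vnEntropy (D.apply (∑ a, (w a : ℂ) • σ a)) := by
  classical
  set τ := ∑ a, (w a : ℂ) • σ a with hτ
  have hwc : ∀ a, (0 : ℂ) ≤ w a := fun a => by exact_mod_cast (hw a).le
  have hτ0 : τ.PosSemidef := Matrix.posSemidef_sum _ fun a _ => (hσ0 a).smul (hwc a)
  have avg : ∀ {n : Type} [Fintype n] [DecidableEq n] {ρ V : S → Matrix n n ℂ} {r : S → n → ℝ}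
      {κ U : Matrix n n ℂ} {s : n → ℝ}, (∀ a, IsSpec (ρ a) (V a) (r a)) → IsSpec κ U s →
      κ = ∑ a, (w a : ℂ) • ρ a →
      ∑ a, w a * relEnt (ρ a) (r a) U s =
        Real.log 2 * (vnEntropy κ - ∑ a, w a * vnEntropy (ρ a)) := by
    intro n _ _ ρ V r κ U s hρ hκ hsum
    have hl : Real.log 2 ≠ 0 := (Real.log_pos one_lt_two).ne'
    have h1 : ∑ a, w a * ∑ i, ((Uᴴ * ρ a * U) i i).re * Real.log (s i) =
        ∑ i, s i * Real.log (s i) := by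
      simp only [Finset.mul_sum]
      rw [Finset.sum_comm]
      refine Finset.sum_congr rfl fun i _ => ?_
      simp only [← mul_assoc, ← Finset.sum_mul]
      congr 1
      have h2 := congrArg Complex.re (congrFun (congrFun hκ.conj_eq i) i)
      rw [Matrix.diagonal_apply_eq, Complex.ofReal_re, hsum] at h2
      rw [← h2]
      simp [Matrix.mul_sum, Matrix.sum_mul, Matrix.sum_apply]
    simp only [relEnt, mul_sub, Finset.sum_sub_distrib, h1]
    simp only [hκ.vnEntropy_eq, (hρ _).vnEntropy_eq, Real.logb, ← mul_div_assoc,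
      ← Finset.sum_div]
    simp only [mul_neg, Finset.sum_neg_distrib, ← mul_div_assoc, ← Finset.sum_div]
    field_simp
    ring
  choose V r hσ using fun a => (hσ0 a).isHermitian.exists_isSpec
  choose V' r' hσ' using fun a => (D.posSemidef_apply (hσ0 a)).isHermitian.exists_isSpec
  obtain ⟨U, s, hU⟩ := hτ0.isHermitian.exists_isSpec
  obtain ⟨U', s', hU'⟩ := (D.posSemidef_apply hτ0).isHermitian.exists_isSpec
  have hmono : ∀ a, relEnt (D.apply (σ a)) (r' a) U' s' ≤ relEnt (σ a) (r a) U s := by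
    intro a
    have hc : ((1 / w a) • τ - σ a).PosSemidef := by
      have : (1 / w a) • τ - σ a =
          (1 / w a) • ∑ b ∈ Finset.univ.erase a, (w b : ℂ) • σ b := by
        rw [hτ, ← Finset.add_sum_erase _ (fun b => (w b : ℂ) • σ b) (Finset.mem_univ a),
          smul_add, Complex.coe_smul, smul_smul, one_div, inv_mul_cancel₀ (hw a).ne', one_smul,
          add_sub_cancel_left]
      rw [this]
      exact (Matrix.posSemidef_sum _ fun b _ => (hσ0 b).smul (hwc b)).smul
        (one_div_pos.mpr (hw a)).le
    have := relEnt_mono (S := Unit) (w := fun _ => 1) (by simp) (L := fun _ => D)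
      (fun _ => hD) (fun _ => hσ a) (fun _ => hU) (fun _ => hσ0 a) (fun _ => hτ0)
      (fun _ => hc) (hσ' a) hU' (by simp) (by simp)
    simpa using this
  have h1 := avg hσ hU hτ
  have h2 := avg hσ' hU' (by rw [hτ, apply_sum_smul])
  have h3 := Finset.sum_le_sum fun a (_ : a ∈ Finset.univ) =>
    mul_le_mul_of_nonneg_left (hmono a) (hw a).le
  rw [h1, h2] at h3
  have h4 := le_of_mul_le_mul_left h3 (Real.log_pos one_lt_two)
  simp only [mul_sub, Finset.sum_sub_distrib]
  linarith

/-- The coherent information of a degradable channel is concave. -/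
theorem IsDegradable.cohInfo_concave {M : KrausFamily A B} (hM : M.IsDegradable) {S : Type}
    [Fintype S] {w : S → ℝ} (hw : ∀ a, 0 < w a) {φ : S → Matrix A A ℂ}
    (hφ : ∀ a, (φ a).PosSemidef) :
    ∑ a, w a * cohInfo M (φ a) ≤ cohInfo M (∑ a, (w a : ℂ) • φ a) := by
  obtain ⟨D, hD, hDM⟩ := hM
  have := vnEntropy_sub_concave hD hw fun a => M.posSemidef_apply (hφ a)
  rw [← apply_sum_smul] at this
  simpa only [cohInfo, hDM] using this

end KrausFamily

end CoherentInformation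

section TensorPowers

variable {C : Type} [Fintype C] [DecidableEq C] {n : ℕ}

/-- The `n`-fold Kronecker product of a family of matrices. -/
def piKron (F : Fin n → Matrix B A ℂ) : Matrix (Fin n → B) (Fin n → A) ℂ :=
  Matrix.of fun b a => ∏ k, F k (b k) (a k)

lemma piKron_apply (F : Fin n → Matrix B A ℂ) (b : Fin n → B) (a : Fin n → A) :
    piKron F b a = ∏ k, F k (b k) (a k) := rfl

lemma piKron_mul (F : Fin n → Matrix C B ℂ) (G : Fin n → Matrix B A ℂ) :
    piKron F * piKron G = piKron fun k => F k * G k := by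
  ext c a
  simp only [Matrix.mul_apply, piKron_apply, ← Finset.prod_mul_distrib]
  rw [Finset.prod_univ_sum, Fintype.piFinset_univ]

lemma conjTranspose_piKron (F : Fin n → Matrix B A ℂ) :
    (piKron F)ᴴ = piKron fun k => (F k)ᴴ := by
  ext a b
  simp [piKron_apply, Matrix.conjTranspose_apply]

lemma piKron_diagonal (d : Fin n → A → ℂ) :
    (piKron fun k => Matrix.diagonal (d k)) = Matrix.diagonal fun a => ∏ k, d k (a k) := by
  ext a b
  by_cases h : a = b
  · subst h
    simp [piKron_apply]
  · obtain ⟨k, hk⟩ := Function.ne_iff.mp h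
    rw [Matrix.diagonal_apply_ne _ h, piKron_apply]
    exact Finset.prod_eq_zero (Finset.mem_univ k) (Matrix.diagonal_apply_ne _ hk)

lemma piKron_one : (piKron fun _ : Fin n => (1 : Matrix A A ℂ)) = 1 := by
  simp only [← Matrix.diagonal_one, piKron_diagonal, Finset.prod_const_one]

lemma piKron_smul (c : Fin n → ℂ) (F : Fin n → Matrix B A ℂ) :
    (piKron fun k => c k • F k) = (∏ k, c k) • piKron F := by
  ext b a
  simp [piKron_apply, Finset.prod_mul_distrib]

lemma piKron_sum {κ : Fin n → Type} [∀ k, Fintype (κ k)] (F : ∀ k, κ k → Matrix B A ℂ) :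
    (piKron fun k => ∑ i, F k i) = ∑ f : ∀ k, κ k, piKron fun k => F k (f k) := by
  ext b a
  simp only [Matrix.sum_apply, piKron_apply]
  rw [Finset.prod_univ_sum, Fintype.piFinset_univ]

lemma trace_piKron (F : Fin n → Matrix A A ℂ) : (piKron F).trace = ∏ k, (F k).trace := by
  simp only [Matrix.trace, Matrix.diag, piKron_apply]
  rw [Finset.prod_univ_sum, Fintype.piFinset_univ]

lemma piKron_single (a b : Fin n → A) :
    (piKron fun k => Matrix.single (a k) (b k) (1 : ℂ)) = Matrix.single a b 1 := by
  ext x y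
  rw [piKron_apply, Matrix.single_apply]
  split_ifs with h
  · obtain ⟨rfl, rfl⟩ := h
    simp
  · rw [not_and_or] at h
    rcases h with h | h <;> obtain ⟨k, hk⟩ := Function.ne_iff.mp h <;>
      exact Finset.prod_eq_zero (Finset.mem_univ k) (by simp [hk])

/-- Linear maps agreeing on product matrices are equal. -/
lemma linearMap_ext_piKron {E : Type} [AddCommGroup E] [Module ℂ E]
    {F G : Matrix (Fin n → A) (Fin n → A) ℂ →ₗ[ℂ] E}
    (h : ∀ ρ : Fin n → Matrix A A ℂ, F (piKron ρ) = G (piKron ρ)) : F = G := by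
  refine LinearMap.ext fun ρ => ?_
  rw [Matrix.matrix_eq_sum_single ρ]
  simp only [map_sum]
  refine Finset.sum_congr rfl fun a _ => Finset.sum_congr rfl fun b _ => ?_
  have : Matrix.single a b (ρ a b) =
      ρ a b • piKron fun k => Matrix.single (a k) (b k) (1 : ℂ) := by
    rw [piKron_single, Matrix.smul_single, smul_eq_mul, mul_one]
  rw [this, map_smul, map_smul, h]

lemma IsSpec.piKron {ρ U : Matrix A A ℂ} {d : A → ℝ} (h : IsSpec ρ U d) :
    IsSpec (piKron fun _ : Fin n => ρ) (piKron fun _ => U) (fun a => ∏ k, d (a k)) := by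
  constructor
  · rw [conjTranspose_piKron, piKron_mul, h.star_mul, piKron_one]
  · rw [conjTranspose_piKron]
    simp only [Complex.ofReal_prod]
    rw [← piKron_diagonal fun _ i => (d i : ℂ), piKron_mul, piKron_mul, ← h.eq]

lemma vnEntropy_piKron {ρ : Matrix A A ℂ} (hρ : IsDensity ρ) :
    vnEntropy (piKron fun _ : Fin n => ρ) = n * vnEntropy ρ := by
  obtain ⟨U, d, h⟩ := hρ.1.isHermitian.exists_isSpec
  have hd : ∑ i, d i = 1 := by
    have := h.trace_eq
    rw [hρ.2] at this
    exact_mod_cast this.symm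
  rw [h.vnEntropy_eq, (h.piKron (n := n)).vnEntropy_eq]
  have h1 : ∀ a : Fin n → A, (∏ k, d (a k)) * Real.logb 2 (∏ k, d (a k)) =
      ∑ k, ∏ j, d (a j) * if j = k then Real.logb 2 (d (a j)) else 1 := by
    intro a
    have h2 : ∀ k, (∏ j, d (a j) * if j = k then Real.logb 2 (d (a j)) else 1) =
        (∏ j, d (a j)) * Real.logb 2 (d (a k)) := by
      intro k
      rw [Finset.prod_mul_distrib, Finset.prod_ite_eq' Finset.univ k]
      simp
    simp only [h2, ← Finset.mul_sum]
    by_cases h0 : ∃ k, d (a k) = 0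
    · obtain ⟨k, hk⟩ := h0
      rw [Finset.prod_eq_zero (Finset.mem_univ k) hk]
      simp
    · push Not at h0
      rw [Real.logb_prod _ _ fun k _ => h0 k]
  have h3 : ∀ k : Fin n, ∑ a : Fin n → A,
      ∏ j, (d (a j) * if j = k then Real.logb 2 (d (a j)) else 1) =
      ∑ i, d i * Real.logb 2 (d i) := by
    intro k
    have := (Finset.prod_univ_sum (fun _ : Fin n => (Finset.univ : Finset A))
      fun j i => d i * if j = k then Real.logb 2 (d i) else 1).symm
    rw [Fintype.piFinset_univ] at this
    rw [this, ← Finset.mul_prod_erase _ _ (Finset.mem_univ k), Finset.prod_eq_one]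
    · simp
    · intro j hj
      simp [Finset.ne_of_mem_erase hj, hd]
  simp only [h1]
  rw [Finset.sum_comm]
  simp only [h3]
  simp

namespace KrausFamily

/-- The action of a Kraus family as a linear map. -/
noncomputable def applyₗ (N : KrausFamily A B) : Matrix A A ℂ →ₗ[ℂ] Matrix B B ℂ where
  toFun := N.apply
  map_add' ρ σ := by simp [apply, Matrix.mul_add, Matrix.add_mul, Finset.sum_add_distrib]
  map_smul' c ρ := by simp [apply, Finset.smul_sum]

/-- The action of the complementary channel as a linear map. -/
noncomputable def complₗ (N : KrausFamily A B) : Matrix A A ℂ →ₗ[ℂ] Matrix N.ι N.ι ℂ where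
  toFun := N.compl
  map_add' ρ σ := by ext; simp [compl, Matrix.mul_add, Matrix.add_mul]
  map_smul' c ρ := by ext; simp [compl]

/-- The tensor product of `n` channels with common input and output types. -/
def piKron (N : Fin n → KrausFamily A B) : KrausFamily (Fin n → A) (Fin n → B) where
  ι := ∀ k, (N k).ι
  K f := _root_.piKron fun k => (N k).K (f k)

lemma apply_piKron (N : Fin n → KrausFamily A B) (ρ : Fin n → Matrix A A ℂ) :
    (piKron N).apply (_root_.piKron ρ) = _root_.piKron fun k => (N k).apply (ρ k) := by
  simp only [apply]
  rw [piKron_sum]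
  refine Finset.sum_congr rfl fun f _ => ?_
  simp only [piKron, conjTranspose_piKron, piKron_mul]

lemma IsChannel.piKron {N : Fin n → KrausFamily A B} (hN : ∀ k, (N k).IsChannel) :
    (KrausFamily.piKron N).IsChannel := by
  have : ∑ f : ∀ k, (N k).ι, (_root_.piKron fun k => (N k).K (f k))ᴴ *
      (_root_.piKron fun k => (N k).K (f k)) = 1 := by
    simp only [conjTranspose_piKron, piKron_mul]
    rw [← piKron_sum fun k i => ((N k).K i)ᴴ * (N k).K i]
    simp only [fun k => show ∑ i, ((N k).K i)ᴴ * (N k).K i = 1 from hN k, piKron_one]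
  exact this

lemma IsChannel.pow {N : KrausFamily A B} (hN : N.IsChannel) (n : ℕ) : (N.pow n).IsChannel :=
  IsChannel.piKron fun _ => hN

lemma pow_apply_piKron (N : KrausFamily A B) (ρ : Fin n → Matrix A A ℂ) :
    (N.pow n).apply (_root_.piKron ρ) = _root_.piKron fun k => N.apply (ρ k) :=
  apply_piKron _ ρ

lemma pow_compl_piKron (N : KrausFamily A B) (ρ : Fin n → Matrix A A ℂ) :
    (N.pow n).compl (_root_.piKron ρ) = _root_.piKron fun k => N.compl (ρ k) := by
  ext f g
  change (_root_.piKron (fun k => N.K (f k)) * _root_.piKron ρ *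
    (_root_.piKron fun k => N.K (g k))ᴴ).trace = ∏ k, (N.K (f k) * ρ k * (N.K (g k))ᴴ).trace
  rw [conjTranspose_piKron, piKron_mul, piKron_mul, trace_piKron]

lemma IsDegradable.pow {N : KrausFamily A B} (hN : N.IsDegradable) (n : ℕ) :
    (N.pow n).IsDegradable := by
  obtain ⟨D, hD, h⟩ := hN
  refine ⟨D.pow n, hD.pow n, fun ρ => ?_⟩
  have : (D.pow n).applyₗ ∘ₗ (N.pow n).applyₗ = (N.pow n).complₗ := by
    refine linearMap_ext_piKron fun ρ => ?_
    change (D.pow n).apply ((N.pow n).apply (_root_.piKron ρ)) =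
      (N.pow n).compl (_root_.piKron ρ)
    rw [pow_apply_piKron, pow_compl_piKron]
    simp only [← h]
    exact D.pow_apply_piKron _
  exact LinearMap.congr_fun this ρ

lemma posSemidef_compl (N : KrausFamily A B) {φ : Matrix A A ℂ} (hφ : φ.PosSemidef) :
    (N.compl φ).PosSemidef := by
  obtain ⟨ψ, rfl⟩ := hφ.exists_eq_mul_conjTranspose
  rw [compl_eq_stack]
  exact (Matrix.posSemidef_conjTranspose_mul_self _).transpose

lemma IsChannel.trace_compl {N : KrausFamily A B} (hN : N.IsChannel) (φ : Matrix A A ℂ) :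
    (N.compl φ).trace = φ.trace := by
  rw [← N.trace_apply hN φ, apply, Matrix.trace_sum]
  rfl

lemma cohInfo_pow_piKron {N : KrausFamily A B} (hN : N.IsChannel) {φ : Matrix A A ℂ}
    (hφ : IsDensity φ) (n : ℕ) :
    cohInfo (N.pow n) (_root_.piKron fun _ => φ) = n * cohInfo N φ := by
  rw [cohInfo, cohInfo, pow_apply_piKron, pow_compl_piKron,
    vnEntropy_piKron ⟨N.posSemidef_apply hφ.1, by rw [N.trace_apply hN, hφ.2]⟩, mul_sub]
  congr 1
  exact vnEntropy_piKron ⟨N.posSemidef_compl hφ.1, by rw [hN.trace_compl, hφ.2]⟩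

/-- If `N` is a mixture of post-processings of a degradable channel `M` with covariantly rotated
inputs, and the rotations average every input to `τ`, then tensor powers of `N` have coherent
information at most that of `M` at `τ` per use. -/
theorem cohInfo_pow_le {N : KrausFamily A B} {M : KrausFamily A C} (hM : M.IsChannel)
    (hdeg : M.IsDegradable) {S : Type} [Fintype S] {w : S → ℝ} (hw : ∀ a, 0 < w a)
    {W : S → Matrix A A ℂ} {D : S → KrausFamily C B} (hD : ∀ a, (D a).IsChannel)
    (h : ∀ ρ, N.apply ρ = ∑ a, (w a : ℂ) • (D a).apply (M.apply (W a * ρ * (W a)ᴴ)))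
    {τ : Matrix A A ℂ} (hτ : IsDensity τ)
    (hav : ∀ ρ, ∑ a, (w a : ℂ) • (W a * ρ * (W a)ᴴ) = ρ.trace • τ)
    (n : ℕ) {φ : Matrix (Fin n → A) (Fin n → A) ℂ} (hφ : IsDensity φ) :
    cohInfo (N.pow n) φ ≤ n * cohInfo M τ := by
  have hN : ∀ ρ, (N.pow n).apply ρ = ∑ f : Fin n → S, ((∏ k, w (f k) : ℝ) : ℂ) •
      (piKron fun k => D (f k)).apply ((M.pow n).apply
        (_root_.piKron (fun k => W (f k)) * ρ * (_root_.piKron fun k => W (f k))ᴴ)) := by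
    intro ρ
    have : (N.pow n).applyₗ = ∑ f : Fin n → S, ((∏ k, w (f k) : ℝ) : ℂ) •
      ((piKron fun k => D (f k)).applyₗ ∘ₗ (M.pow n).applyₗ ∘ₗ
        LinearMap.mulRight ℂ (_root_.piKron fun k => W (f k))ᴴ ∘ₗ
        LinearMap.mulLeft ℂ (_root_.piKron fun k => W (f k))) := by
      refine linearMap_ext_piKron fun ρ => ?_
      simp only [LinearMap.sum_apply, LinearMap.smul_apply]
      change (N.pow n).apply (_root_.piKron ρ) = ∑ f : Fin n → S, ((∏ k, w (f k) : ℝ) : ℂ) •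
        (piKron fun k => D (f k)).apply ((M.pow n).apply
          (_root_.piKron (fun k => W (f k)) * _root_.piKron ρ *
            (_root_.piKron fun k => W (f k))ᴴ))
      simp only [conjTranspose_piKron, piKron_mul, pow_apply_piKron, apply_piKron,
        Complex.ofReal_prod, ← piKron_smul, h]
      rw [piKron_sum]
    rw [show (N.pow n).apply ρ = (N.pow n).applyₗ ρ from rfl, this]
    simp only [LinearMap.sum_apply, LinearMap.smul_apply]
    rfl
  have hav' : ∑ f : Fin n → S, ((∏ k, w (f k) : ℝ) : ℂ) •
      (_root_.piKron (fun k => W (f k)) * φ * (_root_.piKron fun k => W (f k))ᴴ) =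
        _root_.piKron fun _ => τ := by
    have : ∑ f : Fin n → S, ((∏ k, w (f k) : ℝ) : ℂ) •
        (LinearMap.mulRight ℂ (_root_.piKron fun k => W (f k))ᴴ ∘ₗ
        LinearMap.mulLeft ℂ (_root_.piKron fun k => W (f k))) =
        (Matrix.traceLinearMap (Fin n → A) ℂ ℂ).smulRight (_root_.piKron fun _ => τ) := by
      refine linearMap_ext_piKron fun ρ => ?_
      simp only [LinearMap.sum_apply, LinearMap.smul_apply, LinearMap.comp_apply,
        LinearMap.mulLeft_apply, LinearMap.mulRight_apply, LinearMap.smulRight_apply,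
        Matrix.traceLinearMap_apply, conjTranspose_piKron, piKron_mul, Complex.ofReal_prod,
        ← piKron_smul, trace_piKron, ← hav]
      rw [piKron_sum]
    have h2 := LinearMap.congr_fun this φ
    simp only [LinearMap.sum_apply, LinearMap.smul_apply, LinearMap.comp_apply,
        LinearMap.mulLeft_apply, LinearMap.mulRight_apply, LinearMap.smulRight_apply,
        Matrix.traceLinearMap_apply, hφ.2, one_smul] at h2
    exact h2
  have hwf : ∀ f : Fin n → S, 0 < ∏ k, w (f k) := fun f => Finset.prod_pos fun k _ => hw _
  calc cohInfo (N.pow n) φ ≤ ∑ f : Fin n → S, (∏ k, w (f k)) * cohInfo (M.pow n)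
        (_root_.piKron (fun k => W (f k)) * φ * (_root_.piKron fun k => W (f k))ᴴ) :=
        cohInfo_le_of_postprocess (fun f => (hwf f).le)
          (fun f => IsChannel.piKron fun k => hD (f k)) hN hφ.1
    _ ≤ cohInfo (M.pow n) (_root_.piKron fun _ => τ) := by
        rw [← hav']
        exact (hdeg.pow n).cohInfo_concave hwf fun f => hφ.1.mul_mul_conjTranspose_same _
    _ = n * cohInfo M τ := cohInfo_pow_piKron hM hτ n

end KrausFamily

end TensorPowers

section Twirling

/-- The Pauli basis of `2 × 2` matrices. -/
noncomputable def pauli : Fin 4 → Matrix (Fin 2) (Fin 2) ℂ := ![1, PauliX, PauliY, PauliZ]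

/-- Coefficients of a matrix in the Pauli basis. -/
noncomputable def pauliCoeff (K : Matrix (Fin 2) (Fin 2) ℂ) : Fin 4 → ℂ :=
  ![(K 0 0 + K 1 1) / 2, (K 0 1 + K 1 0) / 2, Complex.I * (K 0 1 - K 1 0) / 2,
    (K 0 0 - K 1 1) / 2]

/-- The unitary `(1 - i(X + Y + Z)) / 2`, which permutes the Pauli matrices cyclically. -/
noncomputable def cyclicClifford : Matrix (Fin 2) (Fin 2) ℂ :=
  !![(1 - Complex.I) / 2, (-1 - Complex.I) / 2; (1 - Complex.I) / 2, (1 + Complex.I) / 2]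

/-- Representatives of the cyclic group generated by `cyclicClifford`, up to phases. -/
noncomputable def cyclicRep : Fin 3 → Matrix (Fin 2) (Fin 2) ℂ :=
  ![1, cyclicClifford, cyclicCliffordᴴ]

/-- Twelve unitaries forming a unitary 2-design. -/
noncomputable def design (c : Fin 4 × Fin 3) : Matrix (Fin 2) (Fin 2) ℂ :=
  pauli c.1 * cyclicRep c.2

lemma pauli_conjTranspose (i : Fin 4) : (pauli i)ᴴ = pauli i := by
  fin_cases i <;> ext a b <;> fin_cases a <;> fin_cases b <;>
    simp [pauli, PauliX, PauliY, PauliZ]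

lemma pauli_mul_self (i : Fin 4) : pauli i * pauli i = 1 := by
  fin_cases i <;> ext a b <;> fin_cases a <;> fin_cases b <;>
    simp [pauli, PauliX, PauliY, PauliZ, Matrix.mul_apply, Fin.sum_univ_two]

lemma Matrix.conjTranspose_fin_two (a b c d : ℂ) :
    (!![a, b; c, d])ᴴ = !![star a, star c; star b, star d] := by
  ext i j
  fin_cases i <;> fin_cases j <;> rfl

lemma eq_sum_pauliCoeff (K : Matrix (Fin 2) (Fin 2) ℂ) :
    K = ∑ i, pauliCoeff K i • pauli i := by
  have hI := Complex.I_mul_I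
  ext a b
  fin_cases a <;> fin_cases b <;>
    simp [pauli, pauliCoeff, PauliX, PauliY, PauliZ, Fin.sum_univ_four]
  · ring
  · linear_combination (K 0 1 - K 1 0) / 2 * hI
  · linear_combination -(K 0 1 - K 1 0) / 2 * hI
  · ring

lemma trace_conjTranspose_mul_self_eq (K : Matrix (Fin 2) (Fin 2) ℂ) :
    (Kᴴ * K).trace = 2 * ∑ i, (Complex.normSq (pauliCoeff K i) : ℂ) := by
  simp [Matrix.trace, Matrix.mul_apply, Fin.sum_univ_two, Fin.sum_univ_four,
    Complex.normSq_eq_conj_mul_self, pauliCoeff, map_ofNat (starRingEnd ℂ)]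
  ring_nf
  simp only [Complex.I_sq]
  ring

lemma sum_pauli_conj (ρ : Matrix (Fin 2) (Fin 2) ℂ) :
    ∑ i, pauli i * ρ * pauli i = (2 * ρ.trace) • 1 := by
  rw [Matrix.eta_fin_two ρ]
  ext a b
  fin_cases a <;> fin_cases b <;>
    simp [pauli, PauliX, PauliY, PauliZ, Fin.sum_univ_four,
      Matrix.one_fin_two, Matrix.trace_fin_two] <;> ring_nf <;> simp only [Complex.I_sq] <;> ring

lemma pauli_twirl (K ρ : Matrix (Fin 2) (Fin 2) ℂ) :
    ∑ i, (pauli i * K * pauli i) * ρ * (pauli i * K * pauli i)ᴴ =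
      ∑ j, (4 * Complex.normSq (pauliCoeff K j) : ℂ) • (pauli j * ρ * pauli j) := by
  have h4 := Complex.I_pow_four
  have h5 : Complex.I ^ 5 = Complex.I := by rw [pow_succ, h4, one_mul]
  have h6 : Complex.I ^ 6 = -1 := by rw [pow_succ, h5, Complex.I_mul_I]
  obtain ⟨k, hk⟩ : ∃ k, k = pauliCoeff K := ⟨_, rfl⟩
  have hK : K = !![k 0 + k 3, k 1 - Complex.I * k 2; k 1 + Complex.I * k 2, k 0 - k 3] := by
    rw [eq_sum_pauliCoeff K, ← hk]
    ext a b
    fin_cases a <;> fin_cases b <;>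
      simp [pauli, PauliX, PauliY, PauliZ, Fin.sum_univ_four] <;> ring
  rw [← hk, hK, Matrix.eta_fin_two ρ]
  ext a b
  fin_cases a <;> fin_cases b <;>
    simp [pauli, PauliX, PauliY, PauliZ, Fin.sum_univ_four,
      Matrix.conjTranspose_fin_two, Complex.normSq_eq_conj_mul_self] <;>
    ring_nf <;> simp only [Complex.I_sq, h4, h5, h6] <;> ring

lemma cyclicClifford_conj :
    (cyclicCliffordᴴ * cyclicClifford = 1 ∧ cyclicClifford * cyclicCliffordᴴ = 1) ∧
    cyclicCliffordᴴ * PauliX * cyclicClifford = PauliZ ∧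
    cyclicCliffordᴴ * PauliY * cyclicClifford = PauliX ∧
    cyclicCliffordᴴ * PauliZ * cyclicClifford = PauliY := by
  refine ⟨⟨?_, ?_⟩, ?_, ?_, ?_⟩ <;> ext a b <;> fin_cases a <;> fin_cases b <;>
    simp [cyclicClifford, Matrix.conjTranspose_fin_two, PauliX, PauliY, PauliZ] <;>
    ring_nf <;> simp only [Complex.I_sq, Complex.I_pow_three] <;> ring

lemma cyclicRep_conj_pauli (f : Fin 4 → ℂ) (ρ : Matrix (Fin 2) (Fin 2) ℂ) :
    ∑ s, ∑ j, f j • (((cyclicRep s)ᴴ * pauli j * cyclicRep s) * ρ *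
      ((cyclicRep s)ᴴ * pauli j * cyclicRep s)) =
      (3 * f 0) • ρ + (f 1 + f 2 + f 3) • (PauliX * ρ * PauliX + PauliY * ρ * PauliY +
        PauliZ * ρ * PauliZ) := by
  obtain ⟨u, hX, hY, hZ⟩ := cyclicClifford_conj
  have inv : ∀ {P Q : Matrix (Fin 2) (Fin 2) ℂ}, cyclicCliffordᴴ * P * cyclicClifford = Q →
      cyclicClifford * Q * cyclicCliffordᴴ = P := by
    rintro P Q rfl
    calc cyclicClifford * (cyclicCliffordᴴ * P * cyclicClifford) * cyclicCliffordᴴ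
        = (cyclicClifford * cyclicCliffordᴴ) * P * (cyclicClifford * cyclicCliffordᴴ) := by
          simp only [Matrix.mul_assoc]
      _ = P := by simp [u.2]
  simp only [Fin.sum_univ_three, Fin.sum_univ_four]
  simp [cyclicRep, pauli, u.1, u.2, hX, hY, hZ, inv hX, inv hY, inv hZ]
  module

lemma cyclicRep_unitary (s : Fin 3) :
    (cyclicRep s)ᴴ * cyclicRep s = 1 ∧ cyclicRep s * (cyclicRep s)ᴴ = 1 := by
  obtain ⟨u, -⟩ := cyclicClifford_conj
  fin_cases s <;> simp [cyclicRep, u.1, u.2]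

lemma design_mul_conjTranspose (c : Fin 4 × Fin 3) : design c * (design c)ᴴ = 1 := by
  calc design c * (design c)ᴴ
      = pauli c.1 * (cyclicRep c.2 * (cyclicRep c.2)ᴴ) * pauli c.1 := by
        simp only [design, Matrix.conjTranspose_mul, Matrix.mul_assoc, pauli_conjTranspose]
    _ = 1 := by rw [(cyclicRep_unitary _).2, Matrix.mul_one, pauli_mul_self]

lemma sum_design_conj (ρ : Matrix (Fin 2) (Fin 2) ℂ) :
    ∑ c, ((1 / 12 : ℝ) : ℂ) • (design c * ρ * (design c)ᴴ) =
      ρ.trace • ((1 / 2 : ℂ) • (1 : Matrix (Fin 2) (Fin 2) ℂ)) := by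
  have h : ∀ c : Fin 4 × Fin 3, design c * ρ * (design c)ᴴ =
      pauli c.1 * (cyclicRep c.2 * ρ * (cyclicRep c.2)ᴴ) * pauli c.1 := fun c => by
    simp only [design, Matrix.conjTranspose_mul, Matrix.mul_assoc, pauli_conjTranspose]
  simp only [h, ← Finset.smul_sum]
  rw [Fintype.sum_prod_type_right]
  have ht : ∀ s, (cyclicRep s * ρ * (cyclicRep s)ᴴ).trace = ρ.trace := fun s => by
    rw [Matrix.trace_mul_comm, ← Matrix.mul_assoc, (cyclicRep_unitary s).1, Matrix.one_mul]
  simp only [sum_pauli_conj, ht]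
  rw [Finset.sum_const, Finset.card_univ, Fintype.card_fin, ← Nat.cast_smul_eq_nsmul ℂ, smul_smul,
    smul_smul, smul_smul]
  congr 1
  push_cast
  ring

lemma design_twirl (K ρ : Matrix (Fin 2) (Fin 2) ℂ) :
    ∑ c, ((1 / 12 : ℝ) : ℂ) • (((design c)ᴴ * K * design c) * ρ *
      ((design c)ᴴ * K * design c)ᴴ) =
      (Complex.normSq (pauliCoeff K 0) : ℂ) • ρ +
        (((Complex.normSq (pauliCoeff K 1) + Complex.normSq (pauliCoeff K 2) +
          Complex.normSq (pauliCoeff K 3)) / 3 : ℝ) : ℂ) •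
            (PauliX * ρ * PauliX + PauliY * ρ * PauliY + PauliZ * ρ * PauliZ) := by
  have h : ∀ c : Fin 4 × Fin 3, ((design c)ᴴ * K * design c) * ρ *
      ((design c)ᴴ * K * design c)ᴴ =
      (cyclicRep c.2)ᴴ * ((pauli c.1 * K * pauli c.1) * (cyclicRep c.2 * ρ * (cyclicRep c.2)ᴴ) *
        (pauli c.1 * K * pauli c.1)ᴴ) * cyclicRep c.2 := fun c => by
    simp only [design, Matrix.conjTranspose_mul, Matrix.mul_assoc, pauli_conjTranspose,
      Matrix.conjTranspose_conjTranspose]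
  simp only [h, ← Finset.smul_sum]
  rw [Fintype.sum_prod_type_right]
  simp only [← Matrix.sum_mul, ← Matrix.mul_sum, pauli_twirl]
  have h2 : ∀ s, (cyclicRep s)ᴴ * (∑ j, (4 * Complex.normSq (pauliCoeff K j) : ℂ) •
      (pauli j * (cyclicRep s * ρ * (cyclicRep s)ᴴ) * pauli j)) * cyclicRep s =
      ∑ j, (4 * Complex.normSq (pauliCoeff K j) : ℂ) •
        (((cyclicRep s)ᴴ * pauli j * cyclicRep s) * ρ *
          ((cyclicRep s)ᴴ * pauli j * cyclicRep s)) := fun s => by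
    simp only [Matrix.mul_sum, Matrix.sum_mul, Matrix.mul_smul, Matrix.smul_mul, Matrix.mul_assoc]
  simp only [h2]
  rw [cyclicRep_conj_pauli, smul_add, smul_smul, smul_smul]
  push_cast
  congr 2 <;> ring

lemma depol_apply {p : ℝ} (hp0 : 0 ≤ p) (hp1 : p ≤ 1) (ρ : Matrix (Fin 2) (Fin 2) ℂ) :
    (depol p).apply ρ = ((1 - p : ℝ) : ℂ) • ρ +
      ((p / 3 : ℝ) : ℂ) • (PauliX * ρ * PauliX + PauliY * ρ * PauliY + PauliZ * ρ * PauliZ) := by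
  have h1 := pauli_conjTranspose 1
  have h2 := pauli_conjTranspose 2
  have h3 := pauli_conjTranspose 3
  simp only [pauli, Matrix.cons_val] at h1 h2 h3
  have e1 : ((Real.sqrt (1 - p) : ℝ) : ℂ) * (Real.sqrt (1 - p) : ℝ) = ((1 - p : ℝ) : ℂ) := by
    rw [← Complex.ofReal_mul, Real.mul_self_sqrt (by linarith)]
  have e2 : ((Real.sqrt (p / 3) : ℝ) : ℂ) * (Real.sqrt (p / 3) : ℝ) = ((p / 3 : ℝ) : ℂ) := by
    rw [← Complex.ofReal_mul, Real.mul_self_sqrt (by linarith)]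
  change ∑ i : Fin 4, _ = _
  simp only [depol, Fin.sum_univ_four, Matrix.cons_val, Matrix.conjTranspose_smul, h1, h2, h3,
    Matrix.conjTranspose_one, Complex.star_def, Complex.conj_ofReal, Matrix.smul_mul,
    Matrix.mul_smul, smul_smul, e1, e2, Matrix.one_mul, Matrix.mul_one, smul_add, add_assoc]

end Twirling

section CapacityBound

/-- `(p, y)` is certified by a degradable channel with coherent information at most `y` at the
maximally mixed state, together with a decoder reaching entanglement fidelity `1 - p`. -/
def IsCertified (p y : ℝ) : Prop :=
  ∃ (E : Type) (_ : Fintype E) (_ : DecidableEq E) (M : KrausFamily (Fin 2) E)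
    (D : KrausFamily E (Fin 2)), M.IsChannel ∧ D.IsChannel ∧ M.IsDegradable ∧
    ∑ i, ∑ j, Complex.normSq (D.K i * M.K j).trace = 4 * (1 - p) ∧
    cohInfo M ((1 / 2 : ℂ) • 1) ≤ y

lemma isDensity_half : IsDensity ((1 / 2 : ℂ) • (1 : Matrix (Fin 2) (Fin 2) ℂ)) := by
  refine ⟨Matrix.PosSemidef.one.smul (by simp), ?_⟩
  rw [Matrix.trace_smul, Matrix.trace_one]
  simp

lemma IsDensity.piKron {ρ : Matrix A A ℂ} (hρ : IsDensity ρ) {n : ℕ} :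
    IsDensity (piKron fun _ : Fin n => ρ) := by
  obtain ⟨ψ, hψ⟩ := hρ.1.exists_eq_mul_conjTranspose
  refine ⟨?_, by rw [trace_piKron, hρ.2, Finset.prod_const_one]⟩
  rw [hψ, ← piKron_mul, ← conjTranspose_piKron]
  exact Matrix.posSemidef_self_mul_conjTranspose _

/-- Post-composition of a Kraus family with a matrix. -/
def KrausFamily.mulLeft {E : Type} [Fintype E] [DecidableEq E] (V : Matrix B B ℂ)
    (D : KrausFamily E B) : KrausFamily E B where
  ι := D.ι
  K i := V * D.K i

lemma KrausFamily.IsChannel.mulLeft {E : Type} [Fintype E] [DecidableEq E] {V : Matrix B B ℂ}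
    (hV : Vᴴ * V = 1) {D : KrausFamily E B} (hD : D.IsChannel) : (D.mulLeft V).IsChannel := by
  have : ∑ i, (V * D.K i)ᴴ * (V * D.K i) = 1 := by
    have h2 : ∀ i, (V * D.K i)ᴴ * (V * D.K i) = (D.K i)ᴴ * (Vᴴ * V) * D.K i := fun i => by
      simp only [Matrix.conjTranspose_mul, Matrix.mul_assoc]
    simp only [h2, hV, Matrix.mul_one]
    exact hD
  exact this

theorem IsCertified.cohInfo_pow_le {p y : ℝ} (hp0 : 0 ≤ p) (hp1 : p ≤ 1) (h : IsCertified p y)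
    (n : ℕ) {φ : Matrix (Fin n → Fin 2) (Fin n → Fin 2) ℂ} (hφ : IsDensity φ) :
    cohInfo ((depol p).pow n) φ ≤ n * y := by
  obtain ⟨E, _, _, M, D, hM, hD, hdeg, hF, hy⟩ := h
  have hF0 : ∑ i, ∑ j, Complex.normSq (pauliCoeff (D.K i * M.K j) 0) = 1 - p := by
    have h1 : ∀ K : Matrix (Fin 2) (Fin 2) ℂ,
        Complex.normSq (pauliCoeff K 0) = Complex.normSq K.trace / 4 := fun K => by
      simp only [pauliCoeff, Matrix.cons_val, Matrix.trace_fin_two, map_div₀]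
      congr 1
      simp
      norm_num
    simp only [h1, ← Finset.sum_div, hF]
    ring
  have hT : ∑ i, ∑ j, ∑ k, Complex.normSq (pauliCoeff (D.K i * M.K j) k) = 1 := by
    have h1 : ∑ i, ∑ j, ((D.K i * M.K j)ᴴ * (D.K i * M.K j)).trace = 2 := by
      have h2 : ∀ i j, (D.K i * M.K j)ᴴ * (D.K i * M.K j) =
          (M.K j)ᴴ * ((D.K i)ᴴ * D.K i) * M.K j := fun i j => by
        simp only [Matrix.conjTranspose_mul, Matrix.mul_assoc]
      rw [Finset.sum_comm]
      simp only [h2, ← Matrix.trace_sum, ← Matrix.mul_sum, ← Matrix.sum_mul]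
      rw [show ∑ i, (D.K i)ᴴ * D.K i = 1 from hD]
      simp only [Matrix.mul_one]
      rw [show ∑ i, (M.K i)ᴴ * M.K i = 1 from hM, Matrix.trace_one]
      simp
    simp only [trace_conjTranspose_mul_self_eq, ← Finset.mul_sum] at h1
    have h3 : (∑ i, ∑ j, ∑ k, (Complex.normSq (pauliCoeff (D.K i * M.K j) k) : ℂ)) = 1 := by
      linear_combination h1 / 2
    exact_mod_cast h3
  have hF1 : ∑ i, ∑ j, (Complex.normSq (pauliCoeff (D.K i * M.K j) 1) +
      Complex.normSq (pauliCoeff (D.K i * M.K j) 2) +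
      Complex.normSq (pauliCoeff (D.K i * M.K j) 3)) / 3 = p / 3 := by
    simp only [Fin.sum_univ_four, Finset.sum_add_distrib, ← Finset.sum_div] at hT hF0 ⊢
    linarith
  have htw : ∀ ρ, (depol p).apply ρ = ∑ c, ((1 / 12 : ℝ) : ℂ) •
      (D.mulLeft (design c)ᴴ).apply (M.apply (design c * ρ * (design c)ᴴ)) := by
    intro ρ
    have h1 : ∀ c, (D.mulLeft (design c)ᴴ).apply (M.apply (design c * ρ * (design c)ᴴ)) =
        ∑ i, ∑ j, (((design c)ᴴ * (D.K i * M.K j) * design c) * ρ *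
          ((design c)ᴴ * (D.K i * M.K j) * design c)ᴴ) := by
      intro c
      change ∑ i : D.ι, ((design c)ᴴ * D.K i) * (∑ j, M.K j * (design c * ρ * (design c)ᴴ) *
        (M.K j)ᴴ) * ((design c)ᴴ * D.K i)ᴴ = _
      simp only [Matrix.mul_sum, Matrix.sum_mul, Matrix.conjTranspose_mul, Matrix.mul_assoc]
    simp only [h1, Finset.smul_sum]
    rw [Finset.sum_comm, Finset.sum_congr rfl fun i _ => Finset.sum_comm]
    simp only [design_twirl, Finset.sum_add_distrib, ← Finset.sum_smul, ← Complex.ofReal_sum,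
      hF0, hF1]
    exact depol_apply hp0 hp1 ρ
  refine (KrausFamily.cohInfo_pow_le hM hdeg (fun _ => by norm_num)
    (fun c => hD.mulLeft ?_) htw isDensity_half sum_design_conj n hφ).trans
      (mul_le_mul_of_nonneg_left hy (Nat.cast_nonneg n))
  rw [Matrix.conjTranspose_conjTranspose, design_mul_conjTranspose]

theorem IsCertified.Qcap_le {p y : ℝ} (hp0 : 0 ≤ p) (hp1 : p ≤ 1) (h : IsCertified p y) :
    Qcap (depol p) ≤ y := by
  refine csSup_le ⟨_, 1, one_pos, rfl⟩ ?_
  rintro _ ⟨n, hn, rfl⟩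
  have hn' : (0 : ℝ) < n := Nat.cast_pos.mpr hn
  have : Q1 ((depol p).pow n) ≤ n * y := by
    refine csSup_le ⟨_, piKron fun _ => (1 / 2 : ℂ) • 1, isDensity_half.piKron, rfl⟩ ?_
    rintro _ ⟨φ, hφ, rfl⟩
    exact h.cohInfo_pow_le hp0 hp1 n hφ
  rw [one_div, inv_mul_le_iff₀ hn']
  exact this

end CapacityBound

section FlaggedMixtures

variable {C A' B' : Type} [Fintype C] [DecidableEq C] [Fintype A'] [DecidableEq A']
  [Fintype B'] [DecidableEq B']

lemma IsSpec.fromBlocks {ρ U : Matrix A A ℂ} {d : A → ℝ} (h : IsSpec ρ U d) {σ V : Matrix B B ℂ}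
    {e : B → ℝ} (h' : IsSpec σ V e) (a b : ℝ) :
    IsSpec (Matrix.fromBlocks ((a : ℂ) • ρ) 0 0 ((b : ℂ) • σ)) (Matrix.fromBlocks U 0 0 V)
      (Sum.elim (fun i => a * d i) (fun j => b * e j)) := by
  constructor
  · rw [Matrix.fromBlocks_conjTranspose, Matrix.fromBlocks_multiply]
    simp [h.star_mul, h'.star_mul, Matrix.fromBlocks_one]
  · have : Matrix.diagonal (fun i => ((Sum.elim (fun i => a * d i) (fun j => b * e j) i : ℝ) : ℂ)) =
        Matrix.fromBlocks ((a : ℂ) • Matrix.diagonal fun i => (d i : ℂ)) 0 0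
          ((b : ℂ) • Matrix.diagonal fun i => (e i : ℂ)) := by
      rw [← Matrix.diagonal_smul, ← Matrix.diagonal_smul, Matrix.fromBlocks_diagonal]
      congr 1
      ext (i | j) <;> simp
    rw [this, Matrix.fromBlocks_conjTranspose, Matrix.fromBlocks_multiply,
      Matrix.fromBlocks_multiply]
    simp [← h.eq, ← h'.eq]

lemma vnEntropy_fromBlocks {ρ : Matrix A A ℂ} (hρ : IsDensity ρ) {σ : Matrix B B ℂ}
    (hσ : IsDensity σ) (a b : ℝ) :
    vnEntropy (Matrix.fromBlocks ((a : ℂ) • ρ) 0 0 ((b : ℂ) • σ)) =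
      a * vnEntropy ρ + b * vnEntropy σ - a * Real.logb 2 a - b * Real.logb 2 b := by
  have key : ∀ {n : Type} [Fintype n] [DecidableEq n] {ρ U : Matrix n n ℂ} {d : n → ℝ},
      IsDensity ρ → IsSpec ρ U d → ∀ a : ℝ,
      ∑ i, a * d i * Real.logb 2 (a * d i) = a * Real.logb 2 a - a * vnEntropy ρ := by
    intro n _ _ ρ U d hρ h a
    have hd : ∑ i, d i = 1 := by
      have := h.trace_eq
      rw [hρ.2] at this
      exact_mod_cast this.symm
    have h1 : ∀ i, a * d i * Real.logb 2 (a * d i) =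
        d i * (a * Real.logb 2 a) + a * (d i * Real.logb 2 (d i)) := by
      intro i
      rcases eq_or_ne a 0 with rfl | ha
      · simp
      rcases eq_or_ne (d i) 0 with hi | hi
      · simp [hi]
      rw [Real.logb_mul ha hi]
      ring
    simp only [h1, Finset.sum_add_distrib, ← Finset.sum_mul, ← Finset.mul_sum, hd]
    rw [h.vnEntropy_eq]
    ring
  obtain ⟨U, d, h⟩ := hρ.1.isHermitian.exists_isSpec
  obtain ⟨V, e, h'⟩ := hσ.1.isHermitian.exists_isSpec
  rw [(h.fromBlocks h' a b).vnEntropy_eq, Fintype.sum_sum_type]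
  simp only [Sum.elim_inl, Sum.elim_inr, key hρ h, key hσ h']
  ring

namespace KrausFamily

/-- Mixture of two channels with a flag recorded in the output, with amplitudes `a` and `b`. -/
noncomputable def flagged (a b : ℝ) (M : KrausFamily C A) (N : KrausFamily C B) :
    KrausFamily C (A ⊕ B) where
  ι := M.ι ⊕ N.ι
  K := Sum.elim (fun i => (a : ℂ) • Matrix.fromRows (M.K i) 0)
    (fun j => (b : ℂ) • Matrix.fromRows 0 (N.K j))

/-- Apply one of two channels according to a flag, forgetting the flag. -/
def copair (M : KrausFamily A C) (N : KrausFamily B C) : KrausFamily (A ⊕ B) C where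
  ι := M.ι ⊕ N.ι
  K := Sum.elim (fun i => Matrix.fromCols (M.K i) 0) (fun j => Matrix.fromCols 0 (N.K j))

/-- Apply one of two channels according to a flag, keeping the flag. -/
def directSum (M : KrausFamily A A') (N : KrausFamily B B') :
    KrausFamily (A ⊕ B) (A' ⊕ B') where
  ι := M.ι ⊕ N.ι
  K := Sum.elim (fun i => Matrix.fromBlocks (M.K i) 0 0 0) (fun j => Matrix.fromBlocks 0 0 0 (N.K j))

lemma IsChannel.flagged {a b : ℝ} (hab : a ^ 2 + b ^ 2 = 1) {M : KrausFamily C A}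
    {N : KrausFamily C B} (hM : M.IsChannel) (hN : N.IsChannel) :
    (KrausFamily.flagged a b M N).IsChannel := by
  change ∑ i : M.ι ⊕ N.ι, _ = _
  rw [Fintype.sum_sum_type]
  simp only [KrausFamily.flagged, Sum.elim_inl, Sum.elim_inr, Matrix.conjTranspose_smul,
    Matrix.conjTranspose_fromRows_eq_fromCols_conjTranspose, Matrix.smul_mul, Matrix.mul_smul,
    Matrix.fromCols_mul_fromRows, Matrix.conjTranspose_zero, Matrix.mul_zero, add_zero, zero_add,
    ← Finset.smul_sum, Complex.star_def, Complex.conj_ofReal]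
  rw [show ∑ i, (M.K i)ᴴ * M.K i = 1 from hM, show ∑ i, (N.K i)ᴴ * N.K i = 1 from hN, smul_smul,
    smul_smul, ← add_smul, ← Complex.ofReal_mul, ← Complex.ofReal_mul, ← Complex.ofReal_add,
    ← sq, ← sq, hab, Complex.ofReal_one, one_smul]

lemma sum_fromBlocks_eq_one {M : KrausFamily A A'} {N : KrausFamily B B'} (hM : M.IsChannel)
    (hN : N.IsChannel) :
    ∑ i, Matrix.fromBlocks ((M.K i)ᴴ * M.K i) 0 0 0 +
      ∑ i, Matrix.fromBlocks 0 0 0 ((N.K i)ᴴ * N.K i) = (1 : Matrix (A ⊕ B) (A ⊕ B) ℂ) := by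
  rw [← Matrix.fromBlocks_one, ← show ∑ i, (M.K i)ᴴ * M.K i = 1 from hM,
    ← show ∑ i, (N.K i)ᴴ * N.K i = 1 from hN]
  ext (i | i) (j | j) <;> simp [Matrix.sum_apply]

lemma IsChannel.copair {M : KrausFamily A C} {N : KrausFamily B C} (hM : M.IsChannel)
    (hN : N.IsChannel) : (KrausFamily.copair M N).IsChannel := by
  change ∑ i : M.ι ⊕ N.ι, _ = _
  rw [Fintype.sum_sum_type]
  simp only [KrausFamily.copair, Sum.elim_inl, Sum.elim_inr,
    Matrix.conjTranspose_fromCols_eq_fromRows_conjTranspose, Matrix.fromRows_mul_fromCols,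
    Matrix.conjTranspose_zero, Matrix.mul_zero, Matrix.zero_mul]
  exact sum_fromBlocks_eq_one hM hN

lemma IsChannel.directSum {M : KrausFamily A A'} {N : KrausFamily B B'} (hM : M.IsChannel)
    (hN : N.IsChannel) : (KrausFamily.directSum M N).IsChannel := by
  change ∑ i : M.ι ⊕ N.ι, _ = _
  rw [Fintype.sum_sum_type]
  simp only [KrausFamily.directSum, Sum.elim_inl, Sum.elim_inr, Matrix.fromBlocks_conjTranspose,
    Matrix.fromBlocks_multiply, Matrix.conjTranspose_zero, Matrix.mul_zero, Matrix.zero_mul,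
    add_zero, zero_add]
  exact sum_fromBlocks_eq_one hM hN

lemma flagged_apply (a b : ℝ) (M : KrausFamily C A) (N : KrausFamily C B) (ρ : Matrix C C ℂ) :
    (flagged a b M N).apply ρ = Matrix.fromBlocks (((a ^ 2 : ℝ) : ℂ) • M.apply ρ) 0 0
      (((b ^ 2 : ℝ) : ℂ) • N.apply ρ) := by
  change ∑ i : M.ι ⊕ N.ι, _ = _
  rw [Fintype.sum_sum_type]
  simp only [flagged, Sum.elim_inl, Sum.elim_inr, Matrix.conjTranspose_smul,
    Matrix.conjTranspose_fromRows_eq_fromCols_conjTranspose, Matrix.smul_mul, Matrix.mul_smul,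
    Matrix.fromRows_mul, Matrix.conjTranspose_zero, Matrix.zero_mul, ← Finset.smul_sum,
    Complex.star_def, Complex.conj_ofReal, smul_smul, ← sq, apply]
  ext (i | i) (j | j) <;> simp [Matrix.sum_apply]

lemma flagged_compl (a b : ℝ) (M : KrausFamily C A) (N : KrausFamily C B) (ρ : Matrix C C ℂ) :
    (flagged a b M N).compl ρ = Matrix.fromBlocks (((a ^ 2 : ℝ) : ℂ) • M.compl ρ) 0 0
      (((b ^ 2 : ℝ) : ℂ) • N.compl ρ) := by
  have key : ∀ K L : Matrix (A ⊕ B) C ℂ, ∀ x y : ℝ,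
      (((x : ℂ) • K) * ρ * ((y : ℂ) • L)ᴴ).trace = x * y * (K * ρ * Lᴴ).trace := by
    intro K L x y
    simp only [Matrix.conjTranspose_smul, Matrix.smul_mul, Matrix.mul_smul, smul_smul,
      Matrix.trace_smul, Complex.star_def, Complex.conj_ofReal, smul_eq_mul, mul_comm (y : ℂ)]
  ext (i | i) (j | j) <;> refine (key _ _ _ _).trans ?_ <;>
    simp [compl, Matrix.conjTranspose_fromRows_eq_fromCols_conjTranspose, Matrix.fromRows_mul,
      Matrix.trace, Fintype.sum_sum_type, sq]

lemma directSum_apply (M : KrausFamily A A') (N : KrausFamily B B') (ρ : Matrix A A ℂ)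
    (σ : Matrix B B ℂ) :
    (directSum M N).apply (Matrix.fromBlocks ρ 0 0 σ) =
      Matrix.fromBlocks (M.apply ρ) 0 0 (N.apply σ) := by
  change ∑ i : M.ι ⊕ N.ι, _ = _
  rw [Fintype.sum_sum_type]
  simp only [directSum, Sum.elim_inl, Sum.elim_inr, Matrix.fromBlocks_conjTranspose,
    Matrix.fromBlocks_multiply, apply, Matrix.conjTranspose_zero, Matrix.mul_zero,
    Matrix.zero_mul, add_zero, zero_add]
  ext (i | i) (j | j) <;> simp [Matrix.sum_apply]

lemma IsDegradable.flagged {M : KrausFamily C A} {N : KrausFamily C B} (hM : M.IsDegradable)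
    (hN : N.IsDegradable) (a b : ℝ) : (KrausFamily.flagged a b M N).IsDegradable := by
  obtain ⟨D, hD, h⟩ := hM
  obtain ⟨E, hE, h'⟩ := hN
  refine ⟨directSum D E, hD.directSum hE, fun ρ => ?_⟩
  rw [flagged_apply, flagged_compl, ← h, ← h']
  refine (directSum_apply D E _ _).trans ?_
  congr 1
  · exact D.applyₗ.map_smul _ _
  · exact E.applyₗ.map_smul _ _

lemma IsChannel.cohInfo_flagged {M : KrausFamily C A} {N : KrausFamily C B} (hM : M.IsChannel)
    (hN : N.IsChannel) (a b : ℝ) {ρ : Matrix C C ℂ} (hρ : IsDensity ρ) :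
    cohInfo (KrausFamily.flagged a b M N) ρ = a ^ 2 * cohInfo M ρ + b ^ 2 * cohInfo N ρ := by
  rw [cohInfo, flagged_apply, flagged_compl, vnEntropy_fromBlocks
    ⟨M.posSemidef_apply hρ.1, by rw [M.trace_apply hM, hρ.2]⟩
    ⟨N.posSemidef_apply hρ.1, by rw [N.trace_apply hN, hρ.2]⟩]
  refine (congrArg _ (vnEntropy_fromBlocks
    ⟨M.posSemidef_compl hρ.1, by rw [hM.trace_compl, hρ.2]⟩
    ⟨N.posSemidef_compl hρ.1, by rw [hN.trace_compl, hρ.2]⟩ _ _)).trans ?_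
  rw [cohInfo, cohInfo]
  ring

end KrausFamily

theorem IsCertified.mix {p y q z a b : ℝ} (h : IsCertified p y) (h' : IsCertified q z)
    (ha : 0 ≤ a) (hb : 0 ≤ b) (hab : a + b = 1) :
    IsCertified (a * p + b * q) (a * y + b * z) := by
  obtain ⟨E, _, _, M, D, hM, hD, hdeg, hF, hy⟩ := h
  obtain ⟨E', _, _, M', D', hM', hD', hdeg', hF', hy'⟩ := h'
  have ea := Real.sq_sqrt ha
  have eb := Real.sq_sqrt hb
  refine ⟨E ⊕ E', inferInstance, inferInstance, M.flagged (Real.sqrt a) (Real.sqrt b) M',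
    D.copair D', hM.flagged (by rw [ea, eb, hab]) hM', hD.copair hD', hdeg.flagged hdeg' _ _,
    ?_, ?_⟩
  · change ∑ i : D.ι ⊕ D'.ι, ∑ j : M.ι ⊕ M'.ι, _ = _
    simp only [Fintype.sum_sum_type, KrausFamily.flagged, KrausFamily.copair, Sum.elim_inl,
      Sum.elim_inr, Matrix.mul_smul, Matrix.fromCols_mul_fromRows, Matrix.mul_zero,
      Matrix.zero_mul, add_zero, zero_add, mul_zero, Matrix.trace_zero, map_zero,
      Finset.sum_const_zero, Matrix.trace_smul, smul_eq_mul, map_mul, Complex.normSq_ofReal,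
      Real.mul_self_sqrt ha, Real.mul_self_sqrt hb, ← Finset.mul_sum, hF, hF']
    linear_combination 4 * hab
  · rw [hM.cohInfo_flagged hM' _ _ isDensity_half, ea, eb]
    gcongr

end FlaggedMixtures

section Certificates

lemma vnEntropy_diagonal {n : Type} [Fintype n] [DecidableEq n] (d : n → ℝ) :
    vnEntropy (Matrix.diagonal fun i => (d i : ℂ)) = -∑ i, d i * Real.logb 2 (d i) :=
  IsSpec.vnEntropy_eq (U := 1) ⟨by simp, by simp⟩

lemma vnEntropy_diagonal_binEnt (x : ℝ) : vnEntropy !![1 - (x : ℂ), 0; 0, x] = binEnt x := by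
  have h : (!![1 - (x : ℂ), 0; 0, x]) = Matrix.diagonal fun i => ((![1 - x, x] i : ℝ) : ℂ) := by
    ext i j
    fin_cases i <;> fin_cases j <;> simp
  rw [h, vnEntropy_diagonal, binEnt]
  simp [Fin.sum_univ_two]
  ring

lemma binEnt_half : binEnt (1 / 2) = 1 := by
  have h : Real.logb 2 (1 / 2) = -1 := by
    rw [one_div, Real.logb_inv, Real.logb_self_eq_one one_lt_two]
  rw [binEnt, show (1 : ℝ) - 1 / 2 = 1 / 2 by norm_num, h]
  norm_num

/-- The identity channel. -/
def KrausFamily.id (A : Type) [Fintype A] [DecidableEq A] : KrausFamily A A where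
  ι := Unit
  K _ := 1

lemma KrausFamily.isChannel_id : (KrausFamily.id A).IsChannel := by
  change ∑ _ : Unit, _ = _
  simp [KrausFamily.id]

lemma KrausFamily.id_apply (ρ : Matrix A A ℂ) : (KrausFamily.id A).apply ρ = ρ := by
  change ∑ _ : Unit, _ = _
  simp [KrausFamily.id]

lemma KrausFamily.IsDegradable.isCertified {M : KrausFamily (Fin 2) (Fin 2)}
    (hdeg : M.IsDegradable) (hM : M.IsChannel) {p : ℝ}
    (hF : ∑ j, Complex.normSq (M.K j).trace = 4 * (1 - p)) :
    IsCertified p (cohInfo M ((1 / 2 : ℂ) • 1)) :=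
  ⟨Fin 2, inferInstance, inferInstance, M, KrausFamily.id _, hM, KrausFamily.isChannel_id, hdeg,
    by
      change ∑ _ : Unit, _ = _
      simpa [KrausFamily.id] using hF, le_rfl⟩

/-- Dephasing channel with real amplitudes `a` and `b`. -/
def dephasing (a b : ℝ) : KrausFamily (Fin 2) (Fin 2) where
  ι := Fin 2
  K := ![!![(a : ℂ), 0; 0, a], !![(b : ℂ), 0; 0, -b]]

/-- Measure-and-prepare channel preparing `(a, b)` on outcome `0` and `(a, -b)` on outcome `1`. -/
def prepare (a b : ℝ) : KrausFamily (Fin 2) (Fin 2) where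
  ι := Fin 2
  K := ![!![(a : ℂ), 0; b, 0], !![0, (a : ℂ); 0, -b]]

lemma dephasing_apply (a b : ℝ) (ρ : Matrix (Fin 2) (Fin 2) ℂ) :
    (dephasing a b).apply ρ = !![(a ^ 2 + b ^ 2) * ρ 0 0, (a ^ 2 - b ^ 2) * ρ 0 1;
      (a ^ 2 - b ^ 2) * ρ 1 0, (a ^ 2 + b ^ 2) * ρ 1 1] := by
  change ∑ i : Fin 2, _ = _
  conv_lhs => rw [Matrix.eta_fin_two ρ]
  ext i j
  fin_cases i <;> fin_cases j <;> simp [dephasing, Matrix.conjTranspose_fin_two] <;> ring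

lemma prepare_apply (a b : ℝ) (ρ : Matrix (Fin 2) (Fin 2) ℂ) :
    (prepare a b).apply ρ = !![a ^ 2 * (ρ 0 0 + ρ 1 1), a * b * (ρ 0 0 - ρ 1 1);
      a * b * (ρ 0 0 - ρ 1 1), b ^ 2 * (ρ 0 0 + ρ 1 1)] := by
  change ∑ i : Fin 2, _ = _
  conv_lhs => rw [Matrix.eta_fin_two ρ]
  ext i j
  fin_cases i <;> fin_cases j <;> simp [prepare, Matrix.conjTranspose_fin_two] <;> ring

lemma dephasing_compl (a b : ℝ) (ρ : Matrix (Fin 2) (Fin 2) ℂ) :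
    (dephasing a b).compl ρ = (prepare a b).apply ρ := by
  rw [prepare_apply]
  change Matrix.of (fun (i j : Fin 2) => _) = _
  conv_lhs => rw [Matrix.eta_fin_two ρ]
  ext i j
  fin_cases i <;> fin_cases j <;>
    simp [dephasing, Matrix.conjTranspose_fin_two, Matrix.trace_fin_two] <;> ring

theorem isCertified_dephasing {q : ℝ} (hq0 : 0 ≤ q) (hq1 : q ≤ 1) :
    IsCertified q (1 - binEnt q) := by
  obtain ⟨a, ha⟩ : ∃ a : ℝ, a ^ 2 = 1 - q := ⟨_, Real.sq_sqrt (sub_nonneg.2 hq1)⟩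
  obtain ⟨b, hb⟩ : ∃ b : ℝ, b ^ 2 = q := ⟨_, Real.sq_sqrt hq0⟩
  have ha' : (a : ℂ) ^ 2 = 1 - q := by exact_mod_cast congrArg Complex.ofReal ha
  have hb' : (b : ℂ) ^ 2 = q := by exact_mod_cast congrArg Complex.ofReal hb
  have hab : (a : ℂ) ^ 2 + b ^ 2 = 1 := by linear_combination ha' + hb'
  have hM : (dephasing a b).IsChannel := by
    change ∑ i : Fin 2, _ = _
    ext i j
    fin_cases i <;> fin_cases j <;>
      simp [dephasing, Matrix.conjTranspose_fin_two] <;> linear_combination hab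
  have hD : (prepare a b).IsChannel := by
    change ∑ i : Fin 2, _ = _
    ext i j
    fin_cases i <;> fin_cases j <;>
      simp [prepare, Matrix.conjTranspose_fin_two] <;> linear_combination hab
  have happ : vnEntropy ((dephasing a b).apply ((1 / 2 : ℂ) • 1)) = 1 := by
    rw [← binEnt_half, ← vnEntropy_diagonal_binEnt, dephasing_apply]
    congr 1
    ext i j
    fin_cases i <;> fin_cases j <;> norm_num [hab]
  have hcompl : vnEntropy ((prepare a b).apply ((1 / 2 : ℂ) • 1)) = binEnt q := by
    rw [← vnEntropy_diagonal_binEnt, prepare_apply]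
    congr 1
    ext i j
    fin_cases i <;> fin_cases j <;> simp
    · linear_combination ha'
    · linear_combination hb'
  have hdeg : (dephasing a b).IsDegradable := by
    refine ⟨prepare a b, hD, fun ρ => ?_⟩
    refine Eq.trans ?_ (dephasing_compl a b ρ).symm
    refine (prepare_apply _ _ _).trans ?_
    simp [dephasing_apply, prepare_apply, hab]
  have h := hdeg.isCertified hM (p := q) <| by
    change ∑ i : Fin 2, _ = _
    simp [dephasing, Matrix.trace_fin_two, Complex.normSq_apply]
    linear_combination 4 * ha
  rw [cohInfo, happ] at h
  refine (congrArg (IsCertified q) (congrArg (1 - ·) ?_)).mp h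
  exact (congrArg (vnEntropy (n := Fin 2)) (dephasing_compl a b _)).trans hcompl

/-- Amplitude damping channel with real amplitudes `c` and `r`. -/
def ampDamp (c r : ℝ) : KrausFamily (Fin 2) (Fin 2) where
  ι := Fin 2
  K := ![!![1, 0; 0, (c : ℂ)], !![0, (r : ℂ); 0, 0]]

lemma ampDamp_apply (c r : ℝ) (ρ : Matrix (Fin 2) (Fin 2) ℂ) :
    (ampDamp c r).apply ρ =
      !![ρ 0 0 + r ^ 2 * ρ 1 1, c * ρ 0 1; c * ρ 1 0, c ^ 2 * ρ 1 1] := by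
  change ∑ i : Fin 2, _ = _
  conv_lhs => rw [Matrix.eta_fin_two ρ]
  ext i j
  fin_cases i <;> fin_cases j <;> simp [ampDamp, Matrix.conjTranspose_fin_two] <;> ring

lemma ampDamp_compl (c r : ℝ) (ρ : Matrix (Fin 2) (Fin 2) ℂ) :
    (ampDamp c r).compl ρ = (ampDamp r c).apply ρ := by
  rw [ampDamp_apply]
  change Matrix.of (fun (i j : Fin 2) => _) = _
  conv_lhs => rw [Matrix.eta_fin_two ρ]
  ext i j
  fin_cases i <;> fin_cases j <;>
    simp [ampDamp, Matrix.conjTranspose_fin_two, Matrix.trace_fin_two] <;> ring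

lemma isChannel_ampDamp {c r : ℝ} (h : c ^ 2 + r ^ 2 = 1) : (ampDamp c r).IsChannel := by
  have h' : (c : ℂ) ^ 2 + r ^ 2 = 1 := by exact_mod_cast congrArg Complex.ofReal h
  change ∑ i : Fin 2, _ = _
  ext i j
  fin_cases i <;> fin_cases j <;> simp [ampDamp, Matrix.conjTranspose_fin_two]
  linear_combination h'

lemma isDegradable_ampDamp {c r : ℝ} (hc : 0 < c) (hrc : r ^ 2 ≤ c ^ 2) :
    (ampDamp c r).IsDegradable := by
  have hc' : (c : ℂ) ≠ 0 := by exact_mod_cast hc.ne'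
  have h1 : (r / c) ^ 2 ≤ 1 := by rw [div_pow]; exact div_le_one_of_le₀ hrc (by positivity)
  obtain ⟨t, ht⟩ : ∃ t : ℝ, t ^ 2 = 1 - (r / c) ^ 2 := ⟨_, Real.sq_sqrt (sub_nonneg.2 h1)⟩
  have ht' : (t : ℂ) ^ 2 = 1 - (r / c) ^ 2 := by exact_mod_cast congrArg Complex.ofReal ht
  refine ⟨ampDamp (r / c) t, isChannel_ampDamp (by rw [ht]; ring), fun ρ => ?_⟩
  refine Eq.trans ?_ ((ampDamp_compl c r ρ).trans (ampDamp_apply _ _ _)).symm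
  refine (ampDamp_apply _ _ _).trans ?_
  rw [ampDamp_apply, ht']
  ext i j
  fin_cases i <;> fin_cases j <;> simp <;> field_simp
  ring

theorem isCertified_ampDamp {c r q : ℝ} (h : c ^ 2 + r ^ 2 = 1) (hc : 0 < c)
    (hrc : r ^ 2 ≤ c ^ 2) (hq : (1 + c) ^ 2 = 4 * (1 - q)) :
    IsCertified q (binEnt (c ^ 2 / 2) - binEnt (r ^ 2 / 2)) := by
  have happ : ∀ {c r : ℝ}, c ^ 2 + r ^ 2 = 1 →
      vnEntropy ((ampDamp c r).apply ((1 / 2 : ℂ) • 1)) = binEnt (c ^ 2 / 2) := by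
    intro c r h
    have h' : (c : ℂ) ^ 2 + r ^ 2 = 1 := by exact_mod_cast congrArg Complex.ofReal h
    rw [← vnEntropy_diagonal_binEnt, ampDamp_apply]
    congr 1
    ext i j
    fin_cases i <;> fin_cases j <;> simp
    · linear_combination h' / 2
    · ring
  have hcert := (isDegradable_ampDamp hc hrc).isCertified (isChannel_ampDamp h) (p := q) <| by
    change ∑ i : Fin 2, _ = _
    simp [ampDamp, Matrix.trace_fin_two, Complex.normSq_apply]
    linear_combination hq
  rw [cohInfo, happ h] at hcert
  refine (congrArg (IsCertified q) (congrArg (binEnt (c ^ 2 / 2) - ·) ?_)).mp hcert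
  exact (congrArg (vnEntropy (n := Fin 2)) (ampDamp_compl c r _)).trans
    (happ (by rw [add_comm, h]))

/-- If the Kraus operators are symmetric under exchange of output and environment, the
complementary channel is the channel itself. -/
lemma KrausFamily.compl_eq_apply (K : B → Matrix B A ℂ) (hK : ∀ i j a, K i j a = K j i a)
    (ρ : Matrix A A ℂ) : (KrausFamily.mk B K).compl ρ = (KrausFamily.mk B K).apply ρ := by
  ext i j
  simp only [KrausFamily.compl, KrausFamily.apply, Matrix.of_apply, Matrix.trace,
    Matrix.diag_apply, Matrix.sum_apply, Matrix.mul_apply, Matrix.conjTranspose_apply, hK i,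
    hK j]

/-- The symmetric universal cloner of a qubit, with the ancilla copied to both clones.
The amplitude is `x = 1 / √6`. -/
def cloner (x : ℝ) (i : Fin 2 × Fin 2) : Matrix (Fin 2 × Fin 2) (Fin 2) ℂ :=
  Matrix.of fun j a => if i.2 = j.2 then
    (if i.1 = j.1 then (if i.1 = i.2 ∧ i.2 = a then 2 * (x : ℂ) else 0)
      else (if i.2 = a then 0 else (x : ℂ))) else 0

lemma cloner_symm (x : ℝ) (i j : Fin 2 × Fin 2) (a : Fin 2) :
    cloner x i j a = cloner x j i a := by
  simp only [cloner, Matrix.of_apply]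
  grind

/-- The partial trace over the second tensor factor. -/
def KrausFamily.fstMarginal (A B : Type) [Fintype A] [DecidableEq A] [Fintype B]
    [DecidableEq B] : KrausFamily (A × B) A where
  ι := B
  K f := Matrix.of fun b j => if b = j.1 ∧ f = j.2 then 1 else 0

lemma KrausFamily.isChannel_fstMarginal : (KrausFamily.fstMarginal A B).IsChannel := by
  change ∑ i : B, _ = _
  ext ⟨a, b⟩ ⟨a', b'⟩
  simp only [KrausFamily.fstMarginal, Matrix.sum_apply, Matrix.mul_apply,
    Matrix.conjTranspose_apply, Matrix.of_apply, Matrix.one_apply, Prod.mk.injEq]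
  simp [ite_and, apply_ite star]
  grind

theorem isCertified_cloner : IsCertified (1 / 4) 0 := by
  obtain ⟨x, hx⟩ : ∃ x : ℝ, x ^ 2 = 1 / 6 := ⟨_, Real.sq_sqrt (by norm_num)⟩
  have hx' : (x : ℂ) ^ 2 = 1 / 6 := by
    simpa using congrArg Complex.ofReal hx
  have hcompl := KrausFamily.compl_eq_apply _ (cloner_symm x)
  refine ⟨Fin 2 × Fin 2, inferInstance, inferInstance, ⟨Fin 2 × Fin 2, cloner x⟩,
    KrausFamily.fstMarginal _ _, ?_, KrausFamily.isChannel_fstMarginal,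
    ⟨KrausFamily.id _, KrausFamily.isChannel_id, fun ρ => ?_⟩, ?_, ?_⟩
  · change ∑ i : Fin 2 × Fin 2, _ = _
    ext i j
    fin_cases i <;> fin_cases j <;>
      simp [Matrix.sum_apply, Matrix.mul_apply, Fintype.sum_prod_type, cloner,
        map_ofNat (starRingEnd ℂ)] <;> linear_combination 6 * hx'
  · exact (KrausFamily.id_apply _).trans (hcompl ρ).symm
  · change ∑ i : Fin 2, ∑ j : Fin 2 × Fin 2, _ = _
    simp [KrausFamily.fstMarginal, Matrix.trace, Matrix.mul_apply, Fintype.sum_prod_type, cloner,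
      Complex.normSq_apply]
    linear_combination 18 * hx
  · rw [cohInfo]
    exact (sub_eq_zero.2 (congrArg (vnEntropy (n := Fin 2 × Fin 2)) (hcompl _)).symm).le

theorem isCertified_cloning_line {q : ℝ} (hq0 : 0 ≤ q) (hq1 : q ≤ 1 / 4) :
    IsCertified q (1 - 4 * q) := by
  have h0 := isCertified_dephasing le_rfl zero_le_one
  have h := h0.mix isCertified_cloner (a := 1 - 4 * q) (b := 4 * q) (by linarith) (by linarith)
    (by ring)
  simpa [binEnt, show 4 * q * 4⁻¹ = q by ring] using h

theorem isCertified_ampDamp_line {q : ℝ} (hq0 : 0 ≤ q) (hq1 : q ≤ 1 / 4) :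
    IsCertified q (binEnt ((1 - 4 * Real.sqrt (1 - q) * (1 - Real.sqrt (1 - q))) / 2) -
      binEnt (4 * Real.sqrt (1 - q) * (1 - Real.sqrt (1 - q)) / 2)) := by
  obtain ⟨s, hs⟩ : ∃ s, s = Real.sqrt (1 - q) := ⟨_, rfl⟩
  have hs2 : s ^ 2 = 1 - q := by rw [hs, Real.sq_sqrt (by linarith)]
  have hs1 : s ≤ 1 := by rw [hs]; exact Real.sqrt_le_one.2 (by linarith)
  have hs0 : 0.86 ≤ s := by
    rw [hs]
    exact Real.le_sqrt_of_sq_le (by norm_num; linarith)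
  obtain ⟨r, hr⟩ : ∃ r : ℝ, r ^ 2 = 4 * s * (1 - s) :=
    ⟨_, Real.sq_sqrt (mul_nonneg (by linarith) (by linarith))⟩
  have hc : (2 * s - 1) ^ 2 = 1 - 4 * s * (1 - s) := by ring
  have h := isCertified_ampDamp (c := 2 * s - 1) (r := r) (q := q) (by rw [hc, hr]; ring)
    (by linarith) (by rw [hr]; nlinarith) (by linear_combination 4 * hs2)
  rwa [hc, hr, hs] at h

end Certificates

section CertifiedBound

/-- The best bound on the capacity of `depol x` obtained from certificates. -/
noncomputable def certifiedBound (x : ℝ) : ℝ := sInf {y | IsCertified x y}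

variable {x y : ℝ}

lemma certifiedBound_le (hx : x ∈ Set.Icc (0 : ℝ) (1 / 4)) (h : IsCertified x y) :
    certifiedBound x ≤ y := by
  refine csInf_le ⟨cohInfo ((depol x).pow 1) (piKron fun _ => (1 / 2 : ℂ) • 1), fun z hz => ?_⟩ h
  simpa using hz.cohInfo_pow_le hx.1 (hx.2.trans (by norm_num)) 1 isDensity_half.piKron

lemma exists_isCertified_lt (hx : x ∈ Set.Icc (0 : ℝ) (1 / 4)) {ε : ℝ} (hε : 0 < ε) :
    ∃ y, IsCertified x y ∧ y < certifiedBound x + ε :=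
  exists_lt_of_csInf_lt ⟨_, isCertified_cloning_line hx.1 hx.2⟩ (lt_add_of_pos_right _ hε)

lemma convexOn_certifiedBound : ConvexOn ℝ (Set.Icc (0 : ℝ) (1 / 4)) certifiedBound := by
  refine ⟨convex_Icc _ _, fun x hx z hz a b ha hb hab => le_of_forall_pos_le_add fun ε hε => ?_⟩
  obtain ⟨u, hu, hu'⟩ := exists_isCertified_lt hx hε
  obtain ⟨v, hv, hv'⟩ := exists_isCertified_lt hz hε
  refine (certifiedBound_le (convex_Icc _ _ hx hz ha hb hab) (hu.mix hv ha hb hab)).trans ?_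
  calc a * u + b * v ≤ a * (certifiedBound x + ε) + b * (certifiedBound z + ε) := by gcongr
    _ = a • certifiedBound x + b • certifiedBound z + ε := by
      simp only [smul_eq_mul]
      linear_combination ε * hab

end CertifiedBound

/-- For `0 ≤ p ≤ 1/4`, the quantum capacity of the depolarizing channel
satisfies `Q(N_p) ≤ co[f₁, f₂, f₃](p)` with `f₁(p) = 1 − H(p)`,
`f₂(p) = H((1−γ(p))/2) − H(γ(p)/2)` where `γ(p) = 4√(1−p)(1−√(1−p))`, and
`f₃(p) = 1 − 4p`, `co` being the largest convex function on `[0, 1/4]` pointwise below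
each `fᵢ`. -/
theorem depolarizing_capacity_le_convex_hull_explicit
    (p : ℝ) (hp0 : 0 ≤ p) (hp1 : p ≤ 1 / 4) :
    Qcap (depol p) ≤ convEnv
      { fun q => 1 - binEnt q,
        fun q => binEnt ((1 - 4 * Real.sqrt (1 - q) * (1 - Real.sqrt (1 - q))) / 2) -
                 binEnt (4 * Real.sqrt (1 - q) * (1 - Real.sqrt (1 - q)) / 2),
        fun q => 1 - 4 * q } p := by
  have hp : p ∈ Set.Icc (0 : ℝ) (1 / 4) := ⟨hp0, hp1⟩
  have hcap : Qcap (depol p) ≤ certifiedBound p :=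
    le_csInf ⟨_, isCertified_cloning_line hp0 hp1⟩ fun y hy =>
      hy.Qcap_le hp0 (hp1.trans (by norm_num))
  refine hcap.trans (le_csSup ⟨1 - 4 * p, ?_⟩
    ⟨certifiedBound, convexOn_certifiedBound, fun q hq f hf => ?_, rfl⟩)
  · rintro _ ⟨g, -, hg, rfl⟩
    exact hg p hp (fun q => 1 - 4 * q) (by simp)
  · refine certifiedBound_le hq ?_
    rcases hf with rfl | rfl | rfl
    · exact isCertified_dephasing hq.1 (hq.2.trans (by norm_num))
    · exact isCertified_ampDamp_line hq.1 hq.2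
    · exact isCertified_cloning_line hq.1 hq.2
end

section
/- Let u, v be reals with |sin v| ≤ |cos u|. Then Q^(1)(T^dep_(u,v)) = H(½(1 + sin u · sin v)) − H(½(1 + cos u · cos v)). -/
open scoped Matrix Kronecker ComplexOrder

variable {A B : Type} [Fintype A] [DecidableEq A] [Fintype B] [DecidableEq B]

/-- The Hadamard matrix `H = (1/√2)[[1,1],[1,−1]]`. -/
noncomputable def Had : Matrix (Fin 2) (Fin 2) ℂ :=
  ((Real.sqrt 2)⁻¹ : ℂ) • !![1, 1; 1, -1]

/-- The phase matrix `S = diag(1, i)`. -/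
def Sgate : Matrix (Fin 2) (Fin 2) ℂ := !![1, 0; 0, Complex.I]

/-- `c : Fin 24 → M₂(ℂ)` is a family of representatives of the single-qubit Clifford
group, the 24-element group (modulo global phase) generated by the Hadamard matrix and the
phase matrix: every `c i` is unitary and lies, up to a phase, in the group generated by
`H` and `S`, and every element of that group is a phase times exactly one `c i`. -/
def IsCliffordFamily (c : Fin 24 → Matrix (Fin 2) (Fin 2) ℂ) : Prop :=
  (∀ i, c i ∈ Matrix.unitaryGroup (Fin 2) ℂ) ∧
  (∀ i, ∃ z : ℂ, z • c i ∈ Submonoid.closure {Had, Sgate}) ∧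
  (∀ u ∈ Submonoid.closure {Had, Sgate}, ∃! i, ∃ z : ℂ, u = z • c i)

/-- The Kraus operator `A₊` of the channel `N_(u,v)`. -/
noncomputable def Aplus (u v : ℝ) : Matrix (Fin 2) (Fin 2) ℂ :=
  !![((Real.cos ((v - u) / 2) : ℝ) : ℂ), 0; 0, ((Real.cos ((v + u) / 2) : ℝ) : ℂ)]

/-- The Kraus operator `A₋` of the channel `N_(u,v)`. -/
noncomputable def Aminus (u v : ℝ) : Matrix (Fin 2) (Fin 2) ℂ :=
  !![0, ((Real.sin ((v + u) / 2) : ℝ) : ℂ); ((Real.sin ((v - u) / 2) : ℝ) : ℂ), 0]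

/-- The two-parameter qubit channel `N_(u,v)` with Kraus operators `A₊`, `A₋`. -/
noncomputable def Nuv (u v : ℝ) : KrausFamily (Fin 2) (Fin 2) where
  ι := Fin 2
  K := ![Aplus u v, Aminus u v]

/-- The flagged channel `T^dep_(u,v)(ρ) = (1/|C|) Σ_{c ∈ C} c† N_(u,v)(c ρ c†) c ⊗ |c⟩⟨c|`,
with Kraus operators `(1/√|C|) c† A_± c ⊗ |c⟩` for `c` running over a family of
representatives of the Clifford group. -/
noncomputable def Tdep (u v : ℝ) (c : Fin 24 → Matrix (Fin 2) (Fin 2) ℂ) :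
    KrausFamily (Fin 2) (Fin 2 × Fin 24) where
  ι := Fin 24 × Fin 2
  K x := Matrix.of fun bf a =>
    if bf.2 = x.1 then
      ((Real.sqrt 24)⁻¹ : ℂ) * ((c x.1)ᴴ * (![Aplus u v, Aminus u v] x.2) * c x.1) bf.1 a
    else 0

/-- The binary entropy, in nats, of a bit of bias `t`. -/
noncomputable def biasEntropy (t : ℝ) : ℝ := Real.binEntropy ((1 + t) / 2)

lemma biasEntropy_neg (t : ℝ) : biasEntropy (-t) = biasEntropy t := by
  unfold biasEntropy
  rw [← Real.binEntropy_one_sub]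
  congr 1
  ring

lemma biasEntropy_sqrt_sq (t : ℝ) : biasEntropy √(t ^ 2) = biasEntropy t := by
  rw [Real.sqrt_sq_eq_abs]
  rcases abs_choice t with h | h <;> rw [h]
  exact biasEntropy_neg t

lemma continuous_biasEntropy : Continuous biasEntropy := by
  unfold biasEntropy
  fun_prop

lemma hasDerivAt_biasEntropy {t : ℝ} (ht : t ∈ Set.Ioo (-1 : ℝ) 1) :
    HasDerivAt biasEntropy (-(Real.log (1 + t) - Real.log (1 - t)) / 2) t := by
  obtain ⟨h1, h2⟩ := ht
  have h := (Real.hasDerivAt_binEntropy (p := (1 + t) / 2) (by linarith) (by linarith)).comp t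
    (((hasDerivAt_id t).const_add 1).div_const 2)
  refine h.congr_deriv ?_
  rw [show 1 - (1 + t) / 2 = (1 - t) / 2 by ring, Real.log_div (by linarith) (by norm_num),
    Real.log_div (by linarith) (by norm_num)]
  ring

lemma hasDerivAt_log_sub_log {t : ℝ} (ht : t ∈ Set.Ioo (-1 : ℝ) 1) :
    HasDerivAt (fun t => Real.log (1 + t) - Real.log (1 - t)) (2 / (1 - t ^ 2)) t := by
  obtain ⟨h1, h2⟩ := ht
  have h3 : 1 + t ≠ 0 := by linarith
  have h4 : 1 - t ≠ 0 := by linarith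
  refine ((((hasDerivAt_id t).const_add 1).log h3).sub
    (((hasDerivAt_id t).const_sub 1).log h4)).congr_deriv ?_
  have h5 : 1 - t ^ 2 ≠ 0 := by
    rw [show 1 - t ^ 2 = (1 + t) * (1 - t) by ring]
    exact mul_ne_zero h3 h4
  simp only [id]
  field_simp
  ring

lemma two_mul_le_log_sub_log {t : ℝ} (ht : t ∈ Set.Ioo (0 : ℝ) 1) :
    2 * t ≤ Real.log (1 + t) - Real.log (1 - t) := by
  have h := Real.hasSum_log_sub_log_of_abs_lt_one (abs_lt.2 ⟨by linarith [ht.1], ht.2⟩)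
  have h0 := le_hasSum h 0 fun k _ => by have := ht.1; positivity
  simpa using h0

/-- The function `t ↦ (1 - t²) artanh t / t` is decreasing, up to the factor `2`. -/
lemma antitoneOn_one_sub_sq_div_mul_log :
    AntitoneOn (fun t : ℝ => (1 - t ^ 2) / t * (Real.log (1 + t) - Real.log (1 - t)))
      (Set.Ioo 0 1) := by
  have hd : ∀ t ∈ Set.Ioo (0 : ℝ) 1, HasDerivAt
      (fun t : ℝ => (1 - t ^ 2) / t * (Real.log (1 + t) - Real.log (1 - t)))
      (2 / t - (1 / t ^ 2 + 1) * (Real.log (1 + t) - Real.log (1 - t))) t := by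
    intro t ht
    have h0 : t ≠ 0 := ht.1.ne'
    have h1 : 1 - t ^ 2 ≠ 0 := by nlinarith [ht.1, ht.2]
    refine ((((hasDerivAt_pow 2 t).const_sub 1).div (hasDerivAt_id t) h0).mul
      (hasDerivAt_log_sub_log ⟨by linarith [ht.1], ht.2⟩)).congr_deriv ?_
    simp only [id, Pi.div_apply]
    field_simp
    ring
  refine antitoneOn_of_deriv_nonpos (convex_Ioo 0 1)
    (fun t ht => (hd t ht).continuousAt.continuousWithinAt)
    (fun t ht => (hd t (interior_subset ht)).differentiableAt.differentiableWithinAt) ?_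
  intro t ht
  have ht' := interior_subset ht
  rw [(hd t ht').deriv]
  have h := two_mul_le_log_sub_log ht'
  have h0 := ht'.1
  have : 2 / t = 1 / t ^ 2 * (2 * t) := by field_simp
  have h2 : 0 < 1 / t ^ 2 := by positivity
  nlinarith [mul_le_mul_of_nonneg_left h h2.le]

lemma hasDerivAt_biasEntropy_sqrt {s : ℝ} (hs : s ∈ Set.Ioo (0 : ℝ) 1) :
    HasDerivAt (fun s => biasEntropy √s)
      (-((1 - √s ^ 2) / √s * (Real.log (1 + √s) - Real.log (1 - √s))) / (4 * (1 - s))) s := by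
  have h0 : 0 < √s := Real.sqrt_pos.2 hs.1
  have h1 : √s < 1 := by rw [Real.sqrt_lt' one_pos]; simpa using hs.2
  have h := (hasDerivAt_biasEntropy (t := √s) ⟨by linarith, h1⟩).comp s
    (Real.hasDerivAt_sqrt hs.1.ne')
  refine h.congr_deriv ?_
  rw [Real.sq_sqrt hs.1.le]
  have : 1 - s ≠ 0 := by linarith [hs.2]
  field_simp
  ring

lemma antitoneOn_biasEntropy_sqrt : AntitoneOn (fun s => biasEntropy √s) (Set.Icc 0 1) := by
  refine antitoneOn_of_deriv_nonpos (convex_Icc 0 1)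
    (continuous_biasEntropy.comp Real.continuous_sqrt).continuousOn ?_ ?_
  · rw [interior_Icc]
    exact fun t ht => (hasDerivAt_biasEntropy_sqrt ht).differentiableAt.differentiableWithinAt
  · rw [interior_Icc]
    intro s hs
    rw [(hasDerivAt_biasEntropy_sqrt hs).deriv]
    have h0 : 0 < √s := Real.sqrt_pos.2 hs.1
    have h1 : √s < 1 := by rw [Real.sqrt_lt' one_pos]; simpa using hs.2
    have h2 := two_mul_le_log_sub_log ⟨h0, h1⟩
    have h3 : 0 < 1 - √s ^ 2 := by nlinarith
    have h4 : 0 < 1 - s := by linarith [hs.2]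
    rw [neg_div, neg_nonpos]
    have h5 : 0 ≤ Real.log (1 + √s) - Real.log (1 - √s) := by linarith
    positivity

/-- Moving both squared biases along a ray increases the entropy gap. -/
lemma biasEntropy_sqrt_sub_le_along_ray {α β s r X : ℝ} (hβ : 0 ≤ β) (hβα : β ≤ α)
    (hs : 0 ≤ s) (hr : 0 ≤ r) (hX : 0 ≤ X) (h1 : r + β * X ≤ 1)
    (hle : s + α * X ≤ r + β * X) (hsl : β * (1 - s) ≤ α * (1 - r)) :
    biasEntropy √(s + α * X) - biasEntropy √(r + β * X) ≤ biasEntropy √s - biasEntropy √r := by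
  rcases hβ.eq_or_lt with rfl | hβ
  · have : biasEntropy √(s + α * X) ≤ biasEntropy √s :=
      antitoneOn_biasEntropy_sqrt ⟨hs, by nlinarith⟩ ⟨by positivity, by nlinarith⟩
        (by nlinarith)
    simpa using this
  rcases hX.eq_or_lt with rfl | hX
  · simp
  have hα : 0 < α := by linarith
  have key : AntitoneOn (fun x => biasEntropy √(s + α * x) - biasEntropy √(r + β * x))
      (Set.Icc 0 X) := by
    have hd : ∀ x ∈ Set.Ioo 0 X, s + α * x ∈ Set.Ioo (0 : ℝ) 1 ∧
        r + β * x ∈ Set.Ioo (0 : ℝ) 1 ∧ s + α * x ≤ r + β * x := by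
      rintro x ⟨hx0, hx1⟩
      have ha := mul_pos hα hx0
      have hb := mul_pos hβ hx0
      have ha' := mul_lt_mul_of_pos_left hx1 hα
      have hb' := mul_lt_mul_of_pos_left hx1 hβ
      refine ⟨⟨by linarith, by linarith⟩, ⟨by linarith, by linarith⟩, ?_⟩
      nlinarith [mul_nonneg (sub_nonneg.2 hβα) (sub_nonneg.2 hx1.le)]
    have hd' : ∀ x ∈ Set.Ioo 0 X, _ := fun x hx =>
      ((hasDerivAt_biasEntropy_sqrt (hd x hx).1).comp x
        (((hasDerivAt_id x).const_mul α).const_add s)).sub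
      ((hasDerivAt_biasEntropy_sqrt (hd x hx).2.1).comp x
        (((hasDerivAt_id x).const_mul β).const_add r))
    refine antitoneOn_of_deriv_nonpos (convex_Icc 0 X) ?_ ?_ ?_
    · have := continuous_biasEntropy
      fun_prop
    · rw [interior_Icc]
      exact fun x hx => (hd' x hx).differentiableAt.differentiableWithinAt
    · rw [interior_Icc]
      intro x hx
      refine (hd' x hx).deriv.trans_le ?_
      obtain ⟨hA, hB, hAB⟩ := hd x hx
      simp only [mul_one]
      generalize hAe : s + α * x = A at *
      generalize hBe : r + β * x = B at *
      have hm := antitoneOn_one_sub_sq_div_mul_log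
        (show √A ∈ Set.Ioo (0 : ℝ) 1 from
          ⟨Real.sqrt_pos.2 hA.1, by rw [Real.sqrt_lt' one_pos]; simpa using hA.2⟩)
        (show √B ∈ Set.Ioo (0 : ℝ) 1 from
          ⟨Real.sqrt_pos.2 hB.1, by rw [Real.sqrt_lt' one_pos]; simpa using hB.2⟩)
        (Real.sqrt_le_sqrt hAB)
      have hpos : 0 ≤ (1 - √B ^ 2) / √B * (Real.log (1 + √B) - Real.log (1 - √B)) := by
        have h0 : 0 < √B := Real.sqrt_pos.2 hB.1
        have h1 : √B < 1 := by rw [Real.sqrt_lt' one_pos]; simpa using hB.2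
        have h2 := two_mul_le_log_sub_log ⟨h0, h1⟩
        have h3 : 0 < 1 - √B ^ 2 := by nlinarith
        have h5 : 0 ≤ Real.log (1 + √B) - Real.log (1 - √B) := by linarith
        positivity
      simp only at hm
      generalize (1 - √B ^ 2) / √B * (Real.log (1 + √B) - Real.log (1 - √B)) = MB at *
      generalize (1 - √A ^ 2) / √A * (Real.log (1 + √A) - Real.log (1 - √A)) = MA at *
      have hA' : 0 < 1 - A := by linarith [hA.2]
      have hB' : 0 < 1 - B := by linarith [hB.2]
      have hsl' : β * (1 - A) ≤ α * (1 - B) := by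
        rw [← hAe, ← hBe]; linarith
      have : β * MB / (4 * (1 - B)) ≤ α * MA / (4 * (1 - A)) := by
        rw [div_le_div_iff₀ (by positivity) (by positivity)]
        have e1 := mul_le_mul_of_nonneg_left hm (mul_nonneg hα.le hB'.le)
        have e2 := mul_le_mul_of_nonneg_right hsl' hpos
        linarith
      calc _ = β * MB / (4 * (1 - B)) - α * MA / (4 * (1 - A)) := by ring
        _ ≤ 0 := by linarith
  simpa using key ⟨le_rfl, hX.le⟩ ⟨hX.le, le_rfl⟩ hX.le

/-- Convexity of the entropy gap along the axis of a qubit channel. -/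
lemma biasEntropy_axis_average {p q z : ℝ} (hqp : q ^ 2 ≤ p ^ 2) (hpq : |p| + |q| ≤ 1)
    (hz : z ∈ Set.Icc (-1 : ℝ) 1) :
    (biasEntropy (q + p * z) - biasEntropy (p + q * z)) +
      (biasEntropy (q - p * z) - biasEntropy (p - q * z)) ≤
      2 * (biasEntropy q - biasEntropy p) := by
  rcases eq_or_ne q 0 with rfl | hq
  · have h : ∀ t, biasEntropy t ≤ biasEntropy 0 := fun t => by
      simpa [biasEntropy] using Real.binEntropy_le_log_two
    have h1 := h (0 + p * z)
    have h2 := h (0 - p * z)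
    simp only [zero_mul, add_zero, sub_zero]
    linarith
  have hp : p ≠ 0 := by
    rintro rfl
    have := sq_nonneg q
    exact hq (pow_eq_zero_iff two_ne_zero |>.1 (by nlinarith))
  have bound : ∀ {a b : ℝ}, b ≠ 0 → |a| + |b| ≤ 1 → ∀ x ∈ Set.Ioo (-1 : ℝ) 1,
      a + b * x ∈ Set.Ioo (-1 : ℝ) 1 := by
    intro a b hb hab x hx
    rw [Set.mem_Ioo, ← abs_lt]
    calc |a + b * x| ≤ |a| + |b| * |x| := by rw [← abs_mul]; exact abs_add_le _ _
      _ < |a| + |b| * 1 := by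
        have h0 := abs_pos.2 hb
        gcongr
        exact abs_lt.2 hx
      _ ≤ 1 := by linarith
  have hP := bound hq hpq
  have hQ := bound hp (by linarith : |q| + |p| ≤ 1)
  have conv : ConvexOn ℝ (Set.Icc (-1 : ℝ) 1)
      (fun x => biasEntropy (p + q * x) - biasEntropy (q + p * x)) := by
    refine convexOn_of_hasDerivWithinAt2_nonneg (convex_Icc _ _)
      (f' := fun x => -(Real.log (1 + (p + q * x)) - Real.log (1 - (p + q * x))) / 2 * q -
        -(Real.log (1 + (q + p * x)) - Real.log (1 - (q + p * x))) / 2 * p)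
      (f'' := fun x => p ^ 2 / (1 - (q + p * x) ^ 2) - q ^ 2 / (1 - (p + q * x) ^ 2)) ?_ ?_ ?_ ?_
    · have := continuous_biasEntropy
      fun_prop
    · rw [interior_Icc]
      intro x hx
      refine HasDerivAt.hasDerivWithinAt ?_
      have d1 := (hasDerivAt_biasEntropy (hP x hx)).comp x
        (((hasDerivAt_id x).const_mul q).const_add p)
      have d2 := (hasDerivAt_biasEntropy (hQ x hx)).comp x
        (((hasDerivAt_id x).const_mul p).const_add q)
      exact (d1.sub d2).congr_deriv (by simp)
    · rw [interior_Icc]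
      intro x hx
      refine HasDerivAt.hasDerivWithinAt ?_
      have d1 := (hasDerivAt_log_sub_log (hP x hx)).comp x
        (((hasDerivAt_id x).const_mul q).const_add p)
      have d2 := (hasDerivAt_log_sub_log (hQ x hx)).comp x
        (((hasDerivAt_id x).const_mul p).const_add q)
      refine (((d1.neg.div_const 2).mul_const q).sub
        ((d2.neg.div_const 2).mul_const p)).congr_deriv ?_
      simp only [mul_one]
      ring
    · rw [interior_Icc]
      intro x hx
      have h1 := hP x hx
      have h2 := hQ x hx
      have h1' : 0 < 1 - (p + q * x) ^ 2 := by nlinarith [h1.1, h1.2]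
      have h2' : 0 < 1 - (q + p * x) ^ 2 := by nlinarith [h2.1, h2.2]
      rw [sub_nonneg, div_le_div_iff₀ h1' h2']
      have h3 : 0 ≤ 1 - p ^ 2 - q ^ 2 - 2 * p * q * x := by
        have e1 : p * q * x ≤ |p| * |q| := by
          calc p * q * x ≤ |p * q * x| := le_abs_self _
            _ = |p| * |q| * |x| := by rw [abs_mul, abs_mul]
            _ ≤ |p| * |q| * 1 := by gcongr; exact (abs_lt.2 hx).le
            _ = _ := mul_one _
        have e2 : (|p| + |q|) ^ 2 ≤ 1 := pow_le_one₀ (by positivity) hpq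
        nlinarith [sq_abs p, sq_abs q]
      nlinarith [mul_nonneg (sub_nonneg.2 hqp) h3]
  have h := conv.2 hz (show -z ∈ Set.Icc (-1 : ℝ) 1 from ⟨by linarith [hz.2], by linarith [hz.1]⟩)
    (show (0 : ℝ) ≤ 1 / 2 by norm_num) (show (0 : ℝ) ≤ 1 / 2 by norm_num) (by norm_num)
  have e : (1 / 2 : ℝ) • z + (1 / 2 : ℝ) • (-z) = 0 := by simp
  rw [e] at h
  simp only [smul_eq_mul, mul_zero, add_zero, mul_neg, ← sub_eq_add_neg] at h
  linarith

/-- Squared length of the Bloch vector output by `Nuv u v`, for input Bloch vector `(x, y, z)`. -/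
noncomputable def outSq (u v x y z : ℝ) : ℝ :=
  (Real.cos u * x) ^ 2 + (Real.cos v * y) ^ 2 +
    (Real.sin u * Real.sin v + Real.cos u * Real.cos v * z) ^ 2

/-- Squared length of the Bloch vector output by the complement of `Nuv u v`, for input Bloch
vector `(x, y, z)`. -/
noncomputable def envSq (u v x y z : ℝ) : ℝ :=
  (Real.sin v * x) ^ 2 + (Real.sin u * y) ^ 2 +
    (Real.cos u * Real.cos v + Real.sin u * Real.sin v * z) ^ 2

lemma envSq_sub_outSq (u v x y z : ℝ) : envSq u v x y z - outSq u v x y z =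
    (Real.cos u ^ 2 - Real.sin v ^ 2) * (1 - (x ^ 2 + y ^ 2 + z ^ 2)) := by
  unfold envSq outSq
  have h1 := Real.sin_sq_add_cos_sq u
  have h2 := Real.sin_sq_add_cos_sq v
  rw [← eq_sub_iff_add_eq] at h1
  rw [← eq_sub_iff_add_eq'] at h2
  ring_nf
  simp only [h1, h2]
  ring

lemma envSq_le_one {u v x y z : ℝ} (hr : x ^ 2 + y ^ 2 + z ^ 2 ≤ 1) : envSq u v x y z ≤ 1 := by
  unfold envSq
  have h1 := Real.sin_sq_add_cos_sq u
  have h2 := Real.sin_sq_add_cos_sq v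
  generalize Real.cos u = a at *
  generalize Real.sin u = c at *
  generalize Real.cos v = b at *
  generalize Real.sin v = d at *
  rcases le_total (c ^ 2) (d ^ 2) with h | h
  · have e1 : (a * b + c * d * z) ^ 2 ≤ (a ^ 2 + c ^ 2) * (b ^ 2 + (d * z) ^ 2) := by
      nlinarith [sq_nonneg (a * (d * z) - c * b)]
    have e2 := mul_le_mul_of_nonneg_right h (sq_nonneg y)
    have e3 := mul_le_mul_of_nonneg_left hr (sq_nonneg d)
    rw [add_comm (a ^ 2), h1] at e1
    nlinarith
  · have e1 : (a * b + c * d * z) ^ 2 ≤ (b ^ 2 + d ^ 2) * (a ^ 2 + (c * z) ^ 2) := by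
      nlinarith [sq_nonneg (b * (c * z) - d * a)]
    have e2 := mul_le_mul_of_nonneg_right h (sq_nonneg x)
    have e3 := mul_le_mul_of_nonneg_left hr (sq_nonneg c)
    nlinarith

lemma outSq_le_one_sub_cos_u {u v y z : ℝ} (h : Real.cos v ^ 2 ≤ Real.cos u ^ 2) :
    Real.cos u ^ 2 * (1 - (y ^ 2 + z ^ 2)) ≤ 1 - outSq u v 0 y z := by
  unfold outSq
  have h1 := Real.sin_sq_add_cos_sq u
  have h2 := Real.sin_sq_add_cos_sq v
  generalize Real.cos u = a at *
  generalize Real.sin u = c at *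
  generalize Real.cos v = b at *
  generalize Real.sin v = d at *
  have e1 : (c * d + a * b * z) ^ 2 ≤ (d ^ 2 + b ^ 2) * (c ^ 2 + (a * z) ^ 2) := by
    nlinarith [sq_nonneg (d * (a * z) - b * c)]
  have e2 := mul_le_mul_of_nonneg_right h (sq_nonneg y)
  rw [h2] at e1
  nlinarith

lemma outSq_le_one_sub_cos_v {u v x z : ℝ} (h : Real.cos u ^ 2 ≤ Real.cos v ^ 2) :
    Real.cos v ^ 2 * (1 - (x ^ 2 + z ^ 2)) ≤ 1 - outSq u v x 0 z := by
  unfold outSq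
  have h1 := Real.sin_sq_add_cos_sq u
  have h2 := Real.sin_sq_add_cos_sq v
  generalize Real.cos u = a at *
  generalize Real.sin u = c at *
  generalize Real.cos v = b at *
  generalize Real.sin v = d at *
  have e1 : (c * d + a * b * z) ^ 2 ≤ (c ^ 2 + a ^ 2) * (d ^ 2 + (b * z) ^ 2) := by
    nlinarith [sq_nonneg (c * (b * z) - a * d)]
  have e2 := mul_le_mul_of_nonneg_right h (sq_nonneg x)
  rw [h1] at e1
  nlinarith

/-- The coherent information, in nats, of `Nuv u v` at the input of Bloch vector `(x, y, z)`. -/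
noncomputable def blochGap (u v x y z : ℝ) : ℝ :=
  biasEntropy √(outSq u v x y z) - biasEntropy √(envSq u v x y z)

lemma outSq_nonneg (u v x y z : ℝ) : 0 ≤ outSq u v x y z := by
  unfold outSq
  positivity

lemma envSq_nonneg (u v x y z : ℝ) : 0 ≤ envSq u v x y z := by
  unfold envSq
  positivity

lemma blochGap_le_x {u v x y z : ℝ} (huv : Real.sin v ^ 2 ≤ Real.cos u ^ 2)
    (hcos : y = 0 ∨ Real.cos v ^ 2 ≤ Real.cos u ^ 2) (hr : x ^ 2 + y ^ 2 + z ^ 2 ≤ 1) :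
    blochGap u v x y z ≤ blochGap u v 0 y z := by
  have e1 : outSq u v x y z = outSq u v 0 y z + Real.cos u ^ 2 * x ^ 2 := by
    unfold outSq; ring
  have e2 : envSq u v x y z = envSq u v 0 y z + Real.sin v ^ 2 * x ^ 2 := by
    unfold envSq; ring
  have e3 := envSq_sub_outSq u v x y z
  have e4 := envSq_sub_outSq u v 0 y z
  have e5 := envSq_le_one (u := u) (v := v) hr
  have hcu : Real.cos u ^ 2 * (1 - (y ^ 2 + z ^ 2)) ≤ 1 - outSq u v 0 y z := by
    rcases hcos with rfl | hcos
    · unfold outSq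
      nlinarith [Real.sin_sq_add_cos_sq u, Real.sin_sq_add_cos_sq v,
        sq_nonneg (Real.sin v * (Real.cos u * z) - Real.cos v * Real.sin u)]
    · exact outSq_le_one_sub_cos_u hcos
  unfold blochGap
  rw [e1, e2]
  refine biasEntropy_sqrt_sub_le_along_ray (sq_nonneg _) huv (outSq_nonneg ..) (envSq_nonneg ..)
    (sq_nonneg _) (by linarith) ?_ ?_
  · rw [← e1, ← e2, ← sub_nonneg, e3]
    exact mul_nonneg (by linarith) (by linarith)
  · have := mul_le_mul_of_nonneg_left hcu (sub_nonneg.2 huv)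
    nlinarith

lemma blochGap_le_y {u v x y z : ℝ} (huv : Real.sin v ^ 2 ≤ Real.cos u ^ 2)
    (hcos : x = 0 ∨ Real.cos u ^ 2 ≤ Real.cos v ^ 2) (hr : x ^ 2 + y ^ 2 + z ^ 2 ≤ 1) :
    blochGap u v x y z ≤ blochGap u v x 0 z := by
  have e1 : outSq u v x y z = outSq u v x 0 z + Real.cos v ^ 2 * y ^ 2 := by
    unfold outSq; ring
  have e2 : envSq u v x y z = envSq u v x 0 z + Real.sin u ^ 2 * y ^ 2 := by
    unfold envSq; ring
  have e3 := envSq_sub_outSq u v x y z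
  have e4 := envSq_sub_outSq u v x 0 z
  have e5 := envSq_le_one (u := u) (v := v) hr
  have hδ : Real.cos u ^ 2 - Real.sin v ^ 2 = Real.cos v ^ 2 - Real.sin u ^ 2 := by
    linarith [Real.sin_sq_add_cos_sq u, Real.sin_sq_add_cos_sq v]
  have hcu : Real.cos v ^ 2 * (1 - (x ^ 2 + z ^ 2)) ≤ 1 - outSq u v x 0 z := by
    rcases hcos with rfl | hcos
    · unfold outSq
      nlinarith [Real.sin_sq_add_cos_sq u, Real.sin_sq_add_cos_sq v,
        sq_nonneg (Real.sin u * (Real.cos v * z) - Real.cos u * Real.sin v)]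
    · exact outSq_le_one_sub_cos_v hcos
  unfold blochGap
  rw [e1, e2]
  refine biasEntropy_sqrt_sub_le_along_ray (sq_nonneg _) (by linarith) (outSq_nonneg ..)
    (envSq_nonneg ..) (sq_nonneg _) (by linarith) ?_ ?_
  · rw [← e1, ← e2, ← sub_nonneg, e3]
    exact mul_nonneg (by linarith) (by linarith)
  · have := mul_le_mul_of_nonneg_left hcu (sub_nonneg.2 huv)
    rw [hδ] at this e4
    nlinarith

lemma blochGap_le_axis {u v x y z : ℝ} (huv : Real.sin v ^ 2 ≤ Real.cos u ^ 2)
    (hr : x ^ 2 + y ^ 2 + z ^ 2 ≤ 1) : blochGap u v x y z ≤ blochGap u v 0 0 z := by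
  rcases le_total (Real.cos v ^ 2) (Real.cos u ^ 2) with h | h
  · exact (blochGap_le_x huv (.inr h) hr).trans
      (blochGap_le_y huv (.inl rfl) (by nlinarith [sq_nonneg x]))
  · exact (blochGap_le_y huv (.inr h) hr).trans
      (blochGap_le_x huv (.inl rfl) (by nlinarith [sq_nonneg y]))

lemma blochGap_axis (u v z : ℝ) : blochGap u v 0 0 z =
    biasEntropy (Real.sin u * Real.sin v + Real.cos u * Real.cos v * z) -
      biasEntropy (Real.cos u * Real.cos v + Real.sin u * Real.sin v * z) := by
  simp [blochGap, outSq, envSq, biasEntropy_sqrt_sq]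

/-- The coherent information of `Nuv u v`, averaged over opposite heights of the Bloch ball, is
at most its value at the centre. -/
lemma blochGap_add_blochGap_neg_le {u v x y z : ℝ} (huv : |Real.sin v| ≤ |Real.cos u|)
    (hr : x ^ 2 + y ^ 2 + z ^ 2 ≤ 1) :
    blochGap u v x y z + blochGap u v x (-y) (-z) ≤ 2 * blochGap u v 0 0 0 := by
  have huv' := sq_le_sq.2 huv
  have h1 := blochGap_le_axis huv' hr
  have h2 := blochGap_le_axis (y := -y) (z := -z) huv' (by simpa using hr)
  have hz : z ∈ Set.Icc (-1 : ℝ) 1 := by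
    rw [Set.mem_Icc, ← abs_le, abs_le_one_iff_mul_self_le_one]
    nlinarith [sq_nonneg x, sq_nonneg y]
  have s1 := Real.sin_sq_add_cos_sq u
  have s2 := Real.sin_sq_add_cos_sq v
  have h3 := biasEntropy_axis_average (p := Real.cos u * Real.cos v)
    (q := Real.sin u * Real.sin v) ?_ ?_ hz
  · rw [blochGap_axis] at h1 h2
    rw [blochGap_axis]
    simp only [mul_zero, add_zero, mul_neg, ← sub_eq_add_neg] at h2 ⊢
    linarith
  · nlinarith
  · rw [abs_mul, abs_mul]
    nlinarith [sq_nonneg (|Real.cos u| - |Real.cos v|), sq_nonneg (|Real.sin u| - |Real.sin v|),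
      sq_abs (Real.cos u), sq_abs (Real.cos v), sq_abs (Real.sin u), sq_abs (Real.sin v)]

lemma binEnt_eq (x : ℝ) : binEnt x = Real.binEntropy x / Real.log 2 := by
  rw [binEnt, Real.binEntropy_eq_negMulLog_add_negMulLog_one_sub]
  simp only [Real.negMulLog, Real.logb]
  ring

lemma vnEntropy_eq_sum_roots {n : Type} [Fintype n] [DecidableEq n] {ρ : Matrix n n ℂ}
    (h : ρ.IsHermitian) :
    vnEntropy ρ = (ρ.charpoly.roots.map fun z => Real.negMulLog z.re / Real.log 2).sum := by
  rw [vnEntropy, dif_pos h, h.roots_charpoly_eq_eigenvalues, Multiset.map_map,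
    ← Finset.sum_neg_distrib]
  refine Finset.sum_congr rfl fun j _ => ?_
  simp only [Function.comp_apply, Real.negMulLog, Real.logb, RCLike.ofReal_eq_complex_ofReal,
    Complex.ofReal_re]
  ring

lemma vnEntropy_reindex {m n : Type} [Fintype m] [DecidableEq m] [Fintype n] [DecidableEq n]
    (e : m ≃ n) {ρ : Matrix m m ℂ} (h : ρ.IsHermitian) :
    vnEntropy (Matrix.reindex e e ρ) = vnEntropy ρ := by
  have h' : (Matrix.reindex e e ρ).IsHermitian := h.submatrix e.symm
  rw [vnEntropy_eq_sum_roots h, vnEntropy_eq_sum_roots h', Matrix.charpoly_reindex]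

lemma charmatrix_blockDiagonal {o m R : Type*} [Fintype o] [DecidableEq o] [Fintype m]
    [DecidableEq m] [CommRing R] (M : o → Matrix m m R) :
    (Matrix.blockDiagonal M).charmatrix = Matrix.blockDiagonal fun k => (M k).charmatrix := by
  ext ⟨i, k⟩ ⟨j, l⟩
  by_cases hk : k = l
  · subst hk
    by_cases hi : i = j
    · subst hi
      simp [Matrix.blockDiagonal_apply]
    · simp [Matrix.blockDiagonal_apply, hi]
  · simp [Matrix.blockDiagonal_apply, hk]

lemma charpoly_blockDiagonal {o m R : Type*} [Fintype o] [DecidableEq o] [Fintype m]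
    [DecidableEq m] [CommRing R] (M : o → Matrix m m R) :
    (Matrix.blockDiagonal M).charpoly = ∏ k, (M k).charpoly := by
  rw [Matrix.charpoly, charmatrix_blockDiagonal, Matrix.det_blockDiagonal]
  rfl

lemma roots_charpoly_fin_two {w s : ℝ} (hs : 0 ≤ s) {M : Matrix (Fin 2) (Fin 2) ℂ}
    (htr : M.trace = w) (hdet : M.det = w ^ 2 * (1 - s) / 4) :
    M.charpoly.roots = {((w * ((1 + √s) / 2) : ℝ) : ℂ), ((w * (1 - (1 + √s) / 2) : ℝ) : ℂ)} := by
  have h : M.charpoly =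
      (Polynomial.X - Polynomial.C ((w * ((1 + √s) / 2) : ℝ) : ℂ)) *
        (Polynomial.X - Polynomial.C ((w * (1 - (1 + √s) / 2) : ℝ) : ℂ)) := by
    have e1 : M.trace = ((w * ((1 + √s) / 2) : ℝ) : ℂ) + ((w * (1 - (1 + √s) / 2) : ℝ) : ℂ) := by
      rw [htr]; push_cast; ring
    have e2 : M.det = ((w * ((1 + √s) / 2) : ℝ) : ℂ) * ((w * (1 - (1 + √s) / 2) : ℝ) : ℂ) := by
      rw [hdet]
      have : (s : ℂ) = (√s : ℂ) ^ 2 := by exact_mod_cast (Real.sq_sqrt hs).symm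
      rw [this]; push_cast; ring
    rw [Matrix.charpoly_fin_two, e1, e2]
    simp only [map_add, map_mul]
    ring
  rw [h, Polynomial.roots_mul (mul_ne_zero (Polynomial.X_sub_C_ne_zero _)
    (Polynomial.X_sub_C_ne_zero _)), Polynomial.roots_X_sub_C, Polynomial.roots_X_sub_C]
  rfl

lemma vnEntropy_blockDiagonal_fin_two {o : Type} [Fintype o] [DecidableEq o] {w : ℝ}
    {s : o → ℝ} (hs : ∀ k, 0 ≤ s k) {M : o → Matrix (Fin 2) (Fin 2) ℂ}
    (hM : (Matrix.blockDiagonal M).IsHermitian) (htr : ∀ k, (M k).trace = w)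
    (hdet : ∀ k, (M k).det = w ^ 2 * (1 - s k) / 4) :
    vnEntropy (Matrix.blockDiagonal M) =
      ∑ k, (w * biasEntropy √(s k) + Real.negMulLog w) / Real.log 2 := by
  rw [vnEntropy_eq_sum_roots hM, charpoly_blockDiagonal, Polynomial.roots_prod _ _
    (Finset.prod_ne_zero_iff.2 fun k _ => (Matrix.charpoly_monic _).ne_zero),
    Multiset.map_bind, Multiset.sum_bind]
  refine Finset.sum_congr rfl fun k _ => ?_
  rw [roots_charpoly_fin_two (hs k) (htr k) (hdet k)]
  simp only [Multiset.insert_eq_cons, Multiset.map_cons, Multiset.map_singleton,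
    Multiset.sum_cons, Multiset.sum_singleton, Complex.ofReal_re, Real.negMulLog_mul,
    biasEntropy, Real.binEntropy_eq_negMulLog_add_negMulLog_one_sub]
  ring

lemma KrausFamily.isHermitian_apply {A B : Type} [Fintype A] [DecidableEq A] [Fintype B]
    [DecidableEq B] (N : KrausFamily A B) {φ : Matrix A A ℂ} (h : φ.IsHermitian) :
    (N.apply φ).IsHermitian := by
  rw [KrausFamily.apply]
  unfold Matrix.IsHermitian
  rw [Matrix.conjTranspose_sum]
  exact Finset.sum_congr rfl fun i _ => Matrix.isHermitian_mul_mul_conjTranspose _ h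

lemma KrausFamily.isHermitian_compl {A B : Type} [Fintype A] [DecidableEq A] [Fintype B]
    [DecidableEq B] (N : KrausFamily A B) {φ : Matrix A A ℂ} (h : φ.IsHermitian) :
    (N.compl φ).IsHermitian := by
  ext i j
  rw [Matrix.conjTranspose_apply, KrausFamily.compl, Matrix.of_apply, Matrix.of_apply,
    ← Matrix.trace_conjTranspose]
  simp [Matrix.conjTranspose_mul, h.eq, Matrix.mul_assoc]

/-- The density matrix of Bloch vector `(x, -y, z)`. -/
noncomputable def blochMatrix (x y z : ℝ) : Matrix (Fin 2) (Fin 2) ℂ :=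
  !![(1 + z) / 2, (x + y * Complex.I) / 2; (x - y * Complex.I) / 2, (1 - z) / 2]

lemma trace_blochMatrix (x y z : ℝ) : (blochMatrix x y z).trace = 1 := by
  rw [Matrix.trace_fin_two]
  simp only [blochMatrix, Matrix.of_apply, Matrix.cons_val', Matrix.cons_val_zero,
    Matrix.cons_val_one, Matrix.cons_val_fin_one]
  ring

lemma det_blochMatrix (x y z : ℝ) :
    (blochMatrix x y z).det = (((1 - (x ^ 2 + y ^ 2 + z ^ 2)) / 4 : ℝ) : ℂ) := by
  rw [Matrix.det_fin_two]
  simp only [blochMatrix, Matrix.of_apply, Matrix.cons_val', Matrix.cons_val_zero,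
    Matrix.cons_val_one, Matrix.cons_val_fin_one]
  push_cast
  linear_combination (y : ℂ) ^ 2 / 4 * Complex.I_sq

lemma exists_eq_blochMatrix {ψ : Matrix (Fin 2) (Fin 2) ℂ} (h : IsDensity ψ) :
    ∃ x y z : ℝ, x ^ 2 + y ^ 2 + z ^ 2 ≤ 1 ∧ ψ = blochMatrix x y z := by
  obtain ⟨hpos, htr⟩ := h
  have hH := hpos.isHermitian
  have h00 : (ψ 0 0).im = 0 := Complex.conj_eq_iff_im.1 (hH.apply 0 0)
  have h10 : ψ 1 0 = (starRingEnd ℂ) (ψ 0 1) := (hH.apply 1 0).symm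
  have h11 : ψ 1 1 = 1 - ψ 0 0 := by
    rw [Matrix.trace_fin_two] at htr
    exact eq_sub_of_add_eq' htr
  have hψ : ψ = blochMatrix (2 * (ψ 0 1).re) (2 * (ψ 0 1).im) (2 * (ψ 0 0).re - 1) := by
    ext i j
    fin_cases i <;> fin_cases j
    · apply Complex.ext
      · simp [blochMatrix]
      · simp [blochMatrix, h00]
    · apply Complex.ext <;> simp [blochMatrix]
    · apply Complex.ext
      · simp [blochMatrix, h10]
      · simp [blochMatrix, h10, neg_div]
    · apply Complex.ext
      · simp [blochMatrix, h11]
        ring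
      · simp [blochMatrix, h11, h00]
  refine ⟨_, _, _, ?_, hψ⟩
  have hdet := hpos.det_nonneg
  rw [hψ] at hdet
  generalize 2 * (ψ 0 1).re = x at *
  generalize 2 * (ψ 0 1).im = y at *
  generalize 2 * (ψ 0 0).re - 1 = z at *
  rw [det_blochMatrix, Complex.zero_le_real] at hdet
  linarith

lemma cos_sq_half (t : ℝ) : Real.cos (t / 2) ^ 2 = (1 + Real.cos t) / 2 := by
  rw [Real.cos_sq, mul_div_cancel₀ t two_ne_zero]
  ring

lemma sin_sq_half (t : ℝ) : Real.sin (t / 2) ^ 2 = (1 - Real.cos t) / 2 := by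
  rw [Real.sin_sq, cos_sq_half]
  ring

lemma half_add_add_half_sub (u v : ℝ) : (v + u) / 2 + (v - u) / 2 = v := by ring

lemma half_add_sub_half_sub (u v : ℝ) : (v + u) / 2 - (v - u) / 2 = u := by ring

lemma cos_half_sub_mul_cos_half_add (u v : ℝ) :
    Real.cos ((v - u) / 2) * Real.cos ((v + u) / 2) = (Real.cos u + Real.cos v) / 2 := by
  have h1 := Real.cos_add ((v + u) / 2) ((v - u) / 2)
  have h2 := Real.cos_sub ((v + u) / 2) ((v - u) / 2)
  rw [half_add_add_half_sub] at h1
  rw [half_add_sub_half_sub] at h2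
  linarith

lemma sin_half_sub_mul_sin_half_add (u v : ℝ) :
    Real.sin ((v - u) / 2) * Real.sin ((v + u) / 2) = (Real.cos u - Real.cos v) / 2 := by
  have h1 := Real.cos_add ((v + u) / 2) ((v - u) / 2)
  have h2 := Real.cos_sub ((v + u) / 2) ((v - u) / 2)
  rw [half_add_add_half_sub] at h1
  rw [half_add_sub_half_sub] at h2
  linarith

lemma sin_half_sub_mul_cos_half_add (u v : ℝ) :
    Real.sin ((v - u) / 2) * Real.cos ((v + u) / 2) = (Real.sin v - Real.sin u) / 2 := by
  have h1 := Real.sin_add ((v + u) / 2) ((v - u) / 2)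
  have h2 := Real.sin_sub ((v + u) / 2) ((v - u) / 2)
  rw [half_add_add_half_sub] at h1
  rw [half_add_sub_half_sub] at h2
  linarith

lemma sin_half_add_mul_cos_half_sub (u v : ℝ) :
    Real.sin ((v + u) / 2) * Real.cos ((v - u) / 2) = (Real.sin v + Real.sin u) / 2 := by
  have h1 := Real.sin_add ((v + u) / 2) ((v - u) / 2)
  have h2 := Real.sin_sub ((v + u) / 2) ((v - u) / 2)
  rw [half_add_add_half_sub] at h1
  rw [half_add_sub_half_sub] at h2
  linarith

lemma Aplus_conjTranspose (u v : ℝ) : (Aplus u v)ᴴ = Aplus u v := by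
  ext i j
  fin_cases i <;> fin_cases j <;>
    simp [Aplus, Matrix.conjTranspose_apply, -Complex.ofReal_cos]

lemma Aminus_conjTranspose (u v : ℝ) : (Aminus u v)ᴴ =
    !![0, ((Real.sin ((v - u) / 2) : ℝ) : ℂ); ((Real.sin ((v + u) / 2) : ℝ) : ℂ), 0] := by
  ext i j
  fin_cases i <;> fin_cases j <;>
    simp [Aminus, Matrix.conjTranspose_apply, -Complex.ofReal_sin]

lemma Nuv_apply_blochMatrix (u v x y z : ℝ) :
    Aplus u v * blochMatrix x y z * (Aplus u v)ᴴ +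
        Aminus u v * blochMatrix x y z * (Aminus u v)ᴴ =
      blochMatrix (Real.cos u * x) (Real.cos v * y)
        (Real.sin u * Real.sin v + Real.cos u * Real.cos v * z) := by
  have h1 := congrArg Complex.ofReal (cos_sq_half (v - u))
  have h2 := congrArg Complex.ofReal (cos_sq_half (v + u))
  have h3 := congrArg Complex.ofReal (sin_sq_half (v - u))
  have h4 := congrArg Complex.ofReal (sin_sq_half (v + u))
  have h5 := congrArg Complex.ofReal (cos_half_sub_mul_cos_half_add u v)
  have h6 := congrArg Complex.ofReal (sin_half_sub_mul_sin_half_add u v)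
  rw [Real.cos_sub] at h1 h3
  rw [Real.cos_add] at h2 h4
  rw [Aplus_conjTranspose, Aminus_conjTranspose, Aplus, Aminus, blochMatrix, blochMatrix]
  generalize Real.cos ((v - u) / 2) = c1 at *
  generalize Real.cos ((v + u) / 2) = c2 at *
  generalize Real.sin ((v - u) / 2) = s1 at *
  generalize Real.sin ((v + u) / 2) = s2 at *
  generalize Real.cos u = a at *
  generalize Real.cos v = b at *
  generalize Real.sin u = c at *
  generalize Real.sin v = d at *
  push_cast at *
  ext i j
  fin_cases i <;> fin_cases j <;>
    simp [Matrix.add_apply]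
  · linear_combination (1 + (z : ℂ)) / 2 * h1 + (1 - (z : ℂ)) / 2 * h4
  · linear_combination ((x : ℂ) + y * Complex.I) / 2 * h5 + ((x : ℂ) - y * Complex.I) / 2 * h6
  · linear_combination ((x : ℂ) - y * Complex.I) / 2 * h5 + ((x : ℂ) + y * Complex.I) / 2 * h6
  · linear_combination (1 + (z : ℂ)) / 2 * h3 + (1 - (z : ℂ)) / 2 * h2

lemma Nuv_compl_blochMatrix (u v x y z : ℝ) :
    (Matrix.of fun s t => (![Aplus u v, Aminus u v] s * blochMatrix x y z *
        (![Aplus u v, Aminus u v] t)ᴴ).trace) =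
      blochMatrix (Real.sin v * x) (Real.sin u * y)
        (Real.cos u * Real.cos v + Real.sin u * Real.sin v * z) := by
  have h1 := congrArg Complex.ofReal (cos_sq_half (v - u))
  have h2 := congrArg Complex.ofReal (cos_sq_half (v + u))
  have h3 := congrArg Complex.ofReal (sin_sq_half (v - u))
  have h4 := congrArg Complex.ofReal (sin_sq_half (v + u))
  have h5 := congrArg Complex.ofReal (sin_half_sub_mul_cos_half_add u v)
  have h6 := congrArg Complex.ofReal (sin_half_add_mul_cos_half_sub u v)
  rw [Real.cos_sub] at h1 h3
  rw [Real.cos_add] at h2 h4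
  rw [Aplus, Aminus, blochMatrix, blochMatrix]
  generalize Real.cos ((v - u) / 2) = c1 at *
  generalize Real.cos ((v + u) / 2) = c2 at *
  generalize Real.sin ((v - u) / 2) = s1 at *
  generalize Real.sin ((v + u) / 2) = s2 at *
  generalize Real.cos u = a at *
  generalize Real.cos v = b at *
  generalize Real.sin u = c at *
  generalize Real.sin v = d at *
  push_cast at *
  ext i j
  fin_cases i <;> fin_cases j <;>
    simp [Matrix.trace_fin_two, Matrix.mul_apply, Fin.sum_univ_two]
  · linear_combination (1 + (z : ℂ)) / 2 * h1 + (1 - (z : ℂ)) / 2 * h2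
  · linear_combination ((x : ℂ) - y * Complex.I) / 2 * h5 + ((x : ℂ) + y * Complex.I) / 2 * h6
  · linear_combination ((x : ℂ) + y * Complex.I) / 2 * h5 + ((x : ℂ) - y * Complex.I) / 2 * h6
  · linear_combination (1 + (z : ℂ)) / 2 * h3 + (1 - (z : ℂ)) / 2 * h4

/-- The Kraus operator `(1/√24) L ⊗ |k⟩`. -/
noncomputable def flagged (k : Fin 24) (L : Matrix (Fin 2) (Fin 2) ℂ) :
    Matrix (Fin 2 × Fin 24) (Fin 2) ℂ :=
  Matrix.of fun bf a => if bf.2 = k then ((Real.sqrt 24)⁻¹ : ℂ) * L bf.1 a else 0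

lemma flagged_mul_mul_apply (k l : Fin 24) (L M φ : Matrix (Fin 2) (Fin 2) ℂ)
    (a b : Fin 2 × Fin 24) : (flagged k L * φ * (flagged l M)ᴴ) a b =
      if a.2 = k ∧ b.2 = l then (24 : ℂ)⁻¹ * (L * φ * Mᴴ) a.1 b.1 else 0 := by
  have h24 : ((√24 : ℝ) : ℂ)⁻¹ * ((√24 : ℝ) : ℂ)⁻¹ = (24 : ℂ)⁻¹ := by
    rw [← mul_inv, ← Complex.ofReal_mul, Real.mul_self_sqrt (by norm_num)]
    norm_num
  simp only [flagged, Matrix.mul_apply, Matrix.conjTranspose_apply, Matrix.of_apply,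
    Fin.sum_univ_two]
  by_cases ha : a.2 = k <;> by_cases hb : b.2 = l
  · simp only [ha, hb, and_self, if_true, ← h24, star_mul', star_inv₀]
    rw [show star ((√24 : ℝ) : ℂ) = ((√24 : ℝ) : ℂ) from Complex.conj_ofReal _]
    ring
  all_goals simp [ha, hb]

lemma Tdep_apply (u v : ℝ) {c : Fin 24 → Matrix (Fin 2) (Fin 2) ℂ}
    (φ : Matrix (Fin 2) (Fin 2) ℂ) :
    (Tdep u v c).apply φ = Matrix.blockDiagonal fun k => (24 : ℂ)⁻¹ • ((c k)ᴴ *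
      (Aplus u v * (c k * φ * (c k)ᴴ) * (Aplus u v)ᴴ +
        Aminus u v * (c k * φ * (c k)ᴴ) * (Aminus u v)ᴴ) * c k) := by
  ext ⟨i, f⟩ ⟨j, g⟩
  have e : (Tdep u v c).apply φ = ∑ x : Fin 24 × Fin 2,
      flagged x.1 ((c x.1)ᴴ * ![Aplus u v, Aminus u v] x.2 * c x.1) * φ *
        (flagged x.1 ((c x.1)ᴴ * ![Aplus u v, Aminus u v] x.2 * c x.1))ᴴ := rfl
  rw [e, Matrix.sum_apply]
  simp only [flagged_mul_mul_apply, Fintype.sum_prod_type, Fin.sum_univ_two,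
    Matrix.blockDiagonal_apply]
  by_cases hfg : f = g
  · subst hfg
    simp only [and_self, if_true, Finset.sum_add_distrib, Finset.sum_ite_eq, Finset.mem_univ,
      Matrix.cons_val_zero, Matrix.cons_val_one]
    rw [← mul_add, ← Matrix.add_apply, Matrix.smul_apply, smul_eq_mul]
    simp only [Matrix.conjTranspose_mul, Matrix.conjTranspose_conjTranspose,
      Matrix.mul_add, Matrix.add_mul, Matrix.mul_assoc]
  · rw [if_neg hfg]
    refine Finset.sum_eq_zero fun k _ => ?_
    have : ¬ (f = k ∧ g = k) := fun h => hfg (h.1.trans h.2.symm)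
    simp [this]

lemma Tdep_compl (u v : ℝ) {c : Fin 24 → Matrix (Fin 2) (Fin 2) ℂ}
    (hc : ∀ k, c k ∈ Matrix.unitaryGroup (Fin 2) ℂ) (φ : Matrix (Fin 2) (Fin 2) ℂ) :
    (Tdep u v c).compl φ = Matrix.reindex (Equiv.prodComm (Fin 2) (Fin 24))
      (Equiv.prodComm (Fin 2) (Fin 24)) (Matrix.blockDiagonal fun k => (24 : ℂ)⁻¹ •
        Matrix.of fun s t => (![Aplus u v, Aminus u v] s * (c k * φ * (c k)ᴴ) *
          (![Aplus u v, Aminus u v] t)ᴴ).trace) := by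
  ext ⟨f, s⟩ ⟨g, t⟩
  change (flagged f ((c f)ᴴ * ![Aplus u v, Aminus u v] s * c f) * φ *
    (flagged g ((c g)ᴴ * ![Aplus u v, Aminus u v] t * c g))ᴴ).trace = _
  rw [Matrix.trace]
  simp only [Matrix.diag_apply, flagged_mul_mul_apply, Fintype.sum_prod_type, Matrix.reindex_apply,
    Matrix.submatrix_apply, Equiv.prodComm_symm, Equiv.prodComm_apply, Prod.swap_prod_mk,
    Matrix.blockDiagonal_apply]
  by_cases hfg : f = g
  · subst hfg
    have hcc : c f * (c f)ᴴ = 1 := (Matrix.mem_unitaryGroup_iff (A := c f)).1 (hc f)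
    have e : ((c f)ᴴ * ![Aplus u v, Aminus u v] s * c f * φ *
        ((c f)ᴴ * ![Aplus u v, Aminus u v] t * c f)ᴴ).trace =
        (![Aplus u v, Aminus u v] s * (c f * φ * (c f)ᴴ) *
          (![Aplus u v, Aminus u v] t)ᴴ).trace := by
      simp only [Matrix.conjTranspose_mul, Matrix.conjTranspose_conjTranspose, Matrix.mul_assoc]
      rw [Matrix.trace_mul_comm]
      simp only [Matrix.mul_assoc, hcc, Matrix.mul_one]
    simp only [and_self, Finset.sum_ite_eq', Finset.mem_univ, if_true, Matrix.smul_apply,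
      Matrix.of_apply, ← Finset.mul_sum, smul_eq_mul]
    exact congrArg _ e
  · rw [if_neg hfg]
    refine Finset.sum_eq_zero fun i _ => Finset.sum_eq_zero fun k _ => ?_
    rw [if_neg fun h => hfg (h.1.symm.trans h.2)]

/-- The coherent information of the twirled channel is the average of that of `Nuv u v` over the
conjugates of the input. -/
lemma cohInfo_Tdep {u v : ℝ} {c : Fin 24 → Matrix (Fin 2) (Fin 2) ℂ}
    (hc : ∀ k, c k ∈ Matrix.unitaryGroup (Fin 2) ℂ) {φ : Matrix (Fin 2) (Fin 2) ℂ}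
    (hφ : φ.IsHermitian) {x y z : Fin 24 → ℝ}
    (hb : ∀ k, c k * φ * (c k)ᴴ = blochMatrix (x k) (y k) (z k)) :
    cohInfo (Tdep u v c) φ = (∑ k, blochGap u v (x k) (y k) (z k)) / (24 * Real.log 2) := by
  have hcc : ∀ k, c k * (c k)ᴴ = 1 := fun k => (Matrix.mem_unitaryGroup_iff (A := c k)).1 (hc k)
  have hA := (Tdep u v c).isHermitian_apply hφ
  have hB := (Tdep u v c).isHermitian_compl hφ
  have hdet : ∀ k, ((c k)ᴴ).det * (c k).det = 1 := fun k => by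
    rw [mul_comm, ← Matrix.det_mul, hcc, Matrix.det_one]
  have htr : ∀ k (M : Matrix (Fin 2) (Fin 2) ℂ), ((c k)ᴴ * M * c k).trace = M.trace :=
    fun k M => by rw [Matrix.trace_mul_comm, ← Matrix.mul_assoc, hcc, Matrix.one_mul]
  have hdet' : ∀ k (M : Matrix (Fin 2) (Fin 2) ℂ), ((c k)ᴴ * M * c k).det = M.det :=
    fun k M => by
      rw [Matrix.det_mul, Matrix.det_mul]
      linear_combination M.det * hdet k
  rw [cohInfo]
  rw [Tdep_apply] at hA ⊢
  rw [Tdep_compl u v hc] at hB ⊢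
  have hB' : (Matrix.blockDiagonal fun k => (24 : ℂ)⁻¹ •
        Matrix.of fun s t => (![Aplus u v, Aminus u v] s * (c k * φ * (c k)ᴴ) *
          (![Aplus u v, Aminus u v] t)ᴴ).trace).IsHermitian :=
    hB.submatrix (Equiv.prodComm (Fin 2) (Fin 24))
  erw [vnEntropy_reindex _ hB']
  simp only [hb, Nuv_apply_blochMatrix, Nuv_compl_blochMatrix] at hA hB' ⊢
  rw [vnEntropy_blockDiagonal_fin_two (w := 24⁻¹) (s := fun k => outSq u v (x k) (y k) (z k))
      (fun k => outSq_nonneg ..) hA,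
    vnEntropy_blockDiagonal_fin_two (w := 24⁻¹) (s := fun k => envSq u v (x k) (y k) (z k))
      (fun k => envSq_nonneg ..) hB', ← Finset.sum_sub_distrib, Finset.sum_div]
  · refine Finset.sum_congr rfl fun k _ => ?_
    rw [blochGap]
    field_simp
    ring
  · intro k
    rw [Matrix.trace_smul, trace_blochMatrix]
    simp
  · intro k
    rw [Matrix.det_smul, det_blochMatrix, envSq]
    push_cast
    simp [div_eq_mul_inv, mul_assoc]
  · intro k
    rw [Matrix.trace_smul, htr, trace_blochMatrix]
    simp
  · intro k
    rw [Matrix.det_smul, hdet', det_blochMatrix, outSq]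
    push_cast
    simp [div_eq_mul_inv, mul_assoc]

/-- The Pauli matrix `X`. -/
def pauliX : Matrix (Fin 2) (Fin 2) ℂ := !![0, 1; 1, 0]

lemma pauliX_mul_blochMatrix_mul (x y z : ℝ) :
    pauliX * blochMatrix x y z * pauliXᴴ = blochMatrix x (-y) (-z) := by
  ext i j
  fin_cases i <;> fin_cases j <;>
    simp [pauliX, blochMatrix, Matrix.conjTranspose_apply, Matrix.mul_apply, Fin.sum_univ_two,
      sub_eq_add_neg]

lemma pauliX_mul_self : pauliX * pauliX = 1 := by
  ext i j
  fin_cases i <;> fin_cases j <;> simp [pauliX, Matrix.mul_apply]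

lemma sqrt_two_inv_mul_self : ((√2 : ℝ) : ℂ)⁻¹ * ((√2 : ℝ) : ℂ)⁻¹ = (2 : ℂ)⁻¹ := by
  rw [← mul_inv, ← Complex.ofReal_mul, Real.mul_self_sqrt (by norm_num)]
  norm_num

lemma pauliX_eq : pauliX = Had * (Sgate * Sgate) * Had := by
  rw [Had, Matrix.smul_mul, Matrix.smul_mul, Matrix.mul_smul, smul_smul, sqrt_two_inv_mul_self]
  ext i j
  fin_cases i <;> fin_cases j <;> simp [pauliX, Sgate] <;>
    norm_num

lemma pauliX_mem_closure : pauliX ∈ Submonoid.closure {Had, Sgate} := by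
  rw [pauliX_eq]
  have hH : Had ∈ Submonoid.closure {Had, Sgate} := Submonoid.subset_closure (by simp)
  have hS : Sgate ∈ Submonoid.closure {Had, Sgate} := Submonoid.subset_closure (by simp)
  exact mul_mem (mul_mem hH (mul_mem hS hS)) hH

lemma closure_le_unitaryGroup :
    Submonoid.closure {Had, Sgate} ≤ Matrix.unitaryGroup (Fin 2) ℂ := by
  rw [Submonoid.closure_le]
  rintro _ (rfl | rfl) <;> rw [SetLike.mem_coe, Matrix.mem_unitaryGroup_iff]
  · have hs : star Had = Had := by
      ext i j
      fin_cases i <;> fin_cases j <;> simp [Had, Matrix.star_apply]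
    rw [hs, Had, Matrix.smul_mul, Matrix.mul_smul, smul_smul, sqrt_two_inv_mul_self]
    ext i j
    fin_cases i <;> fin_cases j <;> simp <;> norm_num
  · ext i j
    fin_cases i <;> fin_cases j <;>
      simp [Sgate, Matrix.star_apply, Matrix.mul_apply, Fin.sum_univ_two]

lemma smul_conj_of_unitary {A : Matrix (Fin 2) (Fin 2) ℂ} {w : ℂ}
    (hA : A ∈ Matrix.unitaryGroup (Fin 2) ℂ) (hwA : w • A ∈ Matrix.unitaryGroup (Fin 2) ℂ)
    (φ : Matrix (Fin 2) (Fin 2) ℂ) : (w • A) * φ * (w • A)ᴴ = A * φ * Aᴴ := by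
  have h1 : A * Aᴴ = 1 := Matrix.mem_unitaryGroup_iff.1 hA
  have h2 : (w • A) * (w • A)ᴴ = 1 := Matrix.mem_unitaryGroup_iff.1 hwA
  rw [Matrix.conjTranspose_smul, Matrix.smul_mul, Matrix.mul_smul, smul_smul, h1] at h2
  have h3 : w * star w = 1 := by simpa using congrFun (congrFun h2 0) 0
  rw [Matrix.conjTranspose_smul, Matrix.smul_mul, Matrix.smul_mul, Matrix.mul_smul, smul_smul, h3,
    one_smul]

/-- Left multiplication by `X` permutes a Clifford family, up to phases. -/
lemma exists_perm_pauliX_conj {c : Fin 24 → Matrix (Fin 2) (Fin 2) ℂ} (hc : IsCliffordFamily c) :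
    ∃ σ : Equiv.Perm (Fin 24), ∀ i (φ : Matrix (Fin 2) (Fin 2) ℂ),
      c (σ i) * φ * (c (σ i))ᴴ = pauliX * (c i * φ * (c i)ᴴ) * pauliXᴴ := by
  obtain ⟨hU, hz, huniq⟩ := hc
  choose z hz using hz
  have hXz : ∀ i, pauliX * z i • c i ∈ Submonoid.closure {Had, Sgate} :=
    fun i => mul_mem pauliX_mem_closure (hz i)
  have hex : ∀ i, ∃ j, ∃ w : ℂ, pauliX * z i • c i = w • c j := fun i => (huniq _ (hXz i)).exists
  choose f w hf using hex
  have hz0 : ∀ i, z i ≠ 0 := by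
    intro i h0
    have h := Matrix.mem_unitaryGroup_iff.1 (closure_le_unitaryGroup (hz i))
    rw [h0, zero_smul, zero_mul] at h
    exact zero_ne_one h
  have hw0 : ∀ i, w i ≠ 0 := by
    intro i h0
    have h := Matrix.mem_unitaryGroup_iff.1 (closure_le_unitaryGroup (hXz i))
    rw [hf, h0, zero_smul, zero_mul] at h
    exact zero_ne_one h
  have hinj : Function.Injective f := by
    intro i j hij
    have e : ∀ i, z i • c i = w i • (pauliX * c (f i)) := fun i => by
      rw [← Matrix.mul_smul, ← hf, ← Matrix.mul_assoc, pauliX_mul_self, Matrix.one_mul]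
    refine (huniq _ (hz i)).unique ⟨z i, rfl⟩ ⟨w i * (w j)⁻¹ * z j, ?_⟩
    rw [mul_smul, e j, smul_smul, mul_assoc, inv_mul_cancel₀ (hw0 j), mul_one, e i, hij]
  refine ⟨Equiv.ofBijective f (Finite.injective_iff_bijective.1 hinj), fun i φ => ?_⟩
  rw [Equiv.ofBijective_apply, ← smul_conj_of_unitary (w := w i) (hU (f i)) ?_, ← hf,
    Matrix.conjTranspose_mul, ← smul_conj_of_unitary (hU i) (closure_le_unitaryGroup (hz i))]
  · simp only [Matrix.mul_assoc]
  · rw [← hf]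
    exact closure_le_unitaryGroup (hXz i)

lemma blochMatrix_injective {x y z x' y' z' : ℝ} (h : blochMatrix x y z = blochMatrix x' y' z') :
    x = x' ∧ y = y' ∧ z = z' := by
  have h00 := congrArg Complex.re (congrFun (congrFun h 0) 0)
  have h01 := congrFun (congrFun h 0) 1
  have h01r := congrArg Complex.re h01
  have h01i := congrArg Complex.im h01
  simp [blochMatrix] at h00 h01r h01i
  exact ⟨by linarith, by linarith, by linarith⟩

lemma blochMatrix_zero : blochMatrix 0 0 0 = (2 : ℂ)⁻¹ • 1 := by
  ext i j
  fin_cases i <;> fin_cases j <;> simp [blochMatrix]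

lemma blochGap_zero (u v : ℝ) : blochGap u v 0 0 0 / Real.log 2 =
    binEnt ((1 + Real.sin u * Real.sin v) / 2) - binEnt ((1 + Real.cos u * Real.cos v) / 2) := by
  rw [blochGap_axis, binEnt_eq, binEnt_eq, ← sub_div]
  simp [biasEntropy]


/-- For reals `u, v` with `|sin v| ≤ |cos u|`,
`Q^{(1)}(T^dep_(u,v)) = H(½(1 + sin u sin v)) − H(½(1 + cos u cos v))`. -/
theorem Q1_Tdep (u v : ℝ) (huv : |Real.sin v| ≤ |Real.cos u|)
    (c : Fin 24 → Matrix (Fin 2) (Fin 2) ℂ) (hc : IsCliffordFamily c) :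
    Q1 (Tdep u v c) =
      binEnt ((1 + Real.sin u * Real.sin v) / 2) -
      binEnt ((1 + Real.cos u * Real.cos v) / 2) := by
  rw [← blochGap_zero]
  have hU := hc.1
  have hcc : ∀ k, c k * (c k)ᴴ = 1 := fun k => (Matrix.mem_unitaryGroup_iff (A := c k)).1 (hU k)
  have hlog : 0 < Real.log 2 := Real.log_pos one_lt_two
  refine IsGreatest.csSup_eq ⟨⟨(2 : ℂ)⁻¹ • 1, ⟨?_, ?_⟩, ?_⟩, ?_⟩
  · exact Matrix.PosSemidef.one.smul (by simp)
  · simp [Matrix.trace_smul]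
  · rw [cohInfo_Tdep hU (x := 0) (y := 0) (z := 0) ?_ fun k => ?_]
    · simp only [Pi.zero_apply, Finset.sum_const, Finset.card_univ, Fintype.card_fin,
        nsmul_eq_mul]
      field_simp
      norm_num
    · rw [← blochMatrix_zero]
      ext i j
      fin_cases i <;> fin_cases j <;> simp [blochMatrix]
    · simp only [Pi.zero_apply]
      rw [blochMatrix_zero, Matrix.mul_smul, Matrix.smul_mul, Matrix.mul_one, hcc]
  · rintro _ ⟨φ, hφ, rfl⟩
    have hd : ∀ k, IsDensity (c k * φ * (c k)ᴴ) := fun k =>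
      ⟨hφ.1.mul_mul_conjTranspose_same _, by
        rw [Matrix.trace_mul_comm, ← Matrix.mul_assoc,
          show (c k)ᴴ * c k = 1 from Matrix.mem_unitaryGroup_iff'.1 (hU k), Matrix.one_mul, hφ.2]⟩
    choose x y z hr hb using fun k => exists_eq_blochMatrix (hd k)
    rw [cohInfo_Tdep hU hφ.1.isHermitian hb, div_mul_eq_div_div,
      div_le_div_iff_of_pos_right hlog, div_le_iff₀ (by norm_num)]
    obtain ⟨σ, hσ⟩ := exists_perm_pauliX_conj hc
    have hflip : ∀ k, blochGap u v (x (σ k)) (y (σ k)) (z (σ k)) =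
        blochGap u v (x k) (-y k) (-z k) := by
      intro k
      have h := hσ k φ
      rw [hb, hb, pauliX_mul_blochMatrix_mul] at h
      obtain ⟨h1, h2, h3⟩ := blochMatrix_injective h
      rw [h1, h2, h3]
    have hsum := Equiv.sum_comp σ fun k => blochGap u v (x k) (y k) (z k)
    simp only [hflip] at hsum
    have hle := Finset.sum_le_sum fun k (_ : k ∈ Finset.univ) =>
      blochGap_add_blochGap_neg_le huv (hr k)
    rw [Finset.sum_add_distrib, hsum] at hle
    simp only [Finset.sum_const, Finset.card_univ, Fintype.card_fin, nsmul_eq_mul] at hle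
    push_cast at hle
    linarith
end
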